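/- Let (u, p, v) be a C^∞ solution of the stationary simplified Ericksen–Leslie system on ℝ³ with |v(x)| = 1 for all x, and assume sup_{R ≥ 1} ∫_{C(R/2,R)} |∇v|² dx < +∞. Let 0 < γ < 3 ≤ p < +∞ be such that η(γ,p) = γ/p − 3/p + 2/3 > 0. If u belongs to M^p_{γ,0}(ℝ³), each component of ∇v belongs to M^p_γ(ℝ³), and moreover lim_{R→+∞} R^{3η(γ,p)} ( R^{−γ} ∫_{C(R/2,R)} |u|^p dx )^{1/p} = 0, then u ≡ 0, ∇v ≡ 0 (so v is a constant unit vector) and p is a constant function. -/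

import Mathlib

open MeasureTheory Filter Metric Real

noncomputable section

/-- Three-dimensional Euclidean space. -/
abbrev E3 : Type := EuclideanSpace ℝ (Fin 3)

/-- Partial derivative `∂_j f` of a scalar field. -/
def pd (j : Fin 3) (f : E3 → ℝ) (x : E3) : ℝ :=
  fderiv ℝ f x (EuclideanSpace.single j 1)

/-- Laplacian of a scalar field. -/
def lap (f : E3 → ℝ) (x : E3) : ℝ := ∑ j, pd j (pd j f) x

/-- The annulus `C(R/2, R)`. -/
def ann (R : ℝ) : Set E3 := {x : E3 | R / 2 < ‖x‖ ∧ ‖x‖ < R}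

/-- Euclidean length `|u(x)|` of a vector field. -/
def vecNorm (u : E3 → Fin 3 → ℝ) (x : E3) : ℝ := Real.sqrt (∑ i, (u x i) ^ 2)

/-- `|∇v|² = Σ_{i,k} (∂_i v_k)²`. -/
def gradSq (v : E3 → Fin 3 → ℝ) (x : E3) : ℝ :=
  ∑ i, ∑ k, (pd i (fun y => v y k) x) ^ 2

/-- The stationary simplified Ericksen–Leslie system:
`−Δu + (u·∇)u + div(∇v ⊙ ∇v) + ∇p = 0`, `−Δv + (u·∇)v − |∇v|² v = 0`, `div u = 0`. -/
def StatEL (u : E3 → Fin 3 → ℝ) (P : E3 → ℝ) (v : E3 → Fin 3 → ℝ) : Prop :=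
  (∀ x : E3, ∀ i : Fin 3,
    -(lap (fun y => u y i) x) + (∑ j, u x j * pd j (fun y => u y i) x)
      + (∑ j, ∑ k, pd j (fun y => pd i (fun z => v z k) y * pd j (fun z => v z k) y) x)
      + pd i P x = 0) ∧
  (∀ x : E3, ∀ i : Fin 3,
    -(lap (fun y => v y i) x) + (∑ j, u x j * pd j (fun y => v y i) x)
      - gradSq v x * v x i = 0) ∧
  (∀ x : E3, ∑ j, pd j (fun y => u y j) x = 0)

/-- Membership in the local Morrey space `M^p_γ(ℝ³)`. -/
def MemMorrey (p γ : ℝ) (f : E3 → ℝ) : Prop :=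
  LocallyIntegrable (fun x => |f x| ^ p) volume ∧
  ∃ C : ℝ, ∀ R : ℝ, 1 ≤ R → R ^ (-γ) * ∫ x in ball (0 : E3) R, |f x| ^ p ≤ C

/-- Membership in `M^p_{γ,0}(ℝ³)`. -/
def MemMorrey0 (p γ : ℝ) (f : E3 → ℝ) : Prop :=
  MemMorrey p γ f ∧
  Tendsto (fun R : ℝ => R ^ (-γ) * ∫ x in ann R, |f x| ^ p) atTop (nhds 0)

/-- Smooth scalar fields. -/
abbrev Smooth3 (f : E3 → ℝ) : Prop := ContDiff ℝ (⊤ : ℕ∞) f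

section PartialDerivatives

variable {f g : E3 → ℝ} {j : Fin 3} {x : E3}

lemma Smooth3.differentiableAt (hf : Smooth3 f) (x : E3) : DifferentiableAt ℝ f x :=
  hf.contDiffAt.differentiableAt (by simp)

lemma Smooth3.pd (hf : Smooth3 f) (j : Fin 3) : Smooth3 (pd j f) := by
  have h : ContDiff ℝ (⊤ : ℕ∞) (fderiv ℝ f) := hf.fderiv_right (by simp)
  exact h.clm_apply contDiff_const

lemma pd_add (hf : DifferentiableAt ℝ f x) (hg : DifferentiableAt ℝ g x) :
    pd j (fun y => f y + g y) x = pd j f x + pd j g x := by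
  simp [pd, fderiv_fun_add hf hg]

lemma pd_sub (hf : DifferentiableAt ℝ f x) (hg : DifferentiableAt ℝ g x) :
    pd j (fun y => f y - g y) x = pd j f x - pd j g x := by
  simp [pd, fderiv_fun_sub hf hg]

lemma pd_mul (hf : DifferentiableAt ℝ f x) (hg : DifferentiableAt ℝ g x) :
    pd j (fun y => f y * g y) x = pd j f x * g x + f x * pd j g x := by
  simp [pd, fderiv_fun_mul hf hg]; ring

lemma pd_const_mul (c : ℝ) (hf : DifferentiableAt ℝ f x) :
    pd j (fun y => c * f y) x = c * pd j f x := by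
  simp [pd, fderiv_const_mul hf]

lemma pd_sum {ι : Type*} {s : Finset ι} {F : ι → E3 → ℝ}
    (h : ∀ i ∈ s, DifferentiableAt ℝ (F i) x) :
    pd j (fun y => ∑ i ∈ s, F i y) x = ∑ i ∈ s, pd j (F i) x := by
  simp [pd, fderiv_fun_sum h]

lemma pd_comm (hf : Smooth3 f) (i j : Fin 3) (x : E3) : pd i (pd j f) x = pd j (pd i f) x := by
  have hs : IsSymmSndFDerivAt ℝ f x :=
    hf.contDiffAt.isSymmSndFDerivAt (by
      simpa using WithTop.coe_le_coe.2 (le_top : (2 : ℕ∞) ≤ ⊤))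
  have hd : DifferentiableAt ℝ (fderiv ℝ f) x :=
    (hf.fderiv_right (m := (⊤ : ℕ∞)) (by simp)).contDiffAt.differentiableAt (by simp)
  have key : ∀ a b : Fin 3, pd a (pd b f) x
      = fderiv ℝ (fderiv ℝ f) x (EuclideanSpace.single a 1) (EuclideanSpace.single b 1) := by
    intro a b
    change fderiv ℝ (fun y => fderiv ℝ f y (EuclideanSpace.single b 1)) x _ = _
    rw [fderiv_clm_apply hd (by fun_prop)]
    simp
  rw [key, key]
  exact hs _ _

lemma pd_eq_zero_of_eqOn_compl {q : ℝ} (h : ∀ y, q < ‖y‖ → f y = 0) (hx : q < ‖x‖) :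
    pd j f x = 0 := by
  have : f =ᶠ[nhds x] fun _ => 0 := by
    have ho : IsOpen {y : E3 | q < ‖y‖} := isOpen_lt continuous_const continuous_norm
    filter_upwards [ho.mem_nhds hx] with y hy using h y hy
  simp [pd, this.fderiv_eq]

lemma hasCompactSupport_of_eq_zero {q : ℝ} (h : ∀ y : E3, q < ‖y‖ → f y = 0) :
    HasCompactSupport f := by
  refine HasCompactSupport.intro (isCompact_closedBall (0 : E3) q) ?_
  intro y hy
  exact h y (by simpa using hy)

/-- Integration by parts against a compactly supported field. -/
lemma integral_mul_pd (hf : ContDiff ℝ 1 f) (hg : ContDiff ℝ 1 g) (hc : HasCompactSupport g)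
    (j : Fin 3) : ∫ x, f x * pd j g x = -∫ x, pd j f x * g x := by
  have hcf : Continuous (fun x => fderiv ℝ f x (EuclideanSpace.single j 1)) :=
    (hf.continuous_fderiv (by simp)).clm_apply continuous_const
  have hcg : Continuous (fun x => fderiv ℝ g x (EuclideanSpace.single j 1)) :=
    (hg.continuous_fderiv (by simp)).clm_apply continuous_const
  refine integral_mul_fderiv_eq_neg_fderiv_mul_of_integrable ?_ ?_ ?_ ?_ ?_
  · exact (hcf.mul hg.continuous).integrable_of_hasCompactSupport hc.mul_left
  · exact (hf.continuous.mul hcg).integrable_of_hasCompactSupport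
      (hc.fderiv_apply (𝕜 := ℝ) _).mul_left
  · exact (hf.continuous.mul hg.continuous).integrable_of_hasCompactSupport hc.mul_left
  · exact fun x _ => hf.contDiffAt.differentiableAt (by simp)
  · exact fun x _ => hg.contDiffAt.differentiableAt (by simp)

end PartialDerivatives

/-- A continuous function vanishing outside a closed ball has its integral controlled by any
continuous majorant on the ball. -/
lemma abs_integral_le_of_le {F M : E3 → ℝ} {q : ℝ} (hM : Continuous M)
    (hz : ∀ x, q < ‖x‖ → F x = 0) (hle : ∀ x, ‖x‖ ≤ q → |F x| ≤ M x) :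
    |∫ x, F x| ≤ ∫ x in closedBall (0 : E3) q, M x := by
  rw [← setIntegral_eq_integral_of_forall_compl_eq_zero (s := closedBall (0 : E3) q)
    (fun x hx => hz x (by simpa using hx))]
  have := norm_integral_le_of_norm_le (μ := volume.restrict (closedBall (0 : E3) q)) (f := F)
    (g := M) (hM.continuousOn.integrableOn_compact (isCompact_closedBall _ _)) (by
      refine (ae_restrict_iff' measurableSet_closedBall).2 (ae_of_all _ fun x hx => ?_)
      exact hle x (by simpa using hx))
  simpa using this

lemma integrableOn_closedBall {F : E3 → ℝ} (hF : Continuous F) (c : E3) (q : ℝ) :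
    IntegrableOn F (closedBall c q) :=
  hF.continuousOn.integrableOn_compact (isCompact_closedBall _ _)

lemma setIntegral_closedBall_mono {F G : E3 → ℝ} (hF : Continuous F) (hG : Continuous G) {q : ℝ}
    (h : ∀ x, ‖x‖ ≤ q → F x ≤ G x) :
    ∫ x in closedBall (0 : E3) q, F x ≤ ∫ x in closedBall (0 : E3) q, G x :=
  setIntegral_mono_on (integrableOn_closedBall hF _ _) (integrableOn_closedBall hG _ _)
    measurableSet_closedBall fun x hx => h x (by simpa using hx)

lemma setIntegral_closedBall_mono_radius {F : E3 → ℝ} (hF : Continuous F) (h0 : ∀ x, 0 ≤ F x)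
    {q ρ : ℝ} (hq : q ≤ ρ) :
    ∫ x in closedBall (0 : E3) q, F x ≤ ∫ x in closedBall (0 : E3) ρ, F x :=
  setIntegral_mono_set (integrableOn_closedBall hF _ _) (ae_of_all _ h0)
    (Eventually.of_forall (closedBall_subset_closedBall hq))

lemma hasFDerivAt_setIntegral_of_continuous {Y : Type*} [TopologicalSpace Y] [MeasurableSpace Y]
    [OpensMeasurableSpace Y] [SecondCountableTopology Y] {μ : Measure Y}
    [IsFiniteMeasureOnCompacts μ] {H : Type*} [NormedAddCommGroup H] [NormedSpace ℝ H]
    [FiniteDimensional ℝ H] {F : H → Y → ℝ} {F' : H → Y → H →L[ℝ] ℝ} {K : Set Y}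
    (hK : IsCompact K) (hKm : MeasurableSet K)
    (hF : Continuous (Function.uncurry F)) (hF' : Continuous (Function.uncurry F'))
    (hd : ∀ x y, HasFDerivAt (fun z => F z y) (F' x y) x) (x₀ : H) :
    HasFDerivAt (fun x => ∫ y in K, F x y ∂μ) (∫ y in K, F' x₀ y ∂μ) x₀ := by
  obtain ⟨M, hM⟩ := ((isCompact_closedBall x₀ 1).prod hK).bddAbove_image hF'.norm.continuousOn
  have hFx : ∀ x, Continuous (F x) := fun x => hF.comp (by fun_prop : Continuous fun y => (x, y))
  have hF'x : ∀ x, Continuous (F' x) := fun x => hF'.comp (by fun_prop : Continuous fun y => (x, y))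
  have : IsFiniteMeasure (μ.restrict K) := ⟨by simpa using hK.measure_lt_top⟩
  refine hasFDerivAt_integral_of_dominated_of_fderiv_le (s := closedBall x₀ 1)
    (bound := fun _ => M) (closedBall_mem_nhds _ one_pos) ?_ ?_ ?_ ?_ ?_ ?_
  · exact Eventually.of_forall fun x => (hFx x).aestronglyMeasurable
  · exact (hFx x₀).continuousOn.integrableOn_compact' hK hKm
  · exact (hF'x x₀).aestronglyMeasurable
  · refine (ae_restrict_iff' hKm).2 (ae_of_all _ fun y hy x hx => ?_)
    exact hM ⟨(x, y), ⟨hx, hy⟩, rfl⟩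
  · exact integrable_const _
  · exact ae_of_all _ fun y x _ => hd x y

section Averages

/-- Weighted averages `∫_{|y| ≤ 1} k(y) f(x - s y) dy`. -/
def av (k f : E3 → ℝ) (s : ℝ) (x : E3) : ℝ :=
  ∫ y in closedBall (0 : E3) 1, k y * f (x - s • y)

/-- Unweighted averages `∫_{|y| ≤ 1} f(x - s y) dy`. -/
def avg (f : E3 → ℝ) (s : ℝ) (x : E3) : ℝ :=
  ∫ y in closedBall (0 : E3) 1, f (x - s • y)

lemma continuous_av {k f : E3 → ℝ} (hk : Continuous k) (hf : Continuous f) :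
    Continuous (fun z : ℝ × E3 => av k f z.1 z.2) := by
  refine continuous_parametric_integral_of_continuous
    (f := fun (z : ℝ × E3) (y : E3) => k y * f (z.2 - z.1 • y)) ?_ (isCompact_closedBall _ _)
  unfold Function.uncurry
  fun_prop

lemma continuous_av_right {k f : E3 → ℝ} (hk : Continuous k) (hf : Continuous f) (s : ℝ) :
    Continuous (av k f s) :=
  (continuous_av hk hf).comp (by fun_prop : Continuous fun x : E3 => (s, x))

lemma continuous_avg {f : E3 → ℝ} (hf : Continuous f) (s : ℝ) : Continuous (avg f s) := by
  have h : avg f s = av (fun _ => 1) f s := by funext x; simp [av, avg]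
  exact h ▸ continuous_av_right continuous_const hf s

lemma avg_nonneg {f : E3 → ℝ} (h0 : ∀ x, 0 ≤ f x) (s : ℝ) (x : E3) : 0 ≤ avg f s x :=
  integral_nonneg fun _ => h0 _

lemma abs_av_le {k f g : E3 → ℝ} {C : ℝ} (hk : ∀ y, |k y| ≤ C)
    (hg : Continuous g) (hfg : ∀ x, |f x| ≤ g x) (s : ℝ) (x : E3) :
    |av k f s x| ≤ C * avg g s x := by
  have h := norm_integral_le_of_norm_le (μ := volume.restrict (closedBall (0 : E3) 1))
    (f := fun y => k y * f (x - s • y)) (g := fun y => C * g (x - s • y))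
    (integrableOn_closedBall (by fun_prop) _ _) (ae_of_all _ fun y => by
      rw [norm_mul]
      exact mul_le_mul (hk y) (hfg _) (norm_nonneg _) ((abs_nonneg _).trans (hk y)))
  simpa [av, avg, integral_const_mul] using h

lemma hasFDerivAt_av {k f : E3 → ℝ} (hk : Continuous k) (hf : Smooth3 f) (s : ℝ) (x : E3) :
    HasFDerivAt (av k f s) (∫ y in closedBall (0 : E3) 1, k y • fderiv ℝ f (x - s • y)) x := by
  have hfc : Continuous (fderiv ℝ f) := hf.continuous_fderiv (by simp)
  refine hasFDerivAt_setIntegral_of_continuous (F := fun x y => k y * f (x - s • y))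
    (F' := fun x y => k y • fderiv ℝ f (x - s • y)) (isCompact_closedBall _ _)
    measurableSet_closedBall ?_ ?_ ?_ x
  · have := hf.continuous
    unfold Function.uncurry; fun_prop
  · unfold Function.uncurry; fun_prop
  · intro z y
    have h1 : HasFDerivAt (fun w => f (w - s • y)) (fderiv ℝ f (z - s • y)) z := by
      have := (hf.differentiableAt (z - s • y)).hasFDerivAt.comp z
        ((hasFDerivAt_id z).sub_const (s • y))
      rwa [ContinuousLinearMap.comp_id] at this
    exact h1.const_mul (k y)

lemma pd_av {k f : E3 → ℝ} (hk : Continuous k) (hf : Smooth3 f) (s : ℝ) (j : Fin 3) (x : E3) :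
    pd j (av k f s) x = av k (pd j f) s x := by
  have hfc : Continuous (fderiv ℝ f) := hf.continuous_fderiv (by simp)
  rw [pd, (hasFDerivAt_av hk hf s x).fderiv, ContinuousLinearMap.integral_apply]
  · rfl
  · exact (by fun_prop : Continuous fun y => k y • fderiv ℝ f (x - s • y)).continuousOn
      |>.integrableOn_compact (isCompact_closedBall _ _)

lemma pd_av' {k f : E3 → ℝ} (hk : Continuous k) (hf : Smooth3 f) (s : ℝ) (j : Fin 3) :
    pd j (av k f s) = av k (pd j f) s :=
  funext fun x => pd_av hk hf s j x

lemma fderiv_eq_sum_pd (f : E3 → ℝ) (x z : E3) : fderiv ℝ f x z = ∑ j, z j * pd j f x := by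
  have h := congrArg (fderiv ℝ f x) ((EuclideanSpace.basisFun (Fin 3) ℝ).sum_repr z).symm
  rw [h, map_sum]
  simp [pd]

lemma contDiff_succ_of_pd {n : ℕ} {f : E3 → ℝ} (hd : Differentiable ℝ f)
    (h : ∀ j, ContDiff ℝ n (pd j f)) : ContDiff ℝ (n + 1 : ℕ) f := by
  have hrep : fderiv ℝ f = fun x => ∑ j, pd j f x • (EuclideanSpace.proj j : EuclideanSpace ℝ (Fin 3) →L[ℝ] ℝ) := by
    funext x
    refine ContinuousLinearMap.ext fun z => ?_
    simp [fderiv_eq_sum_pd, mul_comm]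
  have := contDiff_succ_iff_fderiv (𝕜 := ℝ) (n := (n : WithTop ℕ∞)) (f := f)
  push_cast
  refine this.2 ⟨hd, by simp, ?_⟩
  rw [hrep]
  refine ContDiff.sum fun j _ => ?_
  exact ContDiff.smul (h j) contDiff_const

lemma Smooth3.av {k f : E3 → ℝ} (hk : Continuous k) (hf : Smooth3 f) (s : ℝ) :
    Smooth3 (av k f s) := by
  refine contDiff_infty.2 fun n => ?_
  induction n generalizing f with
  | zero =>
    have := continuous_av_right hk hf.continuous s
    exact contDiff_zero.2 this
  | succ n ih =>
    refine contDiff_succ_of_pd (fun x => (hasFDerivAt_av hk hf s x).differentiableAt) fun j => ?_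
    rw [pd_av' hk hf]
    exact ih (hf.pd j)

lemma av_eq_integral {k f : E3 → ℝ} (hk : ∀ y, 1 < ‖y‖ → k y = 0) (s : ℝ) (x : E3) :
    av k f s x = ∫ y, k y * f (x - s • y) :=
  setIntegral_eq_integral_of_forall_compl_eq_zero fun y hy => by
    simp [hk y (by simpa using hy)]

/-- Derivatives of the kernel can be moved onto the averaged field. -/
lemma av_pd_kernel {k f : E3 → ℝ} (hk : Smooth3 k) (hk1 : ∀ y, 1 < ‖y‖ → k y = 0)
    (hf : Smooth3 f) (s : ℝ) (j : Fin 3) (x : E3) :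
    av (pd j k) f s x = s * av k (pd j f) s x := by
  rw [av_eq_integral (fun y hy => pd_eq_zero_of_eqOn_compl hk1 hy), av_eq_integral hk1]
  have hg : Smooth3 (fun y => f (x - s • y)) := hf.comp (by fun_prop)
  have hpd : ∀ y, pd j (fun y => f (x - s • y)) y = -(s * pd j f (x - s • y)) := by
    intro y
    have h1 : HasFDerivAt (fun y : E3 => x - s • y) (-(s • ContinuousLinearMap.id ℝ E3)) y :=
      (((hasFDerivAt_id y).const_smul s).const_sub x)
    have h2 := (hf.differentiableAt (x - s • y)).hasFDerivAt.comp y h1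
    have h3 : fderiv ℝ (fun y => f (x - s • y)) y = _ := h2.fderiv
    rw [pd, h3]
    simp [pd]
  have := integral_mul_pd (hg.of_le (by simp)) (hk.of_le (by simp))
    (hasCompactSupport_of_eq_zero hk1) j
  simp only [hpd] at this
  calc _ = ∫ y, f (x - s • y) * pd j k y := by congr 1; ext y; ring
    _ = _ := by
      rw [this, ← integral_neg, ← integral_const_mul]
      congr 1; ext y; ring

lemma smooth3_lap {f : E3 → ℝ} (hf : Smooth3 f) : Smooth3 (lap f) :=
  ContDiff.sum fun j _ => (hf.pd j).pd j

/-- The scale derivative of the average against `m`, where `∇κ = -y m`. -/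
lemma hasDerivAt_av {κ m f : E3 → ℝ} (hκ : Smooth3 κ) (hκ1 : ∀ y, 1 < ‖y‖ → κ y = 0)
    (hm : Continuous m) (hκm : ∀ j y, pd j κ y = -(y j * m y)) (hf : Smooth3 f)
    (s : ℝ) (x : E3) :
    HasDerivAt (fun s => av m f s x) (s * av κ (lap f) s x) s := by
  have hfc : Continuous (fderiv ℝ f) := hf.continuous_fderiv (by simp)
  have hfc' := hf.continuous
  have h := hasFDerivAt_setIntegral_of_continuous (μ := (volume : Measure E3))
    (F := fun s y => m y * f (x - s • y))
    (F' := fun s y => m y • ((fderiv ℝ f (x - s • y)).comp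
      (-((ContinuousLinearMap.id ℝ ℝ).smulRight y)))) (isCompact_closedBall (0 : E3) 1)
    measurableSet_closedBall (by unfold Function.uncurry; fun_prop)
    (by
      unfold Function.uncurry
      have h1 : Continuous fun y : E3 => (ContinuousLinearMap.id ℝ ℝ).smulRight y :=
        ((ContinuousLinearMap.smulRightL ℝ ℝ E3) (ContinuousLinearMap.id ℝ ℝ)).continuous
      exact (hm.comp continuous_snd).smul ((by fun_prop : Continuous fun p : ℝ × E3 =>
        fderiv ℝ f (x - p.1 • p.2)).clm_comp (h1.comp continuous_snd).neg))
    (by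
      intro s y
      have h1 : HasFDerivAt (fun s : ℝ => x - s • y)
          (-((ContinuousLinearMap.id ℝ ℝ).smulRight y)) s :=
        (((hasFDerivAt_id s).smul_const y).const_sub x)
      exact ((hf.differentiableAt (x - s • y)).hasFDerivAt.comp s h1).const_mul (m y)) s
  have hd : HasDerivAt (fun s => av m f s x) _ s := h.hasDerivAt
  convert hd using 1
  rw [ContinuousLinearMap.integral_apply]
  swap
  · have h1 : Continuous fun y : E3 => (ContinuousLinearMap.id ℝ ℝ).smulRight y :=
      ((ContinuousLinearMap.smulRightL ℝ ℝ E3) (ContinuousLinearMap.id ℝ ℝ)).continuous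
    have : Continuous fun y : E3 => m y • ((fderiv ℝ f (x - s • y)).comp
      (-((ContinuousLinearMap.id ℝ ℝ).smulRight y))) :=
        hm.smul ((by fun_prop : Continuous fun y : E3 => fderiv ℝ f (x - s • y)).clm_comp h1.neg)
    exact this.continuousOn.integrableOn_compact (isCompact_closedBall _ _)
  have hlap : s * av κ (lap f) s x = ∑ j, av (pd j κ) (pd j f) s x := by
    simp_rw [av_pd_kernel hκ hκ1 (hf.pd _), ← Finset.mul_sum]
    congr 1
    unfold av
    rw [← integral_finsetSum]
    · simp [lap, Finset.mul_sum]
    · intro j _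
      have := ((hf.pd j).pd j).continuous
      have := hκ.continuous
      exact integrableOn_closedBall (by fun_prop) _ _
  rw [hlap]
  unfold av
  rw [← integral_finsetSum]
  · refine setIntegral_congr_fun measurableSet_closedBall fun y _ => ?_
    simp only [hκm]
    simp [fderiv_eq_sum_pd, Finset.mul_sum, ← Finset.sum_neg_distrib]
    exact Finset.sum_congr rfl fun j _ => by ring
  · intro j _
    have := (hf.pd j).continuous
    have := (hκ.pd j).continuous
    exact integrableOn_closedBall (by fun_prop) _ _

lemma av_zero (k f : E3 → ℝ) (x : E3) :
    av k f 0 x = (∫ y in closedBall (0 : E3) 1, k y) * f x := by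
  simp [av, integral_mul_const]

lemma av_sub_eq_intervalIntegral {κ m f : E3 → ℝ} (hκ : Smooth3 κ)
    (hκ1 : ∀ y, 1 < ‖y‖ → κ y = 0)
    (hm : Continuous m) (hκm : ∀ j y, pd j κ y = -(y j * m y)) (hf : Smooth3 f)
    (T : ℝ) (x : E3) :
    av m f T x - (∫ y in closedBall (0 : E3) 1, m y) * f x
      = ∫ s in (0 : ℝ)..T, s * av κ (lap f) s x := by
  rw [← av_zero, intervalIntegral.integral_eq_sub_of_hasDerivAt
    (fun s _ => hasDerivAt_av hκ hκ1 hm hκm hf s x)]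
  have : Continuous fun s => av κ (lap f) s x :=
    (continuous_av hκ.continuous (smooth3_lap hf).continuous).comp
      (by fun_prop : Continuous fun s : ℝ => (s, x))
  exact (continuous_id.mul this).intervalIntegrable _ _

end Averages

section AverageEstimates

/-- Volume of the unit ball. -/
def unitVol : ℝ := volume.real (closedBall (0 : E3) 1)

lemma unitVol_pos : 0 < unitVol :=
  ENNReal.toReal_pos (measure_closedBall_pos _ _ one_pos).ne' measure_closedBall_lt_top.ne

variable {f : E3 → ℝ} {s q ρ : ℝ} {x : E3}

lemma setIntegral_avg_le (hf : Continuous f) (h0 : ∀ x, 0 ≤ f x) (hs : 0 ≤ s) (hq : q + s ≤ ρ) :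
    ∫ x in closedBall (0 : E3) q, avg f s x ≤ unitVol * ∫ x in closedBall (0 : E3) ρ, f x := by
  unfold avg
  have hc : Continuous (Function.uncurry fun (x y : E3) => f (x - s • y)) := by
    unfold Function.uncurry; fun_prop
  rw [integral_integral_swap]
  swap
  · rw [Measure.prod_restrict]
    exact hc.continuousOn.integrableOn_compact
      ((isCompact_closedBall _ _).prod (isCompact_closedBall _ _))
  have hy : ∀ y ∈ closedBall (0 : E3) 1,
      ∫ x in closedBall (0 : E3) q, f (x - s • y) ≤ ∫ x in closedBall (0 : E3) ρ, f x := by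
    intro y hy
    rw [← integral_indicator measurableSet_closedBall, ← integral_indicator measurableSet_closedBall,
      ← integral_sub_right_eq_self (fun x => (closedBall (0 : E3) ρ).indicator f x) (s • y)]
    have hi := ((integrableOn_closedBall hf (0 : E3) ρ).integrable_indicator
      measurableSet_closedBall).comp_sub_right (s • y)
    refine integral_mono_of_nonneg (ae_of_all _ fun x => Set.indicator_nonneg (fun _ _ => h0 _) _)
      hi (ae_of_all _ fun x => ?_)
    by_cases hx : x ∈ closedBall (0 : E3) q
    · have hx' : x - s • y ∈ closedBall (0 : E3) ρ := by
        rw [mem_closedBall_zero_iff] at *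
        calc ‖x - s • y‖ ≤ ‖x‖ + ‖s • y‖ := norm_sub_le _ _
          _ ≤ q + s * 1 := by
            rw [norm_smul, Real.norm_of_nonneg hs]
            gcongr
          _ ≤ ρ := by linarith
      simp [Set.indicator_of_mem hx, Set.indicator_of_mem hx']
    · simp only [Set.indicator_of_notMem hx]
      exact Set.indicator_nonneg (fun _ _ => h0 _) _
  calc _ ≤ ∫ y in closedBall (0 : E3) 1, ∫ x in closedBall (0 : E3) ρ, f x := by
        refine setIntegral_mono_on ?_ (by simp)
          measurableSet_closedBall hy
        have : Continuous fun y : E3 => ∫ x in closedBall (0 : E3) q, f (x - s • y) :=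
          continuous_parametric_integral_of_continuous (f := fun (y x : E3) => f (x - s • y))
            (by unfold Function.uncurry; fun_prop) (isCompact_closedBall _ _)
        exact integrableOn_closedBall this _ _
    _ = _ := by simp [unitVol]

lemma avg_pow_le_aux (hf : Continuous f) {n : ℕ} (h : ∀ a : ℝ, 0 ≤ a → ∀ b : ℝ, 0 ≤ b →
    a ^ (n + 1) + (n + 1) * a ^ n * (b - a) ≤ b ^ (n + 1)) (h0 : ∀ x, 0 ≤ f x) :
    (avg f s x) ^ (n + 1) ≤ unitVol ^ n * avg (fun x => f x ^ (n + 1)) s x := by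
  have hV := unitVol_pos
  set A := avg f s x / unitVol with hA
  have hA0 : 0 ≤ A := div_nonneg (avg_nonneg h0 _ _) hV.le
  have h1 : ∫ y in closedBall (0 : E3) 1, (A ^ (n + 1) + (n + 1) * A ^ n * (f (x - s • y) - A))
      ≤ avg (fun x => f x ^ (n + 1)) s x :=
    setIntegral_closedBall_mono (by fun_prop) (by fun_prop) fun y _ => h A hA0 _ (h0 _)
  have hfi : IntegrableOn (fun y => f (x - s • y)) (closedBall (0 : E3) 1) :=
    integrableOn_closedBall (by fun_prop) _ _
  have hconst : ∀ c : ℝ, IntegrableOn (fun _ : E3 => c) (closedBall (0 : E3) 1) := fun c =>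
    integrableOn_closedBall (by fun_prop) _ _
  have h2 : ∫ y in closedBall (0 : E3) 1, (A ^ (n + 1) + (n + 1) * A ^ n * (f (x - s • y) - A))
      = unitVol * A ^ (n + 1) + (n + 1) * A ^ n * (avg f s x - unitVol * A) := by
    rw [integral_add (hconst _) (integrableOn_closedBall (by fun_prop) _ _), integral_const_mul,
      integral_sub hfi (hconst _)]
    simp [avg, unitVol]
  have h3 : unitVol * A = avg f s x := by rw [hA]; field_simp
  rw [h2, h3, sub_self, mul_zero, add_zero] at h1
  calc (avg f s x) ^ (n + 1) = unitVol ^ n * (unitVol * A ^ (n + 1)) := by rw [← h3]; ring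
    _ ≤ _ := by gcongr

lemma avg_sq_le (hf : Continuous f) (h0 : ∀ x, 0 ≤ f x) :
    (avg f s x) ^ 2 ≤ unitVol * avg (fun x => f x ^ 2) s x := by
  simpa using avg_pow_le_aux (n := 1) hf (fun a _ b _ => by
    norm_num; nlinarith [sq_nonneg (a - b)]) h0

lemma avg_cube_le (hf : Continuous f) (h0 : ∀ x, 0 ≤ f x) :
    (avg f s x) ^ 3 ≤ unitVol ^ 2 * avg (fun x => f x ^ 3) s x :=
  avg_pow_le_aux (n := 2) hf (fun a ha b hb => by
    norm_num; nlinarith [mul_nonneg ha (sq_nonneg (a - b)), mul_nonneg hb (sq_nonneg (a - b))]) h0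

lemma cube_mul_avg_le (hf : Continuous f) (h0 : ∀ x, 0 ≤ f x) (hs : 0 < s) (hx : ‖x‖ + s ≤ ρ) :
    s ^ 3 * avg f s x ≤ ∫ x in closedBall (0 : E3) ρ, f x := by
  unfold avg
  rw [← integral_indicator measurableSet_closedBall, ← integral_indicator measurableSet_closedBall]
  set F := (closedBall (0 : E3) ρ).indicator f with hF
  have hFi : Integrable F := (integrableOn_closedBall hf (0 : E3) ρ).integrable_indicator
    measurableSet_closedBall
  have hF0 : ∀ z, 0 ≤ F z := fun z => Set.indicator_nonneg (fun _ _ => h0 _) _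
  have hcs : ∫ y, F (x - s • y) = (s ^ 3)⁻¹ * ∫ z, F z := by
    rw [Measure.integral_comp_smul volume (fun y => F (x - y)) s,
      integral_sub_left_eq_self (fun y => F y) volume x]
    simp [abs_of_pos hs]
  have hle : ∫ y, (closedBall (0 : E3) 1).indicator (fun y => f (x - s • y)) y
      ≤ ∫ y, F (x - s • y) := by
    refine integral_mono_of_nonneg (ae_of_all _ fun x => Set.indicator_nonneg (fun _ _ => h0 _) _)
      ((hFi.comp_sub_left x).comp_smul hs.ne') (ae_of_all _ fun y => ?_)
    by_cases hy : y ∈ closedBall (0 : E3) 1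
    · have hx' : x - s • y ∈ closedBall (0 : E3) ρ := by
        rw [mem_closedBall_zero_iff] at *
        calc ‖x - s • y‖ ≤ ‖x‖ + ‖s • y‖ := norm_sub_le _ _
          _ ≤ ‖x‖ + s * 1 := by
            rw [norm_smul, Real.norm_of_nonneg hs.le]
            gcongr
          _ ≤ ρ := by linarith
      simp [Set.indicator_of_mem hy, hF, Set.indicator_of_mem hx']
    · simp only [Set.indicator_of_notMem hy]
      exact hF0 _
  calc _ ≤ s ^ 3 * ((s ^ 3)⁻¹ * ∫ z, F z) := by rw [← hcs]; gcongr
    _ = _ := by field_simp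

lemma avg_le_of_integral_cube (hf : Continuous f) (h0 : ∀ x, 0 ≤ f x) (hs : 0 < s)
    (hx : ‖x‖ + s ≤ ρ) {n : ℝ} (hn : 0 ≤ n) (hfn : ∫ x in closedBall (0 : E3) ρ, f x ^ 3 ≤ n ^ 3) :
    avg f s x ≤ (1 + unitVol) * n / s := by
  have hV := unitVol_pos
  have h1 := avg_cube_le (s := s) (x := x) hf h0
  have h2 := cube_mul_avg_le (f := fun x => f x ^ 3) (by fun_prop)
    (fun x => pow_nonneg (h0 x) 3) hs hx
  rw [le_div_iff₀ hs]
  refine le_of_pow_le_pow_left₀ (n := 3) (by norm_num) (by positivity) ?_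
  have hV2 : unitVol ^ 2 ≤ (1 + unitVol) ^ 3 := by nlinarith [pow_pos hV 3]
  calc (avg f s x * s) ^ 3 = s ^ 3 * (avg f s x) ^ 3 := by ring
    _ ≤ s ^ 3 * (unitVol ^ 2 * avg (fun x => f x ^ 3) s x) := by gcongr
    _ = unitVol ^ 2 * (s ^ 3 * avg (fun x => f x ^ 3) s x) := by ring
    _ ≤ (1 + unitVol) ^ 3 * n ^ 3 := by
      refine mul_le_mul hV2 (h2.trans hfn) ?_ (by positivity)
      exact mul_nonneg (by positivity) (avg_nonneg (fun x => pow_nonneg (h0 x) 3) _ _)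
    _ = _ := by ring

end AverageEstimates

section WeakForm

/-- The convective derivative `(u·∇) v_k`. -/
def transport (u v : Fin 3 → E3 → ℝ) (k : Fin 3) (x : E3) : ℝ := ∑ j, u j x * pd j (v k) x

/-- The sum of the absolute values of the components. -/
def absSum (u : Fin 3 → E3 → ℝ) (x : E3) : ℝ := ∑ i, |u i x|

/-- The sum of the absolute values of the first derivatives. -/
def absGrad (u : Fin 3 → E3 → ℝ) (x : E3) : ℝ := ∑ i, ∑ j, |pd j (u i) x|

/-- The dissipation density `|∇u|² + |(u·∇)v|²`. -/
def dissip (u v : Fin 3 → E3 → ℝ) (x : E3) : ℝ :=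
  ∑ i, ∑ j, (pd j (u i) x) ^ 2 + ∑ k, (transport u v k x) ^ 2

/-- The system with the gradient part of the elastic stress absorbed in the pressure `Q`. -/
structure ReducedEL (u v : Fin 3 → E3 → ℝ) (Q : E3 → ℝ) : Prop where
  smooth_u : ∀ i, Smooth3 (u i)
  smooth_v : ∀ i, Smooth3 (v i)
  smooth_Q : Smooth3 Q
  div_free : ∀ x, ∑ j, pd j (u j) x = 0
  momentum : ∀ i x, pd i Q x = lap (u i) x - ∑ j, u j x * pd j (u i) x
    - ∑ k, pd i (v k) x * transport u v k x

lemma absSum_nonneg (u : Fin 3 → E3 → ℝ) (x : E3) : 0 ≤ absSum u x :=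
  Finset.sum_nonneg fun _ _ => abs_nonneg _

lemma absGrad_nonneg (u : Fin 3 → E3 → ℝ) (x : E3) : 0 ≤ absGrad u x :=
  Finset.sum_nonneg fun _ _ => Finset.sum_nonneg fun _ _ => abs_nonneg _

lemma dissip_nonneg (u v : Fin 3 → E3 → ℝ) (x : E3) : 0 ≤ dissip u v x :=
  add_nonneg (Finset.sum_nonneg fun _ _ => Finset.sum_nonneg fun _ _ => sq_nonneg _)
    (Finset.sum_nonneg fun _ _ => sq_nonneg _)

lemma abs_le_absSum (u : Fin 3 → E3 → ℝ) (i : Fin 3) (x : E3) : |u i x| ≤ absSum u x :=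
  Finset.single_le_sum (f := fun i => |u i x|) (fun _ _ => abs_nonneg _) (Finset.mem_univ i)

lemma abs_pd_le_absGrad (u : Fin 3 → E3 → ℝ) (i j : Fin 3) (x : E3) :
    |pd j (u i) x| ≤ absGrad u x :=
  (Finset.single_le_sum (f := fun j => |pd j (u i) x|) (fun _ _ => abs_nonneg _)
    (Finset.mem_univ j)).trans
  (Finset.single_le_sum (f := fun i => ∑ j, |pd j (u i) x|)
    (fun _ _ => Finset.sum_nonneg fun _ _ => abs_nonneg _) (Finset.mem_univ i))

lemma continuous_absSum {u : Fin 3 → E3 → ℝ} (hu : ∀ i, Continuous (u i)) :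
    Continuous (absSum u) :=
  continuous_finsetSum _ fun i _ => (hu i).abs

lemma continuous_absGrad {u : Fin 3 → E3 → ℝ} (hu : ∀ i, Smooth3 (u i)) :
    Continuous (absGrad u) :=
  continuous_finsetSum _ fun i _ => continuous_finsetSum _ fun j _ => ((hu i).pd j).continuous.abs

lemma smooth_transport {u v : Fin 3 → E3 → ℝ} (hu : ∀ i, Smooth3 (u i)) (hv : ∀ i, Smooth3 (v i))
    (k : Fin 3) : Smooth3 (transport u v k) :=
  ContDiff.sum fun j _ => (hu j).mul ((hv k).pd j)

lemma continuous_dissip {u v : Fin 3 → E3 → ℝ} (hu : ∀ i, Smooth3 (u i))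
    (hv : ∀ i, Smooth3 (v i)) : Continuous (dissip u v) :=
  (continuous_finsetSum _ fun i _ => continuous_finsetSum _ fun j _ =>
    ((hu i).pd j).continuous.pow 2).add
  (continuous_finsetSum _ fun k _ => (smooth_transport hu hv k).continuous.pow 2)

lemma absGrad_sq_le (u v : Fin 3 → E3 → ℝ) (x : E3) : absGrad u x ^ 2 ≤ 9 * dissip u v x := by
  have h1 : absGrad u x ^ 2 ≤ 9 * ∑ i, ∑ j, (pd j (u i) x) ^ 2 := by
    unfold absGrad
    have h := sq_sum_le_card_mul_sum_sq (s := (Finset.univ : Finset (Fin 3 × Fin 3)))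
      (f := fun p => |pd p.2 (u p.1) x|)
    simpa [Fintype.sum_prod_type] using h
  have h2 : 0 ≤ ∑ k, (transport u v k x) ^ 2 := Finset.sum_nonneg fun _ _ => sq_nonneg _
  unfold dissip
  linarith

lemma absSum_transport_sq_le (u v : Fin 3 → E3 → ℝ) (x : E3) :
    absSum (transport u v) x ^ 2 ≤ 9 * dissip u v x := by
  have h1 : absSum (transport u v) x ^ 2 ≤ 3 * ∑ k, (transport u v k x) ^ 2 := by
    unfold absSum
    have h := sq_sum_le_card_mul_sum_sq (s := (Finset.univ : Finset (Fin 3)))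
      (f := fun k => |transport u v k x|)
    simpa using h
  have h2 : 0 ≤ ∑ k, (transport u v k x) ^ 2 := Finset.sum_nonneg fun _ _ => sq_nonneg _
  have h3 : 0 ≤ ∑ i, ∑ j, (pd j (u i) x) ^ 2 :=
    Finset.sum_nonneg fun _ _ => Finset.sum_nonneg fun _ _ => sq_nonneg _
  unfold dissip
  linarith

lemma integrable_mul_of_eq_zero {f g : E3 → ℝ} {q : ℝ} (hf : Continuous f) (hg : Continuous g)
    (hz : ∀ x, q < ‖x‖ → g x = 0) : Integrable (fun x => f x * g x) :=
  (hf.mul hg).integrable_of_hasCompactSupport (hasCompactSupport_of_eq_zero hz).mul_left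

/-- The pressure gradient tested against a compactly supported field. -/
def gradPair (Q : E3 → ℝ) (ψ : Fin 3 → E3 → ℝ) : ℝ := ∑ i, ∫ x, pd i Q x * ψ i x

variable {u v ψ : Fin 3 → E3 → ℝ} {Q φ ψ0 ψ1 : E3 → ℝ} {q B : ℝ}

lemma integral_lap_mul {f g : E3 → ℝ} (hf : Smooth3 f) (hg : Smooth3 g)
    (hz : ∀ x, q < ‖x‖ → g x = 0) :
    ∫ x, lap f x * g x = -∑ l, ∫ x, pd l f x * pd l g x := by
  unfold lap
  simp_rw [Finset.sum_mul]
  rw [integral_finsetSum, ← Finset.sum_neg_distrib]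
  · refine Finset.sum_congr rfl fun l _ => ?_
    rw [integral_mul_pd ((hf.pd l).of_le (by simp)) (hg.of_le (by simp))
      (hasCompactSupport_of_eq_zero hz), neg_neg]
  · exact fun l _ => integrable_mul_of_eq_zero ((hf.pd l).pd l).continuous hg.continuous hz

/-- Transport by a divergence-free field is antisymmetric. -/
lemma sum_integral_transport_mul (h : ∀ i, Smooth3 (u i)) (hdiv : ∀ x, ∑ j, pd j (u j) x = 0)
    {f g : E3 → ℝ} (hf : Smooth3 f) (hg : Smooth3 g) (hz : ∀ x, q < ‖x‖ → g x = 0) :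
    ∑ j, ∫ x, u j x * pd j f x * g x = -∑ j, ∫ x, u j x * f x * pd j g x := by
  have h1 : ∀ j, ∫ x, u j x * f x * pd j g x
      = -(∫ x, pd j (u j) x * f x * g x) - ∫ x, u j x * pd j f x * g x := by
    intro j
    have hs : Smooth3 (fun x => u j x * f x) := (h j).mul hf
    rw [integral_mul_pd (hs.of_le (by simp)) (hg.of_le (by simp))
      (hasCompactSupport_of_eq_zero hz), ← neg_add', ← integral_add]
    · congr 1
      refine integral_congr_ae (ae_of_all _ fun x => ?_)
      change pd j (fun x => u j x * f x) x * g x = _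
      rw [pd_mul ((h j).differentiableAt x) (hf.differentiableAt x)]
      ring
    · exact integrable_mul_of_eq_zero (((h j).pd j).continuous.mul hf.continuous) hg.continuous hz
    · exact integrable_mul_of_eq_zero ((h j).continuous.mul (hf.pd j).continuous) hg.continuous hz
  have h2 : ∑ j, ∫ x, pd j (u j) x * f x * g x = 0 := by
    rw [← integral_finsetSum]
    · simp_rw [mul_assoc, ← Finset.sum_mul, hdiv, zero_mul]
      simp
    · intro j _
      exact integrable_mul_of_eq_zero (((h j).pd j).continuous.mul hf.continuous) hg.continuous hz
  simp_rw [h1, Finset.sum_sub_distrib, Finset.sum_neg_distrib, h2]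
  simp

lemma ReducedEL.gradPair_eq (H : ReducedEL u v Q) (hψ : ∀ i, Smooth3 (ψ i))
    (hz : ∀ i x, q < ‖x‖ → ψ i x = 0) :
    gradPair Q ψ = -∫ x, ∑ i, (∑ l, pd l (u i) x * pd l (ψ i) x
      + ∑ j, u j x * pd j (u i) x * ψ i x + ∑ k, pd i (v k) x * transport u v k x * ψ i x) := by
  have hu := H.smooth_u
  have hv := H.smooth_v
  have ht := smooth_transport hu hv
  have hz' : ∀ i l x, q < ‖x‖ → pd l (ψ i) x = 0 := fun i l x hx =>
    pd_eq_zero_of_eqOn_compl (hz i) hx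
  have i1 : ∀ i l, Integrable fun x => pd l (u i) x * pd l (ψ i) x := fun i l =>
    integrable_mul_of_eq_zero ((hu i).pd l).continuous ((hψ i).pd l).continuous (hz' i l)
  have i2 : ∀ i j, Integrable fun x => u j x * pd j (u i) x * ψ i x := fun i j =>
    integrable_mul_of_eq_zero ((hu j).continuous.mul ((hu i).pd j).continuous) (hψ i).continuous
      (hz i)
  have i3 : ∀ i k, Integrable fun x => pd i (v k) x * transport u v k x * ψ i x := fun i k =>
    integrable_mul_of_eq_zero (((hv k).pd i).continuous.mul (ht k).continuous) (hψ i).continuous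
      (hz i)
  have i0 : ∀ i, Integrable fun x => lap (u i) x * ψ i x := fun i =>
    integrable_mul_of_eq_zero (smooth3_lap (hu i)).continuous (hψ i).continuous (hz i)
  have s1 : ∀ i, Integrable fun x => ∑ l, pd l (u i) x * pd l (ψ i) x := fun i =>
    integrable_finsetSum _ fun l _ => i1 i l
  have s2 : ∀ i, Integrable fun x => ∑ j, u j x * pd j (u i) x * ψ i x := fun i =>
    integrable_finsetSum _ fun l _ => i2 i l
  have s3 : ∀ i, Integrable fun x => ∑ k, pd i (v k) x * transport u v k x * ψ i x := fun i =>
    integrable_finsetSum _ fun l _ => i3 i l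
  have s4 : ∀ i, Integrable fun x => ∑ l, pd l (u i) x * pd l (ψ i) x
      + ∑ j, u j x * pd j (u i) x * ψ i x + ∑ k, pd i (v k) x * transport u v k x * ψ i x :=
    fun i => ((s1 i).add (s2 i)).add (s3 i)
  rw [integral_finsetSum _ fun i _ => s4 i, gradPair, ← Finset.sum_neg_distrib]
  refine Finset.sum_congr rfl fun i _ => ?_
  have e1 : ∀ x, pd i Q x * ψ i x = (lap (u i) x * ψ i x - ∑ j, u j x * pd j (u i) x * ψ i x)
      - ∑ k, pd i (v k) x * transport u v k x * ψ i x := by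
    intro x
    rw [H.momentum, ← Finset.sum_mul, ← Finset.sum_mul]
    ring
  simp_rw [e1]
  have a1 := integral_sub ((i0 i).sub (s2 i)) (s3 i)
  have a2 := integral_sub (i0 i) (s2 i)
  have a3 := integral_add ((s1 i).add (s2 i)) (s3 i)
  have a4 := integral_add (s1 i) (s2 i)
  have a5 := integral_lap_mul (hu i) (hψ i) (hz i)
  rw [← integral_finsetSum _ fun l _ => i1 i l] at a5
  simp only [Pi.sub_apply, Pi.add_apply] at a1 a2 a3 a4
  rw [a1, a2, a3, a4, a5]
  ring

lemma sum_sum_mul_le {F G : Fin 3 → Fin 3 → ℝ} {M : ℝ} (hG : ∀ i j, |G i j| ≤ M) :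
    |∑ i, ∑ j, F i j * G i j| ≤ (∑ i, ∑ j, |F i j|) * M := by
  rw [Finset.sum_mul]
  refine (Finset.abs_sum_le_sum_abs _ _).trans (Finset.sum_le_sum fun i _ => ?_)
  rw [Finset.sum_mul]
  refine (Finset.abs_sum_le_sum_abs _ _).trans (Finset.sum_le_sum fun j _ => ?_)
  rw [abs_mul]
  exact mul_le_mul_of_nonneg_left (hG i j) (abs_nonneg _)

lemma absGrad_pairing_le (x : E3) (h0 : ∀ i, |ψ i x| ≤ ψ0 x) :
    |∑ i, ∑ k, pd i (v k) x * (transport u v k x * ψ i x)|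
      ≤ absGrad v x * absSum (transport u v) x * ψ0 x := by
  rw [Finset.sum_comm, mul_assoc]
  refine sum_sum_mul_le (F := fun k i => pd i (v k) x) (G := fun k i => transport u v k x * ψ i x)
    fun k i => ?_
  rw [abs_mul]
  exact mul_le_mul (abs_le_absSum _ _ _) (h0 i) (abs_nonneg _) (absSum_nonneg _ _)

lemma ReducedEL.abs_gradPair_le_near (H : ReducedEL u v Q) (hψ : ∀ i, Smooth3 (ψ i))
    (hz : ∀ i x, q < ‖x‖ → ψ i x = 0) (c0 : Continuous ψ0) (c1 : Continuous ψ1)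
    (h0 : ∀ i x, ‖x‖ ≤ q → |ψ i x| ≤ ψ0 x) (h1 : ∀ i l x, ‖x‖ ≤ q → |pd l (ψ i) x| ≤ ψ1 x) :
    |gradPair Q ψ| ≤ ∫ x in closedBall (0 : E3) q, (absGrad u x * ψ1 x
      + absSum u x * absGrad u x * ψ0 x
      + absGrad v x * absSum (transport u v) x * ψ0 x) := by
  have hu := H.smooth_u
  have hv := H.smooth_v
  have := continuous_absGrad hu
  have := continuous_absGrad hv
  have := continuous_absSum fun i => (hu i).continuous
  have := continuous_absSum fun i => (smooth_transport hu hv i).continuous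
  rw [H.gradPair_eq hψ hz, abs_neg]
  refine abs_integral_le_of_le (by fun_prop) ?_ ?_
  · intro x hx
    refine Finset.sum_eq_zero fun i _ => ?_
    simp [hz i x hx, pd_eq_zero_of_eqOn_compl (hz i) hx]
  · intro x hx
    simp only [Finset.sum_add_distrib, mul_assoc]
    refine (abs_add_le _ _).trans (add_le_add ((abs_add_le _ _).trans (add_le_add ?_ ?_)) ?_)
    · exact sum_sum_mul_le (F := fun i l => pd l (u i) x) fun i l => h1 i l x hx
    · have := sum_sum_mul_le (F := fun i j => pd j (u i) x) (G := fun i j => u j x * ψ i x)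
        (M := absSum u x * ψ0 x) fun i j => by
          rw [abs_mul]
          exact mul_le_mul (abs_le_absSum _ _ _) (h0 i x hx) (abs_nonneg _) (absSum_nonneg _ _)
      calc _ = |∑ i, ∑ j, pd j (u i) x * (u j x * ψ i x)| := by
            congr 1
            exact Finset.sum_congr rfl fun i _ => Finset.sum_congr rfl fun j _ => by ring
        _ ≤ absGrad u x * (absSum u x * ψ0 x) := this
        _ = _ := by ring
    · simpa [mul_assoc] using absGrad_pairing_le (u := u) (v := v) x fun i => h0 i x hx

lemma ReducedEL.abs_gradPair_le_far (H : ReducedEL u v Q) (hψ : ∀ i, Smooth3 (ψ i))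
    (hz : ∀ i x, q < ‖x‖ → ψ i x = 0) (c0 : Continuous ψ0) (c1 : Continuous ψ1)
    (h0 : ∀ i x, ‖x‖ ≤ q → |ψ i x| ≤ ψ0 x) (h1 : ∀ i l x, ‖x‖ ≤ q → |pd l (ψ i) x| ≤ ψ1 x) :
    |gradPair Q ψ| ≤ ∫ x in closedBall (0 : E3) q, (absGrad u x * ψ1 x
      + absSum u x ^ 2 * ψ1 x
      + absGrad v x * absSum (transport u v) x * ψ0 x) := by
  have hu := H.smooth_u
  have hv := H.smooth_v
  have hcu := fun i => (hu i).continuous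
  have hcψ := fun i => (hψ i).continuous
  have hcpψ := fun i l => ((hψ i).pd l).continuous
  have hcpu := fun i l => ((hu i).pd l).continuous
  have hcpv := fun i l => ((hv i).pd l).continuous
  have hct := fun i => (smooth_transport hu hv i).continuous
  have hz' : ∀ i l x, q < ‖x‖ → pd l (ψ i) x = 0 := fun i l x hx =>
    pd_eq_zero_of_eqOn_compl (hz i) hx
  have := continuous_absGrad hu
  have := continuous_absGrad hv
  have := continuous_absSum hcu
  have := continuous_absSum hct
  have key : ∫ x, ∑ i, (∑ l, pd l (u i) x * pd l (ψ i) x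
      + ∑ j, u j x * pd j (u i) x * ψ i x + ∑ k, pd i (v k) x * transport u v k x * ψ i x)
      = ∫ x, ∑ i, (∑ l, pd l (u i) x * pd l (ψ i) x
      + -∑ j, u j x * u i x * pd j (ψ i) x + ∑ k, pd i (v k) x * transport u v k x * ψ i x) := by
    have i1 : ∀ i, Integrable fun x => ∑ l, pd l (u i) x * pd l (ψ i) x := fun i =>
      integrable_finsetSum _ fun l _ => integrable_mul_of_eq_zero (hcpu i l) (hcpψ i l) (hz' i l)
    have i2 : ∀ i, Integrable fun x => ∑ j, u j x * pd j (u i) x * ψ i x := fun i =>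
      integrable_finsetSum _ fun j _ =>
        integrable_mul_of_eq_zero ((hcu j).mul (hcpu i j)) (hcψ i) (hz i)
    have i2' : ∀ i, Integrable fun x => ∑ j, u j x * u i x * pd j (ψ i) x := fun i =>
      integrable_finsetSum _ fun j _ =>
        integrable_mul_of_eq_zero ((hcu j).mul (hcu i)) (hcpψ i j) (hz' i j)
    have i3 : ∀ i, Integrable fun x => ∑ k, pd i (v k) x * transport u v k x * ψ i x := fun i =>
      integrable_finsetSum _ fun k _ =>
        integrable_mul_of_eq_zero ((hcpv k i).mul (hct k)) (hcψ i) (hz i)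
    have s4 : ∀ i, Integrable fun x => ∑ l, pd l (u i) x * pd l (ψ i) x
        + ∑ j, u j x * pd j (u i) x * ψ i x + ∑ k, pd i (v k) x * transport u v k x * ψ i x :=
      fun i => ((i1 i).add (i2 i)).add (i3 i)
    have s5 : ∀ i, Integrable fun x => ∑ l, pd l (u i) x * pd l (ψ i) x
        + -∑ j, u j x * u i x * pd j (ψ i) x + ∑ k, pd i (v k) x * transport u v k x * ψ i x :=
      fun i => ((i1 i).add (i2' i).neg).add (i3 i)
    rw [integral_finsetSum _ fun i _ => s4 i, integral_finsetSum _ fun i _ => s5 i]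
    refine Finset.sum_congr rfl fun i _ => ?_
    have a1 := integral_add ((i1 i).add (i2 i)) (i3 i)
    have a2 := integral_add (i1 i) (i2 i)
    have b1 := integral_add ((i1 i).add (i2' i).neg) (i3 i)
    have b2 := integral_add (i1 i) (i2' i).neg
    have c := sum_integral_transport_mul hu H.div_free (hu i) (hψ i) (hz i)
    rw [← integral_finsetSum, ← integral_finsetSum] at c
    rotate_left
    · exact fun j _ => integrable_mul_of_eq_zero ((hcu j).mul (hcu i)) (hcpψ i j) (hz' i j)
    · exact fun j _ => integrable_mul_of_eq_zero ((hcu j).mul (hcpu i j)) (hcψ i) (hz i)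
    simp only [Pi.neg_apply, Pi.add_apply] at a1 a2 b1 b2
    rw [a1, a2, b1, b2, c, integral_neg]
  rw [H.gradPair_eq hψ hz, abs_neg, key]
  refine abs_integral_le_of_le (by fun_prop) ?_ ?_
  · intro x hx
    refine Finset.sum_eq_zero fun i _ => ?_
    simp [hz i x hx, hz' i _ x hx]
  · intro x hx
    simp only [Finset.sum_add_distrib, mul_assoc]
    refine (abs_add_le _ _).trans (add_le_add ((abs_add_le _ _).trans (add_le_add ?_ ?_)) ?_)
    · exact sum_sum_mul_le (F := fun i l => pd l (u i) x) fun i l => h1 i l x hx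
    · rw [Finset.sum_neg_distrib, abs_neg]
      have := sum_sum_mul_le (F := fun i j => u j x * u i x) (G := fun i j => pd j (ψ i) x)
        (M := ψ1 x) fun i j => h1 i j x hx
      have e : absSum u x ^ 2 = ∑ i, ∑ j, |u j x * u i x| := by
        simp_rw [abs_mul, ← Finset.sum_mul, ← Finset.mul_sum]
        rw [sq]; rfl
      rw [e]
      simpa [mul_assoc] using this
    · simpa [mul_assoc] using absGrad_pairing_le (u := u) (v := v) x fun i => h0 i x hx

lemma ReducedEL.integral_mul_dissip_le (H : ReducedEL u v Q) (hφ : Smooth3 φ)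
    (hz : ∀ x, q < ‖x‖ → φ x = 0) (hB : ∀ j x, |pd j φ x| ≤ B) :
    ∫ x, φ x * dissip u v x ≤ -gradPair Q (fun i x => φ x * u i x)
      + ∫ x in closedBall (0 : E3) q, (B * (absSum u x * absGrad u x) + B * absSum u x ^ 3) := by
  have hu := H.smooth_u
  have hv := H.smooth_v
  have hcu := fun i => (hu i).continuous
  have hcφ := hφ.continuous
  have hcpφ := fun l => (hφ.pd l).continuous
  have hcpu := fun i l => ((hu i).pd l).continuous
  have hct := fun i => (smooth_transport hu hv i).continuous
  have hz' : ∀ l x, q < ‖x‖ → pd l φ x = 0 := fun l x hx => pd_eq_zero_of_eqOn_compl hz hx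
  have := continuous_absGrad hu
  have := continuous_absSum hcu
  have hce := continuous_dissip hu hv
  have hpt : ∀ x, ∑ i, (∑ l, pd l (u i) x * pd l (fun x => φ x * u i x) x
      + ∑ j, u j x * pd j (u i) x * (φ x * u i x)
      + ∑ k, pd i (v k) x * transport u v k x * (φ x * u i x))
      = (dissip u v x * φ x + ∑ i, ∑ l, pd l (u i) x * u i x * pd l φ x)
        + ∑ i, ∑ j, u j x * pd j (u i) x * (φ x * u i x) := by
    intro x
    have e1 : ∀ i l, pd l (fun x => φ x * u i x) x = pd l φ x * u i x + φ x * pd l (u i) x :=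
      fun i l => pd_mul (hφ.differentiableAt x) ((hu i).differentiableAt x)
    simp only [e1, Finset.sum_add_distrib]
    have e2 : ∑ i, ∑ k, pd i (v k) x * transport u v k x * (φ x * u i x)
        = (∑ k, transport u v k x ^ 2) * φ x := by
      rw [Finset.sum_comm, Finset.sum_mul]
      refine Finset.sum_congr rfl fun k _ => ?_
      rw [sq]
      nth_rewrite 3 [transport]
      rw [Finset.mul_sum, Finset.sum_mul]
      exact Finset.sum_congr rfl fun i _ => by ring
    have e3 : ∑ i, ∑ l, pd l (u i) x * (pd l φ x * u i x + φ x * pd l (u i) x)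
        = (∑ i, ∑ j, pd j (u i) x ^ 2) * φ x + ∑ i, ∑ l, pd l (u i) x * u i x * pd l φ x := by
      simp_rw [Finset.sum_mul, ← Finset.sum_add_distrib]
      exact Finset.sum_congr rfl fun i _ => Finset.sum_congr rfl fun l _ => by ring
    rw [e2, e3, dissip]
    ring
  have j1 : Integrable fun x => dissip u v x * φ x := integrable_mul_of_eq_zero hce hcφ hz
  have j2 : Integrable fun x => ∑ i, ∑ l, pd l (u i) x * u i x * pd l φ x :=
    integrable_finsetSum _ fun i _ => integrable_finsetSum _ fun l _ =>
      integrable_mul_of_eq_zero ((hcpu i l).mul (hcu i)) (hcpφ l) (hz' l)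
  have j3' : ∀ i j, Integrable fun x => u j x * pd j (u i) x * (φ x * u i x) := fun i j =>
    integrable_mul_of_eq_zero (q := q) ((hcu j).mul (hcpu i j)) (hcφ.mul (hcu i))
      fun x (hx : q < ‖x‖) => by simp [hz x hx]
  have j3 : Integrable fun x => ∑ i, ∑ j, u j x * pd j (u i) x * (φ x * u i x) :=
    integrable_finsetSum _ fun i _ => integrable_finsetSum _ fun j _ => j3' i j
  have hcub : ∫ x, ∑ i, ∑ j, u j x * pd j (u i) x * (φ x * u i x)
      = ∫ x, ∑ i, ∑ j, -(1 / 2 * (u j x * u i x ^ 2 * pd j φ x)) := by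
    have hi : ∀ i j, Integrable fun x => u j x * u i x ^ 2 * pd j φ x := fun i j =>
      integrable_mul_of_eq_zero ((hcu j).mul ((hcu i).pow 2)) (hcpφ j) (hz' j)
    have hi' : ∀ i j, Integrable fun x => -(1 / 2 * (u j x * u i x ^ 2 * pd j φ x)) := fun i j =>
      ((hi i j).const_mul _).neg
    rw [integral_finsetSum _ fun i _ => integrable_finsetSum _ fun j _ => j3' i j,
      integral_finsetSum _ fun i _ => integrable_finsetSum _ fun j _ => hi' i j]
    refine Finset.sum_congr rfl fun i _ => ?_
    have c := sum_integral_transport_mul hu H.div_free (f := fun x => 1 / 2 * u i x ^ 2)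
      (contDiff_const.mul ((hu i).pow 2)) hφ hz
    rw [integral_finsetSum _ fun j _ => j3' i j,
      integral_finsetSum _ fun j _ => hi' i j]
    rw [← Finset.sum_neg_distrib] at c
    convert c using 2 with j _ j _
    · congr 1; ext x
      have e : pd j (fun x => 1 / 2 * u i x ^ 2) x = u i x * pd j (u i) x := by
        have : (fun x => 1 / 2 * u i x ^ 2) = fun x => 1 / 2 * (u i x * u i x) := by
          ext x; ring
        rw [this, pd_const_mul (f := fun x => u i x * u i x) _
            (((hu i).differentiableAt x).mul ((hu i).differentiableAt x)),
          pd_mul ((hu i).differentiableAt x) ((hu i).differentiableAt x)]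
        ring
      rw [e]; ring
    · rw [integral_neg]
      congr 2; ext x; ring
  have hgp := H.gradPair_eq (ψ := fun i x => φ x * u i x) (q := q) (fun i => hφ.mul (hu i))
    (fun i x hx => by simp [hz x hx])
  simp_rw [hpt] at hgp
  have a1 := integral_add (j1.add j2) j3
  have a2 := integral_add j1 j2
  simp only [Pi.add_apply] at a1 a2
  rw [a1, a2, hcub] at hgp
  have b1 : |∫ x, ∑ i, ∑ l, pd l (u i) x * u i x * pd l φ x|
      ≤ ∫ x in closedBall (0 : E3) q, B * (absSum u x * absGrad u x) := by
    refine abs_integral_le_of_le (by fun_prop) ?_ ?_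
    · intro x hx; simp [hz' _ x hx]
    · intro x _
      simp_rw [mul_assoc]
      refine (sum_sum_mul_le (F := fun i l => pd l (u i) x) (M := absSum u x * B)
        fun i l => ?_).trans (le_of_eq (by unfold absGrad; ring))
      rw [abs_mul]
      exact mul_le_mul (abs_le_absSum _ _ _) (hB _ _) (abs_nonneg _) (absSum_nonneg _ _)
  have b2 : |∫ x, ∑ i, ∑ j, -(1 / 2 * (u j x * u i x ^ 2 * pd j φ x))|
      ≤ ∫ x in closedBall (0 : E3) q, B * absSum u x ^ 3 := by
    refine abs_integral_le_of_le (by fun_prop) ?_ ?_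
    · intro x hx; simp [hz' _ x hx]
    · intro x _
      have hB0 : 0 ≤ B := (abs_nonneg _).trans (hB 0 x)
      have h1 := sum_sum_mul_le (F := fun i j => u j x * u i x)
        (G := fun i j => -(1 / 2 * (u i x * pd j φ x))) (M := absSum u x * B) fun i l => by
          rw [abs_neg, abs_mul, abs_mul]
          have := mul_le_mul (abs_le_absSum u i x) (hB l x) (abs_nonneg _) (absSum_nonneg _ _)
          have h0 : 0 ≤ |u i x| * |pd l φ x| := by positivity
          rw [abs_of_pos (by norm_num : (0 : ℝ) < 1 / 2)]
          linarith
      have e : absSum u x ^ 2 = ∑ i, ∑ j, |u j x * u i x| := by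
        simp_rw [abs_mul, ← Finset.sum_mul, ← Finset.mul_sum]
        rw [sq]; rfl
      rw [← e] at h1
      calc _ = |∑ i, ∑ j, u j x * u i x * -(1 / 2 * (u i x * pd j φ x))| := by
            congr 1
            exact Finset.sum_congr rfl fun i _ => Finset.sum_congr rfl fun j _ => by ring
        _ ≤ _ := h1
        _ = _ := by ring
  rw [integral_add (integrableOn_closedBall (by fun_prop) _ _)
    (integrableOn_closedBall (by fun_prop) _ _)]
  have e0 : ∫ x, φ x * dissip u v x = ∫ x, dissip u v x * φ x := by
    congr 1; ext x; ring
  rw [e0]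
  have := (abs_le.1 b1).1
  have := (abs_le.1 b2).1
  linarith

end WeakForm

section Cutoff

lemma smooth3_radial {g : ℝ → ℝ} (hg : ContDiff ℝ (⊤ : ℕ∞) g) (a b : ℝ) :
    Smooth3 fun x => g (a * ‖x‖ ^ 2 + b) :=
  hg.comp ((contDiff_const.mul (contDiff_norm_sq ℝ)).add contDiff_const)

lemma pd_radial {g : ℝ → ℝ} (hg : ContDiff ℝ (⊤ : ℕ∞) g) (a b : ℝ) (j : Fin 3) (x : E3) :
    pd j (fun x => g (a * ‖x‖ ^ 2 + b)) x = deriv g (a * ‖x‖ ^ 2 + b) * (2 * a * x j) := by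
  have h1 : HasFDerivAt (fun x : E3 => a * ‖x‖ ^ 2 + b) (a • (2 • innerSL ℝ x)) x :=
    ((hasStrictFDerivAt_norm_sq x).hasFDerivAt.const_mul a).add_const b
  have h2 : HasDerivAt g (deriv g (a * ‖x‖ ^ 2 + b)) (a * ‖x‖ ^ 2 + b) :=
    (hg.contDiffAt.differentiableAt (by simp)).hasDerivAt
  have h3 := h2.comp_hasFDerivAt x h1
  rw [pd]
  change fderiv ℝ (g ∘ fun x : E3 => a * ‖x‖ ^ 2 + b) x _ = _
  rw [h3.fderiv]
  simp [EuclideanSpace.inner_single_right, -mul_eq_mul_left_iff]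
  ring

lemma contDiff_deriv_of_smooth {g : ℝ → ℝ} (hg : ContDiff ℝ (⊤ : ℕ∞) g) :
    ContDiff ℝ (⊤ : ℕ∞) (deriv g) :=
  ((contDiff_infty_iff_deriv (𝕜 := ℝ)).1 hg).2

lemma pd_coord (l j : Fin 3) (x : E3) :
    pd l (fun y : E3 => y j) x = if l = j then 1 else 0 := by
  have h : HasFDerivAt (fun y : E3 => y j)
      (EuclideanSpace.proj j : EuclideanSpace ℝ (Fin 3) →L[ℝ] ℝ) x :=
    (EuclideanSpace.proj j : EuclideanSpace ℝ (Fin 3) →L[ℝ] ℝ).hasFDerivAt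
  rw [pd, h.fderiv]
  simp [eq_comm]

lemma smooth3_coord (j : Fin 3) : Smooth3 fun y : E3 => y j :=
  (EuclideanSpace.proj j : EuclideanSpace ℝ (Fin 3) →L[ℝ] ℝ).contDiff

/-- A smooth decreasing profile, equal to one on `t ≤ 0` and to zero on `1 ≤ t`. -/
def profile (t : ℝ) : ℝ := smoothTransition (1 - t)

lemma contDiff_profile : ContDiff ℝ (⊤ : ℕ∞) profile :=
  smoothTransition.contDiff.comp (contDiff_const.sub contDiff_id)

lemma profile_eq_one {t : ℝ} (ht : t ≤ 0) : profile t = 1 :=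
  smoothTransition.one_of_one_le (by linarith)

lemma profile_eq_zero {t : ℝ} (ht : 1 ≤ t) : profile t = 0 :=
  smoothTransition.zero_of_nonpos (by linarith)

lemma antitone_profile : Antitone profile := fun _ _ h =>
  smoothTransition.monotone (by linarith)

lemma deriv_eq_zero_of_const_left {g : ℝ → ℝ} {a c t : ℝ} (h : ∀ s < a, g s = c) (ht : t < a) :
    deriv g t = 0 := by
  have : g =ᶠ[nhds t] fun _ => c := by
    filter_upwards [Iio_mem_nhds ht] with s hs using h s hs
  rw [this.deriv_eq]; simp

lemma deriv_eq_zero_of_const_right {g : ℝ → ℝ} {a c t : ℝ} (h : ∀ s > a, g s = c) (ht : a < t) :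
    deriv g t = 0 := by
  have : g =ᶠ[nhds t] fun _ => c := by
    filter_upwards [Ioi_mem_nhds ht] with s hs using h s hs
  rw [this.deriv_eq]; simp

lemma exists_profile_bounds : ∃ C : ℝ, 0 ≤ C ∧ (∀ t, |deriv profile t| ≤ C) ∧
    ∀ t, |deriv (deriv profile) t| ≤ C := by
  have l1 : ∀ s < (0 : ℝ), deriv profile s = 0 := fun s hs =>
    deriv_eq_zero_of_const_left (fun s hs => profile_eq_one hs.le) hs
  have r1 : ∀ s > (1 : ℝ), deriv profile s = 0 := fun s hs =>
    deriv_eq_zero_of_const_right (fun s hs => profile_eq_zero (le_of_lt hs)) hs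
  have l2 : ∀ s < (0 : ℝ), deriv (deriv profile) s = 0 := fun s hs =>
    deriv_eq_zero_of_const_left l1 hs
  have r2 : ∀ s > (1 : ℝ), deriv (deriv profile) s = 0 := fun s hs =>
    deriv_eq_zero_of_const_right r1 hs
  have c1 := contDiff_deriv_of_smooth contDiff_profile
  have c2 := contDiff_deriv_of_smooth c1
  obtain ⟨C1, h1⟩ := isCompact_Icc.exists_bound_of_continuousOn
    (c1.continuous.continuousOn (s := Set.Icc 0 1))
  obtain ⟨C2, h2⟩ := isCompact_Icc.exists_bound_of_continuousOn
    (c2.continuous.continuousOn (s := Set.Icc 0 1))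
  have aux : ∀ (g : ℝ → ℝ) (C : ℝ), (∀ s < 0, g s = 0) → (∀ s > 1, g s = 0) →
      (∀ x ∈ Set.Icc (0 : ℝ) 1, ‖g x‖ ≤ C) → ∀ t, |g t| ≤ |C| := by
    intro g C hl hr hC t
    rcases lt_or_ge t 0 with h | h
    · simp [hl t h]
    rcases lt_or_ge 1 t with h' | h'
    · simp [hr t h']
    exact (hC t ⟨h, h'⟩).trans (le_abs_self _)
  refine ⟨max |C1| |C2|, le_max_of_le_left (abs_nonneg _), fun t => ?_, fun t => ?_⟩
  · exact (aux _ _ l1 r1 h1 t).trans (le_max_left _ _)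
  · exact (aux _ _ l2 r2 h2 t).trans (le_max_right _ _)

lemma abs_coord_le_norm (x : E3) (j : Fin 3) : |x j| ≤ ‖x‖ := by
  simpa using PiLp.norm_apply_le x j

/-- Cutoff functions with the natural scaling of the derivatives. -/
lemma exists_cutoff : ∃ C : ℝ, 0 < C ∧ ∀ r q : ℝ, 0 ≤ r → r < q → ∃ φ : E3 → ℝ, Smooth3 φ ∧
    (∀ x, ‖x‖ ≤ r → φ x = 1) ∧ (∀ x, q < ‖x‖ → φ x = 0) ∧ (∀ x, 0 ≤ φ x) ∧ (∀ x, φ x ≤ 1) ∧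
    (∀ j x, |pd j φ x| ≤ C / (q - r)) ∧ ∀ l j x, |pd l (pd j φ) x| ≤ C / (q - r) ^ 2 := by
  obtain ⟨C, hC, hC1, hC2⟩ := exists_profile_bounds
  refine ⟨6 * C + 1, by positivity, fun r q hr hrq => ?_⟩
  have hd : 0 < q - r := sub_pos.2 hrq
  have hq : 0 < q := by linarith
  have hD : (q - r) * q ≤ q ^ 2 - r ^ 2 := by nlinarith
  have hD0 : 0 < q ^ 2 - r ^ 2 := (mul_pos hd hq).trans_le hD
  set a := (q ^ 2 - r ^ 2)⁻¹ with ha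
  have ha0 : 0 < a := inv_pos.2 hD0
  have ha1 : a * ((q - r) * q) ≤ 1 := by
    rw [ha, inv_mul_le_iff₀ hD0]; linarith
  have haD : a * (q ^ 2 - r ^ 2) = 1 := inv_mul_cancel₀ hD0.ne'
  have hz : ∀ x : E3, q < ‖x‖ → profile (a * ‖x‖ ^ 2 + -(a * r ^ 2)) = 0 := fun x hx =>
    profile_eq_zero (by
      have : q ^ 2 ≤ ‖x‖ ^ 2 := by gcongr
      nlinarith)
  have hs := smooth3_radial contDiff_profile a (-(a * r ^ 2))
  have haq : a * q ≤ (q - r)⁻¹ := by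
    rw [← one_div, le_div_iff₀ hd]; linarith
  have haq' : a ≤ ((q - r) ^ 2)⁻¹ := by
    rw [← one_div, le_div_iff₀ (by positivity)]
    refine le_trans ?_ ha1
    have : (q - r) ^ 2 ≤ (q - r) * q := by rw [sq]; gcongr; linarith
    gcongr
  have hax : ∀ (x : E3) j, ‖x‖ ≤ q → |2 * a * x j| ≤ 2 * (q - r)⁻¹ := by
    intro x j hx
    rw [abs_mul, abs_of_pos (by positivity), mul_assoc]
    have := (abs_coord_le_norm x j).trans hx
    have : a * |x j| ≤ a * q := by gcongr
    linarith
  refine ⟨fun x => profile (a * ‖x‖ ^ 2 + -(a * r ^ 2)), hs, fun x hx => ?_, hz,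
    fun x => smoothTransition.nonneg _, fun x => smoothTransition.le_one _, fun j x => ?_,
    fun l j x => ?_⟩
  · refine profile_eq_one ?_
    have : ‖x‖ ^ 2 ≤ r ^ 2 := by gcongr
    nlinarith
  · rcases lt_or_ge q ‖x‖ with hx | hx
    · rw [pd_eq_zero_of_eqOn_compl hz hx, abs_zero]; positivity
    rw [pd_radial contDiff_profile, abs_mul, div_eq_mul_inv]
    calc _ ≤ C * (2 * (q - r)⁻¹) := mul_le_mul (hC1 _) (hax x j hx) (abs_nonneg _) hC
      _ = 2 * C * (q - r)⁻¹ := by ring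
      _ ≤ _ := by gcongr; linarith
  · rcases lt_or_ge q ‖x‖ with hx | hx
    · rw [pd_eq_zero_of_eqOn_compl (fun y hy => pd_eq_zero_of_eqOn_compl hz hy) hx, abs_zero]
      positivity
    have c1 := contDiff_deriv_of_smooth contDiff_profile
    have e : pd j (fun x => profile (a * ‖x‖ ^ 2 + -(a * r ^ 2)))
        = fun x => deriv profile (a * ‖x‖ ^ 2 + -(a * r ^ 2)) * (2 * a * x j) :=
      funext fun y => pd_radial contDiff_profile _ _ _ _
    rw [e, pd_mul ((smooth3_radial c1 _ _).differentiableAt x)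
      (((smooth3_coord j).differentiableAt x).const_mul _), pd_radial c1,
      pd_const_mul _ ((smooth3_coord j).differentiableAt x), pd_coord, div_eq_mul_inv]
    have b1 : |deriv (deriv profile) (a * ‖x‖ ^ 2 + -(a * r ^ 2)) * (2 * a * x l) * (2 * a * x j)|
        ≤ C * (2 * (q - r)⁻¹) * (2 * (q - r)⁻¹) := by
      rw [abs_mul, abs_mul]
      exact mul_le_mul (mul_le_mul (hC2 _) (hax x l hx) (abs_nonneg _) hC) (hax x j hx)
        (abs_nonneg _) (by positivity)
    have b2 : |deriv profile (a * ‖x‖ ^ 2 + -(a * r ^ 2)) * (2 * a * if l = j then 1 else 0)|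
        ≤ C * (2 * ((q - r) ^ 2)⁻¹) := by
      rw [abs_mul]
      refine mul_le_mul (hC1 _) ?_ (abs_nonneg _) hC
      split_ifs
      · rw [mul_one, abs_of_pos (by positivity)]
        gcongr
      · simp; positivity
    refine (abs_add_le _ _).trans ((add_le_add b1 b2).trans ?_)
    have : C * (2 * (q - r)⁻¹) * (2 * (q - r)⁻¹) + C * (2 * ((q - r) ^ 2)⁻¹)
        = 6 * C * ((q - r) ^ 2)⁻¹ := by
      rw [← inv_pow]; ring
    rw [this]
    gcongr
    linarith

/-- A smoothing kernel `κ` with `∇κ = -y m` and `m` of positive mass. -/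
lemma exists_kernel : ∃ κ m : E3 → ℝ, Smooth3 κ ∧ Smooth3 m ∧ (∀ y, 1 < ‖y‖ → κ y = 0) ∧
    (∀ y, 1 < ‖y‖ → m y = 0) ∧ (∀ j y, pd j κ y = -(y j * m y)) ∧
    0 < ∫ y in closedBall (0 : E3) 1, m y := by
  have c1 := contDiff_deriv_of_smooth contDiff_profile
  set κ : E3 → ℝ := fun y => profile (1 * ‖y‖ ^ 2 + 0) with hκ
  set m : E3 → ℝ := fun y => -2 * deriv profile (1 * ‖y‖ ^ 2 + 0) with hm
  have hκs : Smooth3 κ := smooth3_radial contDiff_profile 1 0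
  have hms : Smooth3 m := contDiff_const.mul (smooth3_radial c1 1 0)
  have hκ1 : ∀ y, 1 < ‖y‖ → κ y = 0 := fun y hy => profile_eq_zero (by nlinarith)
  have hm1 : ∀ y, 1 < ‖y‖ → m y = 0 := fun y hy => by
    have : deriv profile (1 * ‖y‖ ^ 2 + 0) = 0 :=
      deriv_eq_zero_of_const_right (a := 1) (fun s hs => profile_eq_zero (le_of_lt hs)) (by nlinarith)
    simp only [hm, this, mul_zero]
  have hκm : ∀ j y, pd j κ y = -(y j * m y) := fun j y => by
    rw [pd_radial contDiff_profile]
    simp only [hm]; ring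
  refine ⟨κ, m, hκs, hms, hκ1, hm1, hκm, ?_⟩
  rw [setIntegral_eq_integral_of_forall_compl_eq_zero fun y hy => hm1 y (by simpa using hy)]
  have hm0 : ∃ y, m y ≠ 0 := by
    by_contra! h
    have hf : ∀ x, fderiv ℝ κ x = 0 := fun x => ContinuousLinearMap.ext fun z => by
      simp [fderiv_eq_sum_pd, hκm, h]
    have hconst := is_const_of_fderiv_eq_zero (hκs.differentiable (by simp)) hf 0
      (EuclideanSpace.single 0 2)
    rw [hκ1 (EuclideanSpace.single 0 2) (by simp)] at hconst
    simp [hκ, profile] at hconst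
  obtain ⟨y, hy⟩ := hm0
  refine hms.continuous.integral_pos_of_hasCompactSupport_nonneg_nonzero
    (hasCompactSupport_of_eq_zero hm1) (fun y => ?_) hy
  have : deriv profile (1 * ‖y‖ ^ 2 + 0) ≤ 0 := antitone_profile.deriv_nonpos
  simp only [hm, Pi.zero_apply]
  linarith

lemma exists_bound_of_eq_zero {f : E3 → ℝ} {q : ℝ} (hf : Continuous f)
    (hz : ∀ x, q < ‖x‖ → f x = 0) : ∃ C, ∀ x, |f x| ≤ C := by
  obtain ⟨C, hC⟩ := (isCompact_closedBall (0 : E3) q).exists_bound_of_continuousOn hf.continuousOn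
  refine ⟨|C|, fun x => ?_⟩
  rcases lt_or_ge q ‖x‖ with hx | hx
  · simp [hz x hx]
  · exact (hC x (by simpa using hx)).trans (le_abs_self C)

end Cutoff

section PressurePairing

variable {u V : Fin 3 → E3 → ℝ} {Q φ κ m : E3 → ℝ} {q : ℝ}

/-- The commutator field `∑_j ∂_jφ (∂_j V_i - ∂_i V_j)`. -/
def curlField (φ : E3 → ℝ) (V : Fin 3 → E3 → ℝ) (i : Fin 3) (x : E3) : ℝ :=
  ∑ j, pd j φ x * (pd j (V i) x - pd i (V j) x)

lemma smooth_curlField (hφ : Smooth3 φ) (hV : ∀ i, Smooth3 (V i)) (i : Fin 3) :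
    Smooth3 (curlField φ V i) :=
  ContDiff.sum fun j _ => (hφ.pd j).mul (((hV i).pd j).sub ((hV j).pd i))

lemma curlField_eq_zero (hz : ∀ x, q < ‖x‖ → φ x = 0) (i : Fin 3) (x : E3) (hx : q < ‖x‖) :
    curlField φ V i x = 0 :=
  Finset.sum_eq_zero fun j _ => by rw [pd_eq_zero_of_eqOn_compl hz hx, zero_mul]

/-- Gradients pair with localised Laplacians of divergence-free fields only through the
derivatives of the cutoff. -/
lemma gradPair_mul_lap (hQ : Smooth3 Q) (hφ : Smooth3 φ) (hz : ∀ x, q < ‖x‖ → φ x = 0)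
    (hV : ∀ i, Smooth3 (V i)) (hdiv : ∀ x, ∑ j, pd j (V j) x = 0) :
    gradPair Q (fun i x => φ x * lap (V i) x) = -gradPair Q (curlField φ V) := by
  set ω : Fin 3 → Fin 3 → E3 → ℝ := fun i j x => pd j (V i) x - pd i (V j) x with hω
  have hωs : ∀ i j, Smooth3 (ω i j) := fun i j => ((hV i).pd j).sub ((hV j).pd i)
  have hg : ∀ i, Smooth3 fun x => pd i Q x * φ x := fun i => (hQ.pd i).mul hφ
  have hgz : ∀ i x, q < ‖x‖ → pd i Q x * φ x = 0 := fun i x hx => by rw [hz x hx, mul_zero]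
  have hlap : ∀ i x, lap (V i) x = ∑ j, pd j (ω i j) x := by
    intro i x
    have h1 : ∀ j, pd j (ω i j) x = pd j (pd j (V i)) x - pd i (pd j (V j)) x := by
      intro j
      rw [pd_comm (hV j) i j]
      exact pd_sub (((hV i).pd j).differentiableAt x) (((hV j).pd i).differentiableAt x)
    have h2 : ∑ j, pd i (pd j (V j)) x = 0 := by
      rw [← pd_sum fun j _ => ((hV j).pd j).differentiableAt x]
      have h0 : (fun y => ∑ j, pd j (V j) y) = fun _ => 0 := funext hdiv
      rw [h0]
      simp [pd]
    simp_rw [h1, Finset.sum_sub_distrib, h2, sub_zero]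
    rfl
  have e1 : ∀ i j, ∫ x, pd j (ω i j) x * (pd i Q x * φ x)
      = -(∫ x, ω i j x * pd j (pd i Q) x * φ x) - ∫ x, pd i Q x * (pd j φ x * ω i j x) := by
    intro i j
    have h := integral_mul_pd ((hωs i j).of_le (by simp)) ((hg i).of_le (by simp))
      (hasCompactSupport_of_eq_zero (hgz i)) j
    have h2 : ∫ x, pd j (ω i j) x * (pd i Q x * φ x)
        = -∫ x, ω i j x * pd j (fun x => pd i Q x * φ x) x := by rw [h, neg_neg]
    rw [h2, ← neg_add', ← integral_add]
    · congr 1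
      refine integral_congr_ae (ae_of_all _ fun x => ?_)
      change ω i j x * pd j (fun x => pd i Q x * φ x) x = _
      rw [pd_mul ((hQ.pd i).differentiableAt x) (hφ.differentiableAt x)]
      ring
    · exact integrable_mul_of_eq_zero ((hωs i j).continuous.mul ((hQ.pd i).pd j).continuous)
        hφ.continuous hz
    · exact integrable_mul_of_eq_zero (q := q) (hQ.pd i).continuous
        ((hφ.pd j).continuous.mul (hωs i j).continuous)
        fun x (hx : q < ‖x‖) => by rw [pd_eq_zero_of_eqOn_compl hz hx, zero_mul]
  have e2 : ∑ i, ∑ j, ∫ x, ω i j x * pd j (pd i Q) x * φ x = 0 := by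
    have hi : ∀ i j, Integrable fun x => ω i j x * pd j (pd i Q) x * φ x := fun i j =>
      integrable_mul_of_eq_zero ((hωs i j).continuous.mul ((hQ.pd i).pd j).continuous)
        hφ.continuous hz
    have hs : ∀ i j, ∫ x, ω i j x * pd j (pd i Q) x * φ x
        = -∫ x, ω j i x * pd i (pd j Q) x * φ x := by
      intro i j
      rw [← integral_neg]
      refine integral_congr_ae (ae_of_all _ fun x => ?_)
      simp only [hω, pd_comm hQ i j]
      ring
    have h1 : ∑ i, ∑ j, ∫ x, ω i j x * pd j (pd i Q) x * φ x
        = -∑ i, ∑ j, ∫ x, ω j i x * pd i (pd j Q) x * φ x := by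
      simp_rw [← Finset.sum_neg_distrib]
      exact Finset.sum_congr rfl fun i _ => Finset.sum_congr rfl fun j _ => hs i j
    rw [Finset.sum_comm (f := fun i j => ∫ x, ω j i x * pd i (pd j Q) x * φ x)] at h1
    linarith
  have e3 : ∀ i, ∫ x, pd i Q x * (φ x * lap (V i) x)
      = ∑ j, ∫ x, pd j (ω i j) x * (pd i Q x * φ x) := by
    intro i
    rw [← integral_finsetSum]
    · refine integral_congr_ae (ae_of_all _ fun x => ?_)
      simp only [hlap, ← Finset.sum_mul]
      ring
    · exact fun j _ => integrable_mul_of_eq_zero ((hωs i j).pd j).continuous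
        (hg i).continuous (hgz i)
  have e4 : ∀ i, ∫ x, pd i Q x * curlField φ V i x
      = ∑ j, ∫ x, pd i Q x * (pd j φ x * ω i j x) := by
    intro i
    rw [← integral_finsetSum]
    · simp only [curlField, Finset.mul_sum, hω]
    · exact fun j _ => integrable_mul_of_eq_zero (q := q) (hQ.pd i).continuous
        ((hφ.pd j).continuous.mul (hωs i j).continuous)
        fun x (hx : q < ‖x‖) => by rw [pd_eq_zero_of_eqOn_compl hz hx, zero_mul]
  unfold gradPair
  simp_rw [e3, e4, e1, Finset.sum_sub_distrib, Finset.sum_neg_distrib, e2]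
  ring

lemma lap_const_mul_av (hκ : Continuous κ) {f : E3 → ℝ} (hf : Smooth3 f) (s : ℝ) (x : E3) :
    lap (fun y => s * av κ f s y) x = s * av κ (lap f) s x := by
  have h1 : ∀ j, pd j (fun y => s * av κ f s y) = fun y => s * av κ (pd j f) s y := fun j =>
    funext fun y => by
      rw [pd_const_mul _ ((hf.av hκ s).differentiableAt y), pd_av hκ hf]
  have h2 : ∀ j, pd j (fun y => s * av κ (pd j f) s y) x = s * av κ (pd j (pd j f)) s x :=
    fun j => by rw [pd_const_mul _ (((hf.pd j).av hκ s).differentiableAt x), pd_av hκ (hf.pd j)]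
  unfold lap
  simp_rw [h1, h2, ← Finset.mul_sum]
  congr 1
  unfold av
  rw [← integral_finsetSum]
  · simp_rw [Finset.mul_sum]
  · intro j _
    have := ((hf.pd j).pd j).continuous
    exact integrableOn_closedBall (by fun_prop) _ _

lemma div_const_mul_av (hκ : Continuous κ) (hu : ∀ i, Smooth3 (u i))
    (hdiv : ∀ x, ∑ j, pd j (u j) x = 0) (s : ℝ) (x : E3) :
    ∑ j, pd j (fun y => s * av κ (u j) s y) x = 0 := by
  have h1 : ∀ j, pd j (fun y => s * av κ (u j) s y) x = s * av κ (pd j (u j)) s x := fun j => by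
      rw [pd_const_mul _ (((hu j).av hκ s).differentiableAt x), pd_av hκ (hu j)]
  simp_rw [h1, ← Finset.mul_sum]
  unfold av
  rw [← integral_finsetSum]
  · simp_rw [← Finset.mul_sum, hdiv]
    simp
  · intro j _
    have := ((hu j).pd j).continuous
    exact integrableOn_closedBall (by fun_prop) _ _

/-- The rate of change, in the averaging scale, of the pressure pairing. -/
def pairRate (Q φ κ : E3 → ℝ) (u : Fin 3 → E3 → ℝ) (s : ℝ) : ℝ :=
  gradPair Q fun i x => φ x * (s * av κ (lap (u i)) s x)

lemma pairRate_eq (hQ : Smooth3 Q) (hφ : Smooth3 φ) (hz : ∀ x, q < ‖x‖ → φ x = 0)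
    (hκ : Continuous κ) (hu : ∀ i, Smooth3 (u i)) (hdiv : ∀ x, ∑ j, pd j (u j) x = 0) (s : ℝ) :
    pairRate Q φ κ u s = -gradPair Q (curlField φ fun i x => s * av κ (u i) s x) := by
  rw [← gradPair_mul_lap hQ hφ hz (fun i => contDiff_const.mul ((hu i).av hκ s))
    (div_const_mul_av hκ hu hdiv s)]
  simp_rw [lap_const_mul_av hκ (hu _)]
  rfl

lemma pairRate_eq_setIntegral (hz : ∀ x, q < ‖x‖ → φ x = 0) (s : ℝ) :
    pairRate Q φ κ u s = ∑ i, ∫ x in closedBall (0 : E3) q,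
      pd i Q x * (φ x * (s * av κ (lap (u i)) s x)) := by
  unfold pairRate gradPair
  refine Finset.sum_congr rfl fun i _ => ?_
  rw [setIntegral_eq_integral_of_forall_compl_eq_zero fun x hx => ?_]
  simp [hz x (by simpa using hx)]

lemma continuous_pairRate (hQ : Smooth3 Q) (hφ : Smooth3 φ) (hz : ∀ x, q < ‖x‖ → φ x = 0)
    (hκ : Continuous κ) (hu : ∀ i, Smooth3 (u i)) : Continuous (pairRate Q φ κ u) := by
  have e : pairRate Q φ κ u = _ := funext fun s => pairRate_eq_setIntegral hz s
  rw [e]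
  refine continuous_finsetSum _ fun i _ => ?_
  refine continuous_parametric_integral_of_continuous
    (f := fun s x => pd i Q x * (φ x * (s * av κ (lap (u i)) s x))) ?_ (isCompact_closedBall _ _)
  have := continuous_av hκ (smooth3_lap (hu i)).continuous
  have := (hQ.pd i).continuous
  have := hφ.continuous
  unfold Function.uncurry
  fun_prop

lemma gradPair_av_sub (hQ : Smooth3 Q) (hφ : Smooth3 φ) (hz : ∀ x, q < ‖x‖ → φ x = 0)
    (hκ : Smooth3 κ) (hκ1 : ∀ y, 1 < ‖y‖ → κ y = 0) (hm : Continuous m)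
    (hκm : ∀ j y, pd j κ y = -(y j * m y)) (hu : ∀ i, Smooth3 (u i)) {T : ℝ} (hT : 0 ≤ T) :
    gradPair Q (fun i x => φ x * av m (u i) T x)
      - (∫ y in closedBall (0 : E3) 1, m y) * gradPair Q (fun i x => φ x * u i x)
      = ∫ s in (0 : ℝ)..T, pairRate Q φ κ u s := by
  have hcQ := fun i => (hQ.pd i).continuous
  have hcφ := hφ.continuous
  have hcL := fun i => continuous_av hκ.continuous (smooth3_lap (hu i)).continuous
  have hF : ∀ i, Continuous fun z : ℝ × E3 =>
      pd i Q z.2 * (φ z.2 * (z.1 * av κ (lap (u i)) z.1 z.2)) := fun i => by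
    have := hcL i
    have := hcQ i
    fun_prop
  have hswap : ∀ i, ∫ s in (0 : ℝ)..T, ∫ x in closedBall (0 : E3) q,
      pd i Q x * (φ x * (s * av κ (lap (u i)) s x))
      = ∫ x in closedBall (0 : E3) q, pd i Q x * (φ x * ∫ s in (0 : ℝ)..T,
        s * av κ (lap (u i)) s x) := by
    intro i
    rw [intervalIntegral.integral_of_le hT, ← integral_Icc_eq_integral_Ioc,
      integral_integral_swap]
    · refine setIntegral_congr_fun measurableSet_closedBall fun x _ => ?_
      rw [intervalIntegral.integral_of_le hT, ← integral_Icc_eq_integral_Ioc,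
        ← integral_const_mul, ← integral_const_mul]
    · rw [Measure.prod_restrict]
      exact (hF i).continuousOn.integrableOn_compact (isCompact_Icc.prod (isCompact_closedBall _ _))
  have e : pairRate Q φ κ u = _ := funext fun s => pairRate_eq_setIntegral hz s
  rw [e, intervalIntegral.integral_finsetSum]
  · unfold gradPair
    rw [Finset.mul_sum, ← Finset.sum_sub_distrib]
    refine Finset.sum_congr rfl fun i _ => ?_
    have hca := continuous_av_right hm (hu i).continuous T
    have hcu := (hu i).continuous
    rw [hswap, ← integral_const_mul, ← integral_sub]
    · rw [setIntegral_eq_integral_of_forall_compl_eq_zero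
        (f := fun x => pd i Q x * (φ x * ∫ s in (0 : ℝ)..T, s * av κ (lap (u i)) s x))
        fun x hx => by simp [hz x (by simpa using hx)]]
      refine integral_congr_ae (ae_of_all _ fun x => ?_)
      simp only [← av_sub_eq_intervalIntegral hκ hκ1 hm hκm (hu i)]
      ring
    · exact integrable_mul_of_eq_zero (q := q) (hcQ i) (hcφ.mul hca) fun x (hx : q < ‖x‖) => by
        simp [hz x hx]
    · exact (integrable_mul_of_eq_zero (q := q) (hcQ i) (hcφ.mul hcu) fun x (hx : q < ‖x‖) => by
        simp [hz x hx]).const_mul _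
  · intro i _
    refine Continuous.intervalIntegrable ?_ _ _
    exact continuous_parametric_integral_of_continuous
      (f := fun s x => pd i Q x * (φ x * (s * av κ (lap (u i)) s x))) (hF i)
      (isCompact_closedBall _ _)

end PressurePairing

section AverageBounds

/-- Bounds on a ball for the quantities controlling the local energy. -/
structure BallBounds (a D h t : E3 → ℝ) (ρ n E U2 U3 V2 V3 : ℝ) : Prop where
  cont_a : Continuous a
  cont_D : Continuous D
  cont_h : Continuous h
  cont_t : Continuous t
  a_nonneg : ∀ x, 0 ≤ a x
  D_nonneg : ∀ x, 0 ≤ D x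
  h_nonneg : ∀ x, 0 ≤ h x
  t_nonneg : ∀ x, 0 ≤ t x
  int_D : ∫ x in closedBall (0 : E3) ρ, D x ^ 2 ≤ E
  int_t : ∫ x in closedBall (0 : E3) ρ, t x ^ 2 ≤ E
  int_a_sq : ∫ x in closedBall (0 : E3) ρ, a x ^ 2 ≤ U2
  int_a_cube : ∫ x in closedBall (0 : E3) ρ, a x ^ 3 ≤ U3
  int_h_sq : ∫ x in closedBall (0 : E3) ρ, h x ^ 2 ≤ V2
  int_h_cube : ∫ x in closedBall (0 : E3) ρ, h x ^ 3 ≤ V3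
  one_le_n : 1 ≤ n
  cube_le : U3 ≤ n ^ 3

variable {a D h t f : E3 → ℝ} {ρ q n E U2 U3 V2 V3 s l : ℝ}

lemma sq_mul_le_cube_add {x y : ℝ} (hx : 0 ≤ x) (hy : 0 ≤ y) : x ^ 2 * y ≤ x ^ 3 + y ^ 3 := by
  rcases le_total x y with h | h
  · nlinarith [mul_le_mul_of_nonneg_right (pow_le_pow_left₀ hx h 2) hy, pow_nonneg hx 3]
  · nlinarith [mul_le_mul_of_nonneg_left h (sq_nonneg x), pow_nonneg hy 3]

lemma mul_le_weighted {x y : ℝ} (hl : 0 < l) : x * y ≤ l * x ^ 2 + l⁻¹ * y ^ 2 := by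
  have h : 0 ≤ l⁻¹ * ((l * x - y) ^ 2 + (l * x) ^ 2 + y ^ 2) := by positivity
  have e : l⁻¹ * ((l * x - y) ^ 2 + (l * x) ^ 2 + y ^ 2)
      = (l⁻¹ * l) * (2 * l * x ^ 2) - (l⁻¹ * l) * (2 * (x * y)) + 2 * (l⁻¹ * y ^ 2) := by ring
  rw [e, inv_mul_cancel₀ hl.ne'] at h
  linarith

lemma setIntegral_nonneg_of_le {I : ℝ} (h0 : ∀ x, 0 ≤ f x)
    (h : ∫ x in closedBall (0 : E3) ρ, f x ≤ I) : 0 ≤ I :=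
  (integral_nonneg h0).trans h

lemma setIntegral_avg_sq_le (hf : Continuous f) (h0 : ∀ x, 0 ≤ f x) (hs : 0 ≤ s)
    (hq : q + s ≤ ρ) {I : ℝ} (hI : ∫ x in closedBall (0 : E3) ρ, f x ^ 2 ≤ I) :
    ∫ x in closedBall (0 : E3) q, avg f s x ^ 2 ≤ unitVol ^ 2 * I := by
  have hV := unitVol_pos
  have hc : Continuous fun x => f x ^ 2 := hf.pow 2
  have c1 := continuous_avg hf s
  have c2 := continuous_avg hc s
  have h1 := setIntegral_closedBall_mono (q := q) (F := fun x => avg f s x ^ 2)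
    (G := fun x => unitVol * avg (fun x => f x ^ 2) s x) (by fun_prop) (by fun_prop) fun x _ => avg_sq_le hf h0
  rw [integral_const_mul] at h1
  have h2 := setIntegral_avg_le hc (fun x => sq_nonneg _) hs hq
  calc _ ≤ _ := h1
    _ ≤ unitVol * (unitVol * I) := by gcongr; exact h2.trans (by gcongr)
    _ = _ := by ring

lemma setIntegral_avg_cube_le (hf : Continuous f) (h0 : ∀ x, 0 ≤ f x) (hs : 0 ≤ s)
    (hq : q + s ≤ ρ) {I : ℝ} (hI : ∫ x in closedBall (0 : E3) ρ, f x ^ 3 ≤ I) :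
    ∫ x in closedBall (0 : E3) q, avg f s x ^ 3 ≤ unitVol ^ 3 * I := by
  have hV := unitVol_pos
  have hc : Continuous fun x => f x ^ 3 := hf.pow 3
  have c1 := continuous_avg hf s
  have c2 := continuous_avg hc s
  have h1 := setIntegral_closedBall_mono (q := q) (F := fun x => avg f s x ^ 3)
    (G := fun x => unitVol ^ 2 * avg (fun x => f x ^ 3) s x) (by fun_prop) (by fun_prop) fun x _ => avg_cube_le hf h0
  rw [integral_const_mul] at h1
  have h2 := setIntegral_avg_le hc (fun x => pow_nonneg (h0 x) 3) hs hq
  calc _ ≤ _ := h1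
    _ ≤ unitVol ^ 2 * (unitVol * I) := by gcongr; exact h2.trans (by gcongr)
    _ = _ := by ring

lemma setIntegral_le_of_radius_le {I : ℝ} (hf : Continuous f) (h0 : ∀ x, 0 ≤ f x) (hq : q ≤ ρ)
    (h : ∫ x in closedBall (0 : E3) ρ, f x ≤ I) : ∫ x in closedBall (0 : E3) q, f x ≤ I :=
  (setIntegral_closedBall_mono_radius hf h0 hq).trans h

lemma BallBounds.mul_avg_le (B : BallBounds a D h t ρ n E U2 U3 V2 V3) (hs : 0 < s)
    (hq : q + s ≤ ρ) {x : E3} (hx : ‖x‖ ≤ q) : s * avg a s x ≤ (1 + unitVol) * n := by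
  have hn := B.one_le_n
  have h1 := avg_le_of_integral_cube (n := n) B.cont_a B.a_nonneg hs (by linarith : ‖x‖ + s ≤ ρ)
    (by linarith) (B.int_a_cube.trans B.cube_le)
  rw [le_div_iff₀ hs] at h1
  linarith

/-- The bound for scales comparable to the width of the annulus. -/
lemma BallBounds.far_le (B : BallBounds a D h t ρ n E U2 U3 V2 V3) (hs : 0 < s)
    (hq : q + s ≤ ρ) (hl : 0 < l) :
    ∫ x in closedBall (0 : E3) q, (D x * avg a s x + a x ^ 2 * avg a s x
      + s * (h x * t x * avg a s x))
      ≤ 2 * (1 + unitVol) ^ 3 * (l * E + l⁻¹ * (U2 + n ^ 2 * V2) + U3) := by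
  have hV := unitVol_pos
  have hn := B.one_le_n
  have ca := B.cont_a
  have cD := B.cont_D
  have ch := B.cont_h
  have ct := B.cont_t
  have cA := continuous_avg ca s
  have hA : ∀ x, 0 ≤ avg a s x := avg_nonneg B.a_nonneg s
  have hqρ : q ≤ ρ := by linarith
  have hE : 0 ≤ E := setIntegral_nonneg_of_le (fun _ => sq_nonneg _) B.int_D
  have hU2 : 0 ≤ U2 := setIntegral_nonneg_of_le (fun _ => sq_nonneg _) B.int_a_sq
  have hV2 : 0 ≤ V2 := setIntegral_nonneg_of_le (fun _ => sq_nonneg _) B.int_h_sq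
  have hU3 : 0 ≤ U3 := setIntegral_nonneg_of_le (fun x => pow_nonneg (B.a_nonneg x) 3) B.int_a_cube
  have I1 := setIntegral_le_of_radius_le (f := fun x => D x ^ 2) (by fun_prop) (fun _ => sq_nonneg _) hqρ B.int_D
  have I2 := setIntegral_le_of_radius_le (f := fun x => t x ^ 2) (by fun_prop) (fun _ => sq_nonneg _) hqρ B.int_t
  have I3 := setIntegral_le_of_radius_le (f := fun x => a x ^ 3) (by fun_prop) (fun x => pow_nonneg (B.a_nonneg x) 3) hqρ
    B.int_a_cube
  have I4 := setIntegral_le_of_radius_le (f := fun x => h x ^ 2) (by fun_prop) (fun _ => sq_nonneg _) hqρ B.int_h_sq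
  have I5 := setIntegral_avg_sq_le ca B.a_nonneg hs.le hq B.int_a_sq
  have I6 := setIntegral_avg_cube_le ca B.a_nonneg hs.le hq B.int_a_cube
  have key := setIntegral_closedBall_mono (q := q)
    (F := fun x => D x * avg a s x + a x ^ 2 * avg a s x + s * (h x * t x * avg a s x))
    (G := fun x => l * D x ^ 2 + l⁻¹ * avg a s x ^ 2 + a x ^ 3 + avg a s x ^ 3
      + (1 + unitVol) * l * t x ^ 2 + (1 + unitVol) * (l⁻¹ * n ^ 2) * h x ^ 2)
    (by fun_prop) (by fun_prop) fun x hx => by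
      have h1 := mul_le_weighted (x := D x) (y := avg a s x) hl
      have h2 := sq_mul_le_cube_add (B.a_nonneg x) (hA x)
      have h3 := B.mul_avg_le hs hq hx
      have h4 := mul_le_weighted (x := t x) (y := n * h x) hl
      have h5 : h x * t x * (s * avg a s x) ≤ h x * t x * ((1 + unitVol) * n) :=
        mul_le_mul_of_nonneg_left h3 (mul_nonneg (B.h_nonneg x) (B.t_nonneg x))
      have h6 : (1 + unitVol) * (t x * (n * h x))
          ≤ (1 + unitVol) * (l * t x ^ 2 + l⁻¹ * (n * h x) ^ 2) := by gcongr
      have e : s * (h x * t x * avg a s x) = h x * t x * (s * avg a s x) := by ring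
      rw [e]
      linarith
  refine key.trans ?_
  clear key
  rw [integral_add (integrableOn_closedBall (by fun_prop) _ _)
      (integrableOn_closedBall (by fun_prop) _ _),
    integral_add (integrableOn_closedBall (by fun_prop) _ _)
      (integrableOn_closedBall (by fun_prop) _ _),
    integral_add (integrableOn_closedBall (by fun_prop) _ _)
      (integrableOn_closedBall (by fun_prop) _ _),
    integral_add (integrableOn_closedBall (by fun_prop) _ _)
      (integrableOn_closedBall (by fun_prop) _ _),
    integral_add (integrableOn_closedBall (by fun_prop) _ _)
      (integrableOn_closedBall (by fun_prop) _ _)]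
  simp only [integral_const_mul]
  have hl' : 0 < l⁻¹ := inv_pos.2 hl
  have hc1 : 2 + unitVol ≤ 2 * (1 + unitVol) ^ 3 := by nlinarith [pow_pos hV 2, pow_pos hV 3]
  have hc2 : unitVol ^ 2 ≤ 2 * (1 + unitVol) ^ 3 := by nlinarith [pow_pos hV 2, pow_pos hV 3]
  have hc3 : 1 + unitVol ^ 3 ≤ 2 * (1 + unitVol) ^ 3 := by nlinarith [pow_pos hV 2, pow_pos hV 3]
  have hc4 : 1 + unitVol ≤ 2 * (1 + unitVol) ^ 3 := by linarith
  calc _ ≤ l * E + l⁻¹ * (unitVol ^ 2 * U2) + U3 + unitVol ^ 3 * U3 + (1 + unitVol) * l * E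
        + (1 + unitVol) * (l⁻¹ * n ^ 2) * V2 := by gcongr
    _ = (2 + unitVol) * (l * E) + unitVol ^ 2 * (l⁻¹ * U2) + (1 + unitVol) * (l⁻¹ * (n ^ 2 * V2))
        + (1 + unitVol ^ 3) * U3 := by ring
    _ ≤ 2 * (1 + unitVol) ^ 3 * (l * E) + 2 * (1 + unitVol) ^ 3 * (l⁻¹ * U2)
        + 2 * (1 + unitVol) ^ 3 * (l⁻¹ * (n ^ 2 * V2)) + 2 * (1 + unitVol) ^ 3 * U3 := by
      gcongr
    _ = _ := by ring

/-- The bound for small scales, integrable in the scale. -/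
lemma BallBounds.near_le (B : BallBounds a D h t ρ n E U2 U3 V2 V3) (hs : 0 < s) (hs1 : s ≤ 1)
    (hq : q + s ≤ ρ) :
    √s * ∫ x in closedBall (0 : E3) q, (D x * avg a s x + D x * avg D s x
      + a x * D x * avg a s x + h x * t x * avg a s x)
      ≤ 4 * (1 + unitVol) ^ 4 * n * (E + U2 + U3 + V3) := by
  have hV := unitVol_pos
  have hn := B.one_le_n
  have ca := B.cont_a
  have cD := B.cont_D
  have ch := B.cont_h
  have ct := B.cont_t
  have cA := continuous_avg ca s
  have cA' := continuous_avg cD s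
  have hA : ∀ x, 0 ≤ avg a s x := avg_nonneg B.a_nonneg s
  have hqρ : q ≤ ρ := by linarith
  have hE : 0 ≤ E := setIntegral_nonneg_of_le (fun _ => sq_nonneg _) B.int_D
  have hU2 : 0 ≤ U2 := setIntegral_nonneg_of_le (fun _ => sq_nonneg _) B.int_a_sq
  have hV3 : 0 ≤ V3 := setIntegral_nonneg_of_le (fun x => pow_nonneg (B.h_nonneg x) 3) B.int_h_cube
  have hU3 : 0 ≤ U3 := setIntegral_nonneg_of_le (fun x => pow_nonneg (B.a_nonneg x) 3) B.int_a_cube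
  have I1 := setIntegral_le_of_radius_le (f := fun x => D x ^ 2) (by fun_prop) (fun _ => sq_nonneg _) hqρ B.int_D
  have I2 := setIntegral_le_of_radius_le (f := fun x => t x ^ 2) (by fun_prop) (fun _ => sq_nonneg _) hqρ B.int_t
  have I3 := setIntegral_le_of_radius_le (f := fun x => a x ^ 3) (by fun_prop) (fun x => pow_nonneg (B.a_nonneg x) 3) hqρ
    B.int_a_cube
  have I4 := setIntegral_le_of_radius_le (f := fun x => h x ^ 3) (by fun_prop) (fun x => pow_nonneg (B.h_nonneg x) 3) hqρ
    B.int_h_cube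
  have I5 := setIntegral_avg_sq_le ca B.a_nonneg hs.le hq B.int_a_sq
  have I6 := setIntegral_avg_cube_le ca B.a_nonneg hs.le hq B.int_a_cube
  have I7 := setIntegral_avg_sq_le cD B.D_nonneg hs.le hq B.int_D
  set σ := √s with hσ
  have hσ0 : 0 < σ := Real.sqrt_pos.2 hs
  have hσ1 : σ ≤ 1 := Real.sqrt_le_one.2 hs1
  have hσs : σ ^ 2 = s := Real.sq_sqrt hs.le
  set M := (1 + unitVol) * n with hM
  have hM0 : 0 < M := by positivity
  rw [← integral_const_mul]
  have key := setIntegral_closedBall_mono (q := q)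
    (F := fun x => σ * (D x * avg a s x + D x * avg D s x
      + a x * D x * avg a s x + h x * t x * avg a s x))
    (G := fun x => 3 * D x ^ 2 + avg a s x ^ 2 + avg D s x ^ 2 + t x ^ 2 + M * a x ^ 3
      + M * h x ^ 3 + 2 * M * avg a s x ^ 3)
    (by fun_prop) (by fun_prop) fun x hx => by
      have hDx := B.D_nonneg x
      have hax := B.a_nonneg x
      have hhx := B.h_nonneg x
      have hAx := hA x
      have hA'x := avg_nonneg B.D_nonneg s x
      have h1 := mul_le_weighted (x := D x) (y := avg a s x) one_pos
      have h2 := mul_le_weighted (x := D x) (y := avg D s x) one_pos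
      have h3 : s * avg a s x ≤ M := B.mul_avg_le hs hq hx
      have h4 := sq_mul_le_cube_add hax hAx
      have h5 := sq_mul_le_cube_add hhx hAx
      have h1' : σ * (D x * avg a s x) ≤ D x * avg a s x :=
        mul_le_of_le_one_left (by positivity) hσ1
      have h2' : σ * (D x * avg D s x) ≤ D x * avg D s x :=
        mul_le_of_le_one_left (by positivity) hσ1
      have aux : ∀ y z : ℝ, y * (σ * z * avg a s x) ≤ y ^ 2 + M * (z ^ 2 * avg a s x) := by
        intro y z
        have g1 : y * (σ * z * avg a s x) ≤ 1 * y ^ 2 + 1⁻¹ * (σ * z * avg a s x) ^ 2 :=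
          mul_le_weighted one_pos
        have g2 : (σ * z * avg a s x) ^ 2 = (s * avg a s x) * (z ^ 2 * avg a s x) := by
          rw [← hσs]; ring
        have g3 : (s * avg a s x) * (z ^ 2 * avg a s x) ≤ M * (z ^ 2 * avg a s x) := by gcongr
        linarith
      have h6 := aux (D x) (a x)
      have h7 := aux (t x) (h x)
      have h8 : M * (a x ^ 2 * avg a s x) ≤ M * (a x ^ 3 + avg a s x ^ 3) := by gcongr
      have h9 : M * (h x ^ 2 * avg a s x) ≤ M * (h x ^ 3 + avg a s x ^ 3) := by gcongr
      rw [inv_one] at h1 h2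
      linarith
  refine key.trans ?_
  clear key
  rw [integral_add (integrableOn_closedBall (by fun_prop) _ _)
      (integrableOn_closedBall (by fun_prop) _ _),
    integral_add (integrableOn_closedBall (by fun_prop) _ _)
      (integrableOn_closedBall (by fun_prop) _ _),
    integral_add (integrableOn_closedBall (by fun_prop) _ _)
      (integrableOn_closedBall (by fun_prop) _ _),
    integral_add (integrableOn_closedBall (by fun_prop) _ _)
      (integrableOn_closedBall (by fun_prop) _ _),
    integral_add (integrableOn_closedBall (by fun_prop) _ _)
      (integrableOn_closedBall (by fun_prop) _ _),
    integral_add (integrableOn_closedBall (by fun_prop) _ _)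
      (integrableOn_closedBall (by fun_prop) _ _)]
  simp only [integral_const_mul]
  have hc : 4 + unitVol ^ 2 ≤ 4 * (1 + unitVol) ^ 4 := by
    nlinarith [pow_pos hV 2, pow_pos hV 3, pow_pos hV 4]
  have hc1 : 4 + unitVol ^ 2 ≤ 4 * (1 + unitVol) ^ 4 * n :=
    hc.trans (le_mul_of_one_le_right (by positivity) hn)
  have hc2 : unitVol ^ 2 ≤ 4 * (1 + unitVol) ^ 4 * n := by linarith
  have hc3 : M * (1 + 2 * unitVol ^ 3) ≤ 4 * (1 + unitVol) ^ 4 * n := by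
    have : (1 + unitVol) * (1 + 2 * unitVol ^ 3) ≤ 4 * (1 + unitVol) ^ 4 := by
      nlinarith [pow_pos hV 2, pow_pos hV 3, pow_pos hV 4]
    calc _ = (1 + unitVol) * (1 + 2 * unitVol ^ 3) * n := by rw [hM]; ring
      _ ≤ _ := by gcongr
  have hc4 : M ≤ 4 * (1 + unitVol) ^ 4 * n :=
    (le_mul_of_one_le_right hM0.le (by linarith [pow_pos hV 3])).trans hc3
  calc _ ≤ 3 * E + unitVol ^ 2 * U2 + unitVol ^ 2 * E + E + M * U3 + M * V3
        + 2 * M * (unitVol ^ 3 * U3) := by gcongr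
    _ = (4 + unitVol ^ 2) * E + unitVol ^ 2 * U2 + M * (1 + 2 * unitVol ^ 3) * U3 + M * V3 := by
      ring
    _ ≤ 4 * (1 + unitVol) ^ 4 * n * E + 4 * (1 + unitVol) ^ 4 * n * U2
        + 4 * (1 + unitVol) ^ 4 * n * U3 + 4 * (1 + unitVol) ^ 4 * n * V3 := by
      gcongr
    _ = _ := by ring

end AverageBounds

section LocalEnergy

/-- A smooth cutoff, equal to one on the ball of radius `r` and supported in that of radius `q`. -/
structure IsCutoff (φ : E3 → ℝ) (r q d K : ℝ) : Prop where
  smooth : Smooth3 φ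
  eq_one : ∀ x, ‖x‖ ≤ r → φ x = 1
  eq_zero : ∀ x, q < ‖x‖ → φ x = 0
  nonneg : ∀ x, 0 ≤ φ x
  le_one : ∀ x, φ x ≤ 1
  abs_pd_le : ∀ j x, |pd j φ x| ≤ K / d
  abs_pd_pd_le : ∀ l j x, |pd l (pd j φ) x| ≤ K / d ^ 2

/-- A mollification kernel `m` together with the kernel `κ` such that `∇κ = -y m(y)`. -/
structure IsKernel (κ m : E3 → ℝ) (K : ℝ) : Prop where
  smooth_κ : Smooth3 κ
  smooth_m : Smooth3 m
  κ_eq_zero : ∀ y, 1 < ‖y‖ → κ y = 0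
  m_eq_zero : ∀ y, 1 < ‖y‖ → m y = 0
  pd_κ : ∀ j y, pd j κ y = -(y j * m y)
  abs_pd_κ_le : ∀ j y, |pd j κ y| ≤ K
  abs_pd_pd_κ_le : ∀ l j y, |pd l (pd j κ) y| ≤ K
  abs_m_le : ∀ y, |m y| ≤ K
  abs_pd_m_le : ∀ j y, |pd j m y| ≤ K

lemma IsKernel.mono {κ m : E3 → ℝ} {K K' : ℝ} (h : IsKernel κ m K) (hK : K ≤ K') :
    IsKernel κ m K' where
  smooth_κ := h.smooth_κ
  smooth_m := h.smooth_m
  κ_eq_zero := h.κ_eq_zero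
  m_eq_zero := h.m_eq_zero
  pd_κ := h.pd_κ
  abs_pd_κ_le j y := (h.abs_pd_κ_le j y).trans hK
  abs_pd_pd_κ_le l j y := (h.abs_pd_pd_κ_le l j y).trans hK
  abs_m_le y := (h.abs_m_le y).trans hK
  abs_pd_m_le j y := (h.abs_pd_m_le j y).trans hK

lemma exists_isKernel : ∃ (κ m : E3 → ℝ) (K : ℝ), IsKernel κ m K ∧
    0 < ∫ y in closedBall (0 : E3) 1, m y := by
  obtain ⟨κ, m, hκ, hm, hκ0, hm0, hκm, hpos⟩ := exists_kernel
  have hκ0' : ∀ j y, 1 < ‖y‖ → pd j κ y = 0 := fun j y hy => pd_eq_zero_of_eqOn_compl hκ0 hy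
  choose C1 h1 using fun j => exists_bound_of_eq_zero (hκ.pd j).continuous (hκ0' j)
  choose C2 h2 using fun l j => exists_bound_of_eq_zero ((hκ.pd j).pd l).continuous
    fun y hy => pd_eq_zero_of_eqOn_compl (hκ0' j) hy
  obtain ⟨C3, h3⟩ := exists_bound_of_eq_zero hm.continuous hm0
  choose C4 h4 using fun j => exists_bound_of_eq_zero (hm.pd j).continuous
    fun y hy => pd_eq_zero_of_eqOn_compl hm0 hy
  have hle : ∀ (C : Fin 3 → ℝ) (j : Fin 3), C j ≤ ∑ j, |C j| := fun C j =>
    (le_abs_self _).trans (Finset.single_le_sum (f := fun j => |C j|) (fun _ _ => abs_nonneg _)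
      (Finset.mem_univ j))
  have p : ∀ C : Fin 3 → ℝ, 0 ≤ ∑ j, |C j| := fun C => Finset.sum_nonneg fun _ _ => abs_nonneg _
  have hC1 := p C1
  have hC4 := p C4
  have hC2 : 0 ≤ ∑ l, ∑ j, |C2 l j| := Finset.sum_nonneg fun l _ => p (C2 l)
  have hle2 : ∀ l, ∑ j, |C2 l j| ≤ ∑ l, ∑ j, |C2 l j| := fun l =>
    Finset.single_le_sum (f := fun l => ∑ j, |C2 l j|) (fun l _ => p (C2 l)) (Finset.mem_univ l)
  refine ⟨κ, m, (∑ j, |C1 j|) + (∑ l, ∑ j, |C2 l j|) + |C3| + ∑ j, |C4 j|, ?_, hpos⟩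
  refine ⟨hκ, hm, hκ0, hm0, hκm, fun j y => ?_, fun l j y => ?_, fun y => ?_, fun j y => ?_⟩
  · linarith [h1 j y, hle C1 j, abs_nonneg C3]
  · linarith [h2 l j y, hle (C2 l) j, abs_nonneg C3, hle2 l]
  · linarith [h3 y, le_abs_self C3]
  · linarith [h4 j y, hle C4 j, abs_nonneg C3]

lemma exists_isCutoff : ∃ K : ℝ, 1 ≤ K ∧ ∀ K', K ≤ K' → ∀ r d : ℝ, 0 ≤ r → 0 < d →
    ∃ φ, IsCutoff φ r (r + d / 2) d K' := by
  obtain ⟨C, hC, h⟩ := exists_cutoff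
  refine ⟨4 * C + 1, by linarith, fun K hK r d hr hd => ?_⟩
  obtain ⟨φ, h1, h2, h3, h4, h5, h6, h7⟩ := h r (r + d / 2) hr (by linarith)
  have e : r + d / 2 - r = d / 2 := by ring
  rw [e] at h6 h7
  refine ⟨φ, h1, h2, h3, h4, h5, fun j x => (h6 j x).trans ?_, fun l j x => (h7 l j x).trans ?_⟩
  · rw [div_le_div_iff₀ (by positivity) hd]
    nlinarith
  · rw [div_le_div_iff₀ (by positivity) (by positivity)]
    nlinarith [pow_pos hd 2]

variable {u v V : Fin 3 → E3 → ℝ} {Q φ κ m : E3 → ℝ} {x : E3}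
variable {r q d ρ n E U2 U3 V2 V3 s l K T δ B1 B2 G0 G1 : ℝ}

lemma abs_curlField_le (h1 : ∀ j, |pd j φ x| ≤ B1) (g0 : ∀ i j, |pd j (V i) x| ≤ G0)
    (i : Fin 3) : |curlField φ V i x| ≤ 6 * (B1 * G0) := by
  have hB : 0 ≤ B1 := (abs_nonneg _).trans (h1 0)
  unfold curlField
  calc _ ≤ ∑ j, |pd j φ x * (pd j (V i) x - pd i (V j) x)| := Finset.abs_sum_le_sum_abs _ _
    _ ≤ ∑ _j : Fin 3, B1 * (G0 + G0) := Finset.sum_le_sum fun j _ => by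
        rw [abs_mul]
        exact mul_le_mul (h1 j) ((abs_sub _ _).trans (add_le_add (g0 i j) (g0 j i)))
          (abs_nonneg _) hB
    _ = _ := by simp; ring

lemma abs_pd_curlField_le (hφ : Smooth3 φ) (hV : ∀ i, Smooth3 (V i))
    (h1 : ∀ j, |pd j φ x| ≤ B1) (h2 : ∀ l j, |pd l (pd j φ) x| ≤ B2)
    (g0 : ∀ i j, |pd j (V i) x| ≤ G0) (g1 : ∀ i l j, |pd l (pd j (V i)) x| ≤ G1)
    (i l : Fin 3) : |pd l (curlField φ V i) x| ≤ 6 * (B2 * G0 + B1 * G1) := by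
  have hB1 : 0 ≤ B1 := (abs_nonneg _).trans (h1 0)
  have hB2 : 0 ≤ B2 := (abs_nonneg _).trans (h2 0 0)
  have hd : ∀ i j, Smooth3 fun y => pd j (V i) y - pd i (V j) y := fun i j =>
    ((hV i).pd j).sub ((hV j).pd i)
  have e : pd l (curlField φ V i) x = ∑ j, (pd l (pd j φ) x * (pd j (V i) x - pd i (V j) x)
      + pd j φ x * (pd l (pd j (V i)) x - pd l (pd i (V j)) x)) := by
    unfold curlField
    rw [pd_sum fun j _ => Smooth3.differentiableAt ((hφ.pd j).mul (hd i j)) x]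
    refine Finset.sum_congr rfl fun j _ => ?_
    rw [pd_mul ((hφ.pd j).differentiableAt x) ((hd i j).differentiableAt x),
      pd_sub (((hV i).pd j).differentiableAt x) (((hV j).pd i).differentiableAt x)]
  rw [e]
  calc _ ≤ ∑ j, |_| := Finset.abs_sum_le_sum_abs _ _
    _ ≤ ∑ _j : Fin 3, (B2 * (G0 + G0) + B1 * (G1 + G1)) := Finset.sum_le_sum fun j _ => by
        refine (abs_add_le _ _).trans (add_le_add ?_ ?_) <;> rw [abs_mul]
        · exact mul_le_mul (h2 l j) ((abs_sub _ _).trans (add_le_add (g0 i j) (g0 j i)))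
            (abs_nonneg _) hB2
        · exact mul_le_mul (h1 j) ((abs_sub _ _).trans (add_le_add (g1 i l j) (g1 j l i)))
            (abs_nonneg _) hB1
    _ = _ := by simp; ring

lemma IsKernel.pd_const_mul_av (hκ : IsKernel κ m K) {f : E3 → ℝ} (hf : Smooth3 f) (s : ℝ)
    (j : Fin 3) : pd j (fun x => s * av κ f s x) = av (pd j κ) f s := by
  funext x
  rw [pd_const_mul _ ((hf.av hκ.smooth_κ.continuous s).differentiableAt x),
    pd_av hκ.smooth_κ.continuous hf, av_pd_kernel hκ.smooth_κ hκ.κ_eq_zero hf]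

lemma IsKernel.pd_pd_const_mul_av (hκ : IsKernel κ m K) {f : E3 → ℝ} (hf : Smooth3 f) (s : ℝ)
    (l j : Fin 3) (x : E3) :
    pd l (pd j (fun x => s * av κ f s x)) x = av (pd j κ) (pd l f) s x := by
  rw [hκ.pd_const_mul_av hf, pd_av (hκ.smooth_κ.pd j).continuous hf]

lemma IsKernel.mul_pd_pd_const_mul_av (hκ : IsKernel κ m K) {f : E3 → ℝ} (hf : Smooth3 f) (s : ℝ)
    (l j : Fin 3) (x : E3) :
    s * pd l (pd j (fun x => s * av κ f s x)) x = av (pd l (pd j κ)) f s x := by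
  rw [hκ.pd_pd_const_mul_av hf, av_pd_kernel (hκ.smooth_κ.pd j)
    (fun y hy => pd_eq_zero_of_eqOn_compl hκ.κ_eq_zero hy) hf]

lemma IsKernel.abs_pd_le (hκ : IsKernel κ m K) (hu : ∀ i, Smooth3 (u i)) (s : ℝ)
    (x : E3) (i j : Fin 3) :
    |pd j (fun x => s * av κ (u i) s x) x| ≤ K * avg (absSum u) s x := by
  rw [hκ.pd_const_mul_av (hu i)]
  exact abs_av_le (hκ.abs_pd_κ_le j) (continuous_absSum fun i => (hu i).continuous)
    (abs_le_absSum u i) s x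

lemma IsKernel.abs_pd_pd_le (hκ : IsKernel κ m K) (hu : ∀ i, Smooth3 (u i)) (s : ℝ)
    (x : E3) (i l j : Fin 3) :
    |pd l (pd j (fun x => s * av κ (u i) s x)) x| ≤ K * avg (absGrad u) s x := by
  rw [hκ.pd_pd_const_mul_av (hu i)]
  exact abs_av_le (hκ.abs_pd_κ_le j) (continuous_absGrad hu) (abs_pd_le_absGrad u i l) s x

lemma IsKernel.abs_pd_pd_le_div (hκ : IsKernel κ m K) (hu : ∀ i, Smooth3 (u i)) (hs : 0 < s)
    (x : E3) (i l j : Fin 3) :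
    |pd l (pd j (fun x => s * av κ (u i) s x)) x| ≤ K * avg (absSum u) s x / s := by
  rw [le_div_iff₀ hs, ← abs_of_pos hs, ← abs_mul, abs_of_pos hs, mul_comm,
    hκ.mul_pd_pd_const_mul_av (hu i)]
  exact abs_av_le (hκ.abs_pd_pd_κ_le l j) (continuous_absSum fun i => (hu i).continuous)
    (abs_le_absSum u i) s x

/-- The scale-`s` contribution to the pressure term at scales below the cutoff width. -/
lemma ReducedEL.abs_pairRate_le_far (H : ReducedEL u v Q) (hκ : IsKernel κ m K)
    (hφ : IsCutoff φ r q d K) (hd : 0 < d) (hs : 0 < s) (hsd : s ≤ d) :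
    |pairRate Q φ κ u s| ≤ 12 * K ^ 2 / (d * s) * ∫ x in closedBall (0 : E3) q,
      (absGrad u x * avg (absSum u) s x + absSum u x ^ 2 * avg (absSum u) s x
        + s * (absGrad v x * absSum (transport u v) x * avg (absSum u) s x)) := by
  have hu := H.smooth_u
  have ca := continuous_absSum fun i => (hu i).continuous
  have cA := continuous_avg ca s
  have hA : ∀ x, 0 ≤ avg (absSum u) s x := avg_nonneg (absSum_nonneg u) s
  have hV : ∀ i, Smooth3 fun x => s * av κ (u i) s x := fun i =>
    contDiff_const.mul ((hu i).av hκ.smooth_κ.continuous s)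
  have hK : 0 ≤ K := (abs_nonneg _).trans (hκ.abs_m_le 0)
  rw [pairRate_eq H.smooth_Q hφ.smooth hφ.eq_zero hκ.smooth_κ.continuous hu H.div_free, abs_neg]
  refine (H.abs_gradPair_le_far (q := q) (ψ0 := fun x => 12 * K ^ 2 / (d * s) * (s *
      avg (absSum u) s x)) (ψ1 := fun x => 12 * K ^ 2 / (d * s) * avg (absSum u) s x)
    (smooth_curlField hφ.smooth hV) (curlField_eq_zero hφ.eq_zero) (by fun_prop) (by fun_prop)
    (fun i x _ => ?_) fun i l x _ => ?_).trans_eq ?_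
  · refine (abs_curlField_le (fun j => hφ.abs_pd_le j x) (hκ.abs_pd_le hu s x) i).trans ?_
    have hX : 0 ≤ K ^ 2 * avg (absSum u) s x / d := by have := hA x; positivity
    have e1 : 6 * (K / d * (K * avg (absSum u) s x)) = 6 * (K ^ 2 * avg (absSum u) s x / d) := by
      ring
    have e2 : 12 * K ^ 2 / (d * s) * (s * avg (absSum u) s x)
        = 12 * (K ^ 2 * avg (absSum u) s x / d) := by field_simp
    rw [e1, e2]
    linarith
  · refine (abs_pd_curlField_le hφ.smooth hV (fun j => hφ.abs_pd_le j x)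
      (fun l j => hφ.abs_pd_pd_le l j x) (hκ.abs_pd_le hu s x)
      (hκ.abs_pd_pd_le_div hu hs x) i l).trans ?_
    have hX : 0 ≤ K ^ 2 * avg (absSum u) s x / d := by have := hA x; positivity
    have hds : d⁻¹ ≤ s⁻¹ := inv_anti₀ hs hsd
    have e1 : 6 * (K / d ^ 2 * (K * avg (absSum u) s x) + K / d * (K * avg (absSum u) s x / s))
        = 6 * (K ^ 2 * avg (absSum u) s x / d) * (d⁻¹ + s⁻¹) := by field_simp
    have e2 : 12 * K ^ 2 / (d * s) * avg (absSum u) s x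
        = 6 * (K ^ 2 * avg (absSum u) s x / d) * (s⁻¹ + s⁻¹) := by field_simp; ring
    rw [e1, e2]
    gcongr
  · rw [← integral_const_mul]
    congr 1
    funext x
    ring

/-- The scale-`s` contribution to the pressure term at small scales. -/
lemma ReducedEL.abs_pairRate_le_near (H : ReducedEL u v Q) (hκ : IsKernel κ m K)
    (hφ : IsCutoff φ r q d K) (hd : 0 < d) :
    |pairRate Q φ κ u s| ≤ 6 * K ^ 2 * (1 / d + 1 / d ^ 2) * ∫ x in closedBall (0 : E3) q,
      (absGrad u x * avg (absSum u) s x + absGrad u x * avg (absGrad u) s x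
        + absSum u x * absGrad u x * avg (absSum u) s x
        + absGrad v x * absSum (transport u v) x * avg (absSum u) s x) := by
  have hu := H.smooth_u
  have ca := continuous_absSum fun i => (hu i).continuous
  have cA := continuous_avg ca s
  have cA' := continuous_avg (continuous_absGrad hu) s
  have hA : ∀ x, 0 ≤ avg (absSum u) s x := avg_nonneg (absSum_nonneg u) s
  have hA' : ∀ x, 0 ≤ avg (absGrad u) s x := avg_nonneg (absGrad_nonneg u) s
  have hV : ∀ i, Smooth3 fun x => s * av κ (u i) s x := fun i =>
    contDiff_const.mul ((hu i).av hκ.smooth_κ.continuous s)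
  have hK : 0 ≤ K := (abs_nonneg _).trans (hκ.abs_m_le 0)
  rw [pairRate_eq H.smooth_Q hφ.smooth hφ.eq_zero hκ.smooth_κ.continuous hu H.div_free, abs_neg]
  set c := 6 * K ^ 2 * (1 / d + 1 / d ^ 2) with hc
  refine (H.abs_gradPair_le_near (q := q) (ψ0 := fun x => c * avg (absSum u) s x)
    (ψ1 := fun x => c * (avg (absSum u) s x + avg (absGrad u) s x))
    (smooth_curlField hφ.smooth hV) (curlField_eq_zero hφ.eq_zero) (by fun_prop) (by fun_prop)
    (fun i x _ => ?_) fun i l x _ => ?_).trans_eq ?_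
  · refine (abs_curlField_le (fun j => hφ.abs_pd_le j x) (hκ.abs_pd_le hu s x) i).trans ?_
    have hX : 0 ≤ 6 * K ^ 2 * avg (absSum u) s x / d ^ 2 := by have := hA x; positivity
    have e : c * avg (absSum u) s x = 6 * (K / d * (K * avg (absSum u) s x))
        + 6 * K ^ 2 * avg (absSum u) s x / d ^ 2 := by rw [hc]; ring
    rw [e]
    linarith
  · refine (abs_pd_curlField_le hφ.smooth hV (fun j => hφ.abs_pd_le j x)
      (fun l j => hφ.abs_pd_pd_le l j x) (hκ.abs_pd_le hu s x)
      (hκ.abs_pd_pd_le hu s x) i l).trans ?_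
    have hX : 0 ≤ 6 * K ^ 2 * avg (absSum u) s x / d := by have := hA x; positivity
    have hY : 0 ≤ 6 * K ^ 2 * avg (absGrad u) s x / d ^ 2 := by have := hA' x; positivity
    have e : c * (avg (absSum u) s x + avg (absGrad u) s x)
        = 6 * (K / d ^ 2 * (K * avg (absSum u) s x) + K / d * (K * avg (absGrad u) s x))
        + 6 * K ^ 2 * avg (absSum u) s x / d + 6 * K ^ 2 * avg (absGrad u) s x / d ^ 2 := by
      rw [hc]; ring
    rw [e]
    linarith
  · rw [← integral_const_mul]
    congr 1
    funext x
    ring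

/-- The pressure tested against the mollified velocity at the scale of the cutoff. -/
lemma ReducedEL.abs_gradPair_mul_av_le (H : ReducedEL u v Q) (hκ : IsKernel κ m K)
    (hφ : IsCutoff φ r q d K) (hd : 0 < d) (hK : 1 ≤ K) (hT : T = d / 2) :
    |gradPair Q fun i x => φ x * av m (u i) T x| ≤ 3 * K ^ 2 / d * ∫ x in closedBall (0 : E3) q,
      (absGrad u x * avg (absSum u) T x + absSum u x ^ 2 * avg (absSum u) T x
        + T * (absGrad v x * absSum (transport u v) x * avg (absSum u) T x)) := by
  have hu := H.smooth_u
  have hT0 : 0 < T := by linarith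
  have ca := continuous_absSum fun i => (hu i).continuous
  have cA := continuous_avg ca T
  have hA : ∀ x, 0 ≤ avg (absSum u) T x := avg_nonneg (absSum_nonneg u) T
  have cm := hκ.smooth_m.continuous
  have hav : ∀ i, Smooth3 (av m (u i) T) := fun i => (hu i).av cm T
  have b0 : ∀ i x, |av m (u i) T x| ≤ K * avg (absSum u) T x := fun i x =>
    abs_av_le hκ.abs_m_le ca (abs_le_absSum u i) T x
  have b1 : ∀ i l x, |pd l (av m (u i) T) x| ≤ K * avg (absSum u) T x / T := fun i l x => by
    rw [le_div_iff₀ hT0, ← abs_of_pos hT0, ← abs_mul, abs_of_pos hT0, mul_comm,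
      pd_av cm (hu i), ← av_pd_kernel hκ.smooth_m hκ.m_eq_zero (hu i)]
    exact abs_av_le (hκ.abs_pd_m_le l) ca (abs_le_absSum u i) T x
  have hKK : K ≤ K ^ 2 := by nlinarith
  refine (H.abs_gradPair_le_far (q := q) (ψ0 := fun x => 3 * K ^ 2 / d * (T *
      avg (absSum u) T x)) (ψ1 := fun x => 3 * K ^ 2 / d * avg (absSum u) T x)
    (fun i => hφ.smooth.mul (hav i)) (fun i x hx => by rw [hφ.eq_zero x hx, zero_mul])
    (by fun_prop) (by fun_prop) (fun i x _ => ?_) fun i l x _ => ?_).trans_eq ?_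
  · rw [abs_mul, abs_of_nonneg (hφ.nonneg x)]
    have hX := hA x
    calc _ ≤ 1 * (K * avg (absSum u) T x) :=
          mul_le_mul (hφ.le_one x) (b0 i x) (abs_nonneg _) zero_le_one
      _ ≤ 3 / 2 * (K ^ 2 * avg (absSum u) T x) := by nlinarith
      _ = _ := by rw [hT]; field_simp
  · rw [pd_mul (hφ.smooth.differentiableAt x) ((hav i).differentiableAt x)]
    refine (abs_add_le _ _).trans ?_
    rw [abs_mul, abs_mul, abs_of_nonneg (hφ.nonneg x)]
    have hX := hA x
    calc _ ≤ K / d * (K * avg (absSum u) T x) + 1 * (K * avg (absSum u) T x / T) := by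
          refine add_le_add (mul_le_mul (hφ.abs_pd_le l x) (b0 i x) (abs_nonneg _) ?_)
            (mul_le_mul (hφ.le_one x) (b1 i l x) (abs_nonneg _) zero_le_one)
          positivity
      _ = K ^ 2 / d * avg (absSum u) T x + 2 * K / d * avg (absSum u) T x := by
          rw [hT]; field_simp
      _ ≤ K ^ 2 / d * avg (absSum u) T x + 2 * K ^ 2 / d * avg (absSum u) T x := by gcongr
      _ = _ := by ring
  · rw [← integral_const_mul]
    congr 1
    funext x
    ring

end LocalEnergy

section CoreEstimate

variable {u v : Fin 3 → E3 → ℝ} {Q φ κ m : E3 → ℝ}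
variable {r q d ρ n E U2 U3 V2 V3 s l K T δ c N : ℝ}

lemma integral_rpow_neg_half : ∫ s in (0 : ℝ)..δ, s ^ (-(1 / 2) : ℝ) = 2 * √δ := by
  rw [integral_rpow (Or.inl (by norm_num)), Real.sqrt_eq_rpow]
  norm_num
  ring

lemma abs_integral_le_near {f : ℝ → ℝ} (hδ : 0 ≤ δ)
    (h : ∀ s, 0 < s → s ≤ δ → √s * |f s| ≤ N) : |∫ s in (0 : ℝ)..δ, f s| ≤ 2 * √δ * N := by
  have h1 := intervalIntegral.norm_integral_le_of_norm_le (f := f)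
    (g := fun s => N * s ^ (-(1 / 2) : ℝ)) (μ := volume) hδ (ae_of_all _ fun s hs => by
      have hs0 : 0 < √s := Real.sqrt_pos.2 hs.1
      rw [Real.rpow_neg hs.1.le, ← Real.sqrt_eq_rpow, ← div_eq_mul_inv, le_div_iff₀ hs0, mul_comm]
      exact h s hs.1 hs.2)
    ((intervalIntegral.intervalIntegrable_rpow' (by norm_num)).const_mul N)
  rw [intervalIntegral.integral_const_mul, integral_rpow_neg_half] at h1
  calc _ ≤ _ := h1
    _ = _ := by ring

lemma abs_integral_le_far {f : ℝ → ℝ} (hδ : 0 < δ) (hT : δ ≤ T)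
    (h : ∀ s, δ ≤ s → s ≤ T → s * |f s| ≤ N) : |∫ s in δ..T, f s| ≤ N * Real.log (T / δ) := by
  have h0 : (0 : ℝ) ∉ Set.uIcc δ T := by
    rw [Set.uIcc_of_le hT]; exact fun h => absurd h.1 (not_le.2 hδ)
  have h1 := intervalIntegral.norm_integral_le_of_norm_le (f := f)
    (g := fun s => N * s⁻¹) (μ := volume) hT (ae_of_all _ fun s hs => by
      have hs0 : 0 < s := hδ.trans hs.1
      rw [← div_eq_mul_inv, le_div_iff₀ hs0, mul_comm]
      exact h s hs.1.le hs.2)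
    ((intervalIntegrable_inv_iff.2 (Or.inr h0)).const_mul N)
  rwa [intervalIntegral.integral_const_mul, integral_inv h0] at h1

/-- The local energy estimate on balls of radii `r < r + d`. -/
theorem exists_core_estimate : ∃ C : ℝ, 0 < C ∧
    ∀ (u v : Fin 3 → E3 → ℝ) (Q : E3 → ℝ) (r d n E U2 U3 V2 V3 l δ : ℝ), ReducedEL u v Q →
    BallBounds (absSum u) (absGrad u) (absGrad v) (absSum (transport u v)) (r + d)
      n E U2 U3 V2 V3 →
    0 ≤ r → 0 < d → 0 < l → 0 < δ → δ ≤ 1 → δ ≤ d / 2 →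
    ∫ x in closedBall (0 : E3) r, dissip u v x ≤
      C * ((1 + Real.log (d / 2 / δ)) * (1 / d) * (l * E + l⁻¹ * (U2 + n ^ 2 * V2) + U3)
        + √δ * n * (1 / d + 1 / d ^ 2) * (E + U2 + U3 + V3)) := by
  obtain ⟨κ, m, K1, hκ1, hM0⟩ := exists_isKernel
  obtain ⟨K2, hK2, hcut⟩ := exists_isCutoff
  set K := max K1 K2 with hKdef
  have hκ : IsKernel κ m K := hκ1.mono (le_max_left _ _)
  have hK : 1 ≤ K := hK2.trans (le_max_right _ _)
  have hV := unitVol_pos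
  set M := ∫ y in closedBall (0 : E3) 1, m y with hM
  set W := 2 * (1 + unitVol) ^ 3 with hW
  set W' := 4 * (1 + unitVol) ^ 4 with hW'
  refine ⟨M⁻¹ * (12 * K ^ 2 * W + 12 * K ^ 2 * W') + K, by positivity, ?_⟩
  intro u v Q r d n E U2 U3 V2 V3 l δ H B hr hd hl hδ hδ1 hδd
  obtain ⟨φ, hφ⟩ := hcut K (le_max_right _ _) r d hr hd
  set T := d / 2 with hT
  set q := r + T with hq
  have hqT : q + T ≤ r + d := by rw [hq, hT]; linarith
  have hu := H.smooth_u
  have hcu : ∀ i, Continuous (u i) := fun i => (hu i).continuous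
  have hT0 : 0 < T := by positivity
  have hn := B.one_le_n
  have hE : 0 ≤ E := setIntegral_nonneg_of_le (fun _ => sq_nonneg _) B.int_D
  have hU2 : 0 ≤ U2 := setIntegral_nonneg_of_le (fun _ => sq_nonneg _) B.int_a_sq
  have hV2 : 0 ≤ V2 := setIntegral_nonneg_of_le (fun _ => sq_nonneg _) B.int_h_sq
  have hU3 : 0 ≤ U3 := setIntegral_nonneg_of_le (fun x => pow_nonneg (B.a_nonneg x) 3) B.int_a_cube
  have hV3 : 0 ≤ V3 := setIntegral_nonneg_of_le (fun x => pow_nonneg (B.h_nonneg x) 3) B.int_h_cube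
  set F := l * E + l⁻¹ * (U2 + n ^ 2 * V2) + U3 with hF
  set Y := E + U2 + U3 + V3 with hY
  have hF0 : 0 ≤ F := by positivity
  have hY0 : 0 ≤ Y := by positivity
  have hΛ : 0 ≤ Real.log (T / δ) := Real.log_nonneg ((one_le_div hδ).2 hδd)
  have far : ∀ s, δ ≤ s → s ≤ T → s * |pairRate Q φ κ u s| ≤ 12 * K ^ 2 / d * (W * F) := by
    intro s hs1 hs2
    have hs0 : 0 < s := hδ.trans_le hs1
    have h1 := H.abs_pairRate_le_far hκ hφ hd hs0 (by linarith)
    have h2 := B.far_le (l := l) hs0 (by linarith : q + s ≤ r + d) hl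
    calc _ ≤ s * (12 * K ^ 2 / (d * s) * (W * F)) := by
          exact mul_le_mul_of_nonneg_left (h1.trans (by gcongr)) hs0.le
      _ = _ := by field_simp
  have near : ∀ s, 0 < s → s ≤ δ → √s * |pairRate Q φ κ u s|
      ≤ 6 * K ^ 2 * (1 / d + 1 / d ^ 2) * (W' * n * Y) := by
    intro s hs0 hs1
    have h1 := H.abs_pairRate_le_near (s := s) hκ hφ hd
    have h2 := B.near_le hs0 (by linarith) (by linarith : q + s ≤ r + d)
    calc _ ≤ √s * _ := by gcongr
      _ = 6 * K ^ 2 * (1 / d + 1 / d ^ 2) * (√s * _) := mul_left_comm _ _ _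
      _ ≤ _ := by gcongr
  have last : |gradPair Q fun i x => φ x * av m (u i) T x| ≤ 3 * K ^ 2 / d * (W * F) :=
    (H.abs_gradPair_mul_av_le hκ hφ hd hK hT).trans (by gcongr; exact B.far_le hT0 hqT hl)
  have cont := continuous_pairRate H.smooth_Q hφ.smooth hφ.eq_zero hκ.smooth_κ.continuous hu
  have split := intervalIntegral.integral_add_adjacent_intervals
    (cont.intervalIntegrable (μ := volume) 0 δ) (cont.intervalIntegrable δ T)
  have hav := gradPair_av_sub H.smooth_Q hφ.smooth hφ.eq_zero hκ.smooth_κ hκ.κ_eq_zero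
    hκ.smooth_m.continuous hκ.pd_κ hu hT0.le
  have i1 := abs_le.1 (abs_integral_le_near hδ.le near)
  have i2 := abs_le.1 (abs_integral_le_far hδ hδd far)
  have i3 := abs_le.1 last
  have pressure : -gradPair Q (fun i x => φ x * u i x) ≤ M⁻¹ * (3 * K ^ 2 / d * (W * F)
      + 2 * √δ * (6 * K ^ 2 * (1 / d + 1 / d ^ 2) * (W' * n * Y))
      + 12 * K ^ 2 / d * (W * F) * Real.log (T / δ)) := by
    rw [inv_mul_eq_div, le_div_iff₀ hM0]
    linarith [i1.2, i2.2, i3.1]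
  have energy := H.integral_mul_dissip_le hφ.smooth hφ.eq_zero hφ.abs_pd_le
  have ca := B.cont_a
  have cD := B.cont_D
  have hqρ : q ≤ r + d := by linarith
  have I1 := setIntegral_le_of_radius_le (f := fun x => absGrad u x ^ 2) (by fun_prop)
    (fun _ => sq_nonneg _) hqρ B.int_D
  have I2 := setIntegral_le_of_radius_le (f := fun x => absSum u x ^ 2) (by fun_prop)
    (fun _ => sq_nonneg _) hqρ B.int_a_sq
  have I3 := setIntegral_le_of_radius_le (f := fun x => absSum u x ^ 3) (by fun_prop)
    (fun x => pow_nonneg (B.a_nonneg x) 3) hqρ B.int_a_cube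
  have hl' : 0 < l⁻¹ := inv_pos.2 hl
  have lower : ∫ x in closedBall (0 : E3) q, (K / d * (absSum u x * absGrad u x)
      + K / d * absSum u x ^ 3) ≤ K / d * F := by
    have key := setIntegral_closedBall_mono (q := q)
      (F := fun x => K / d * (absSum u x * absGrad u x) + K / d * absSum u x ^ 3)
      (G := fun x => K / d * (l * absGrad u x ^ 2 + l⁻¹ * absSum u x ^ 2 + absSum u x ^ 3))
      (by fun_prop) (by fun_prop) fun x _ => by
        rw [← mul_add]
        have := mul_le_weighted (x := absGrad u x) (y := absSum u x) hl
        gcongr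
        linarith
    refine key.trans ?_
    clear key
    rw [integral_const_mul, integral_add (integrableOn_closedBall (by fun_prop) _ _)
        (integrableOn_closedBall (by fun_prop) _ _),
      integral_add (integrableOn_closedBall (by fun_prop) _ _)
        (integrableOn_closedBall (by fun_prop) _ _), integral_const_mul, integral_const_mul]
    have : 0 ≤ l⁻¹ * (n ^ 2 * V2) := by positivity
    gcongr
    calc _ ≤ l * E + l⁻¹ * U2 + U3 := by gcongr
      _ ≤ F := by rw [hF]; linarith
  have ball : ∫ x in closedBall (0 : E3) r, dissip u v x ≤ ∫ x, φ x * dissip u v x := by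
    have cd := continuous_dissip hu H.smooth_v
    have cφ := hφ.smooth.continuous
    rw [← setIntegral_eq_integral_of_forall_compl_eq_zero (s := closedBall (0 : E3) q)
      (f := fun x => φ x * dissip u v x) fun x hx => by rw [hφ.eq_zero x (by simpa using hx), zero_mul]]
    refine le_trans ?_ (setIntegral_closedBall_mono_radius (F := fun x => φ x * dissip u v x)
      (by fun_prop) (fun x => mul_nonneg (hφ.nonneg x) (dissip_nonneg u v x))
      (by linarith : r ≤ q))
    refine setIntegral_closedBall_mono cd (by fun_prop) fun x hx => ?_
    rw [hφ.eq_one x hx, one_mul]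
  set Λ := Real.log (T / δ) with hΛdef
  set X1 := (1 + Λ) * (1 / d) * F with hX1
  set X2 := √δ * n * (1 / d + 1 / d ^ 2) * Y with hX2
  have hX10 : 0 ≤ X1 := by positivity
  have hX20 : 0 ≤ X2 := by positivity
  have hX11 : 1 / d * F ≤ X1 := by
    have : 0 ≤ Λ * (1 / d) * F := by positivity
    rw [hX1]; linarith
  have e1 : 3 * K ^ 2 / d * (W * F) + 2 * √δ * (6 * K ^ 2 * (1 / d + 1 / d ^ 2) * (W' * n * Y))
      + 12 * K ^ 2 / d * (W * F) * Λ
      = 12 * K ^ 2 * W * X1 - 9 * K ^ 2 * W * (1 / d * F) + 12 * K ^ 2 * W' * X2 := by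
    rw [hX1, hX2]; ring
  have p1 : 0 ≤ 9 * K ^ 2 * W * (1 / d * F) := by positivity
  have p2 : 0 ≤ 12 * K ^ 2 * W' * X1 := by positivity
  have p3 : 0 ≤ 12 * K ^ 2 * W * X2 := by positivity
  have hMi : 0 < M⁻¹ := inv_pos.2 hM0
  have p4 : M⁻¹ * (12 * K ^ 2 * W * X1 - 9 * K ^ 2 * W * (1 / d * F) + 12 * K ^ 2 * W' * X2)
      ≤ M⁻¹ * ((12 * K ^ 2 * W + 12 * K ^ 2 * W') * (X1 + X2)) := by
    gcongr
    linarith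
  have p5 : K / d * F ≤ K * (X1 + X2) := by
    have : K / d * F = K * (1 / d * F) := by ring
    rw [this]
    gcongr
    linarith
  rw [e1] at pressure
  linarith

end CoreEstimate

section Decay

lemma le_of_hole_filling {f : ℝ → ℝ} {R A B : ℝ} (hR : 0 < R) (hA0 : 0 ≤ A) (f0 : ∀ r, 0 ≤ f r)
    (hB : ∀ r, R ≤ r → r < 2 * R → f r ≤ B)
    (h : ∀ r d, R ≤ r → 0 < d → r + 2 * d = 2 * R →
      (d / R) ^ 4 * f r ≤ 1 / 32 * (d / R) ^ 4 * f (r + d) + A) : f R ≤ 32 * A := by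
  have hB0 : 0 ≤ B := (f0 R).trans (hB R le_rfl (by linarith))
  have step : ∀ k : ℕ, ∀ r d, R ≤ r → 0 < d → r + 2 * d = 2 * R →
      (d / R) ^ 4 * f r ≤ (1 / 2) ^ k * B + 2 * A := by
    intro k
    induction k with
    | zero =>
      intro r d hr hd e
      have hy : d / R ≤ 1 / 2 := by rw [div_le_iff₀ hR]; linarith
      have hy0 : 0 < d / R := by positivity
      have hy4 : (d / R) ^ 4 ≤ 1 := pow_le_one₀ hy0.le (by linarith)
      have hb := hB r hr (by linarith)
      have h2 : (d / R) ^ 4 * f r ≤ 1 * B := by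
        gcongr
        exact f0 _
      rw [pow_zero]
      linarith
    | succ k ih =>
      intro r d hr hd e
      have h1 := h r d hr hd e
      have h2 := ih (r + d) (d / 2) (by linarith) (by linarith) (by linarith)
      have e1 : (d / R) ^ 4 = 16 * (d / 2 / R) ^ 4 := by ring
      rw [e1] at h1 ⊢
      rw [pow_succ (1 / 2 : ℝ)]
      linarith
  have hlim : Tendsto (fun k : ℕ => (1 / 2 : ℝ) ^ k * B + 2 * A) atTop (nhds (0 * B + 2 * A)) :=
    ((tendsto_pow_atTop_nhds_zero_of_lt_one (by norm_num) (by norm_num)).mul_const B).add_const _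
  have h1 := ge_of_tendsto' hlim fun k => step k R (R / 2) le_rfl (by linarith) (by linarith)
  have e : R / 2 / R = 1 / 2 := by field_simp
  rw [e] at h1
  linarith

lemma continuous_coefficients {u v : Fin 3 → E3 → ℝ} {Q : E3 → ℝ} (H : ReducedEL u v Q) :
    Continuous (absSum u) ∧ Continuous (absGrad u) ∧ Continuous (absGrad v) ∧
      Continuous (absSum (transport u v)) ∧ Continuous (dissip u v) :=
  have hu := H.smooth_u
  have hcu : ∀ i, Continuous (u i) := fun i => (hu i).continuous
  ⟨continuous_absSum hcu, continuous_absGrad hu, continuous_absGrad H.smooth_v,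
    continuous_absSum fun i => (smooth_transport hu H.smooth_v i).continuous,
    continuous_dissip hu H.smooth_v⟩

lemma ReducedEL.ballBounds {u v : Fin 3 → E3 → ℝ} {Q : E3 → ℝ} (H : ReducedEL u v Q)
    {ρ S n U2 U3 V2 V3 : ℝ} (hρ : ρ ≤ S)
    (h2 : ∫ x in closedBall (0 : E3) S, absSum u x ^ 2 ≤ U2)
    (h3 : ∫ x in closedBall (0 : E3) S, absSum u x ^ 3 ≤ U3)
    (k2 : ∫ x in closedBall (0 : E3) S, absGrad v x ^ 2 ≤ V2)
    (k3 : ∫ x in closedBall (0 : E3) S, absGrad v x ^ 3 ≤ V3) (hn : 1 ≤ n) (hUn : U3 ≤ n ^ 3) :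
    BallBounds (absSum u) (absGrad u) (absGrad v) (absSum (transport u v)) ρ
      n (9 * ∫ x in closedBall (0 : E3) ρ, dissip u v x) U2 U3 V2 V3 := by
  obtain ⟨ca, cD, ch, ct, cd⟩ := continuous_coefficients H
  refine ⟨ca, cD, ch, ct, absSum_nonneg _, absGrad_nonneg _, absGrad_nonneg _, absSum_nonneg _,
    ?_, ?_, ?_, ?_, ?_, ?_, hn, hUn⟩
  · rw [← integral_const_mul]
    exact setIntegral_closedBall_mono (F := fun x => absGrad u x ^ 2)
      (G := fun x => 9 * dissip u v x) (by fun_prop) (by fun_prop) fun x _ => absGrad_sq_le u v x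
  · rw [← integral_const_mul]
    exact setIntegral_closedBall_mono (F := fun x => absSum (transport u v) x ^ 2)
      (G := fun x => 9 * dissip u v x) (by fun_prop) (by fun_prop)
      fun x _ => absSum_transport_sq_le u v x
  · exact setIntegral_le_of_radius_le (f := fun x => absSum u x ^ 2) (by fun_prop)
      (fun _ => sq_nonneg _) hρ h2
  · exact setIntegral_le_of_radius_le (f := fun x => absSum u x ^ 3) (by fun_prop)
      (fun x => pow_nonneg (absSum_nonneg u x) 3) hρ h3
  · exact setIntegral_le_of_radius_le (f := fun x => absGrad v x ^ 2) (by fun_prop)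
      (fun _ => sq_nonneg _) hρ k2
  · exact setIntegral_le_of_radius_le (f := fun x => absGrad v x ^ 3) (by fun_prop)
      (fun x => pow_nonneg (absGrad_nonneg v x) 3) hρ k3

set_option maxHeartbeats 1000000 in
/-- The dissipation on a ball is bounded by a negative power of `X` (itself a small power of the
radius), given growth bounds on the ball of twice the radius. -/
theorem exists_decay_estimate {G c : ℝ} (hG : 1 ≤ G) (hc : 1 ≤ c) : ∃ A R0 : ℝ,
    ∀ (u v : Fin 3 → E3 → ℝ) (Q : E3 → ℝ) (R X n U2 U3 V2 V3 : ℝ), ReducedEL u v Q →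
    R0 ≤ R → 1 ≤ R → 1 ≤ X → X ≤ R → Real.log R ≤ c * X →
    ∫ x in closedBall (0 : E3) (2 * R), absSum u x ^ 2 ≤ U2 →
    ∫ x in closedBall (0 : E3) (2 * R), absSum u x ^ 3 ≤ U3 →
    ∫ x in closedBall (0 : E3) (2 * R), absGrad v x ^ 2 ≤ V2 →
    ∫ x in closedBall (0 : E3) (2 * R), absGrad v x ^ 3 ≤ V3 →
    1 ≤ n → U3 ≤ n ^ 3 → n ≤ G * R → U2 + n ^ 2 * V2 ≤ G * R ^ 2 / X ^ 4 → U3 ≤ G * R / X ^ 4 →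
    V3 ≤ G * R ^ 3 →
    ∫ x in closedBall (0 : E3) R, dissip u v x ≤ A / X := by
  obtain ⟨C, hC, core⟩ := exists_core_estimate
  refine ⟨32 * (166464 * C ^ 2 * c ^ 2 * G + 17 * C * c * G + 6 * C * G ^ 2), 1152 * C * G, ?_⟩
  intro u v Q R X n U2 U3 V2 V3 H hR0 hR1 hX1 hXR hlog h2 h3 k2 k3 hn hUn hnG hW hU3 hV3
  set f : ℝ → ℝ := fun r => ∫ x in closedBall (0 : E3) r, dissip u v x with hf
  have hR : 0 < R := by linarith
  have hX : 0 < X := by linarith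
  have f0 : ∀ r, 0 ≤ f r := fun r => integral_nonneg fun x => dissip_nonneg u v x
  obtain ⟨-, -, -, -, cd⟩ := continuous_coefficients H
  have key := le_of_hole_filling (f := f) (R := R) (B := f (2 * R))
    (A := (166464 * C ^ 2 * c ^ 2 * G + 17 * C * c * G + 6 * C * G ^ 2) / X) hR (by positivity) f0
    (fun r _ hr => setIntegral_closedBall_mono_radius cd (dissip_nonneg u v) hr.le) ?_
  · exact key.trans_eq (by ring)
  intro r d hr hd e
  have hU20 : 0 ≤ U2 := setIntegral_nonneg_of_le (fun _ => sq_nonneg _) h2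
  have hV20 : 0 ≤ V2 := setIntegral_nonneg_of_le (fun _ => sq_nonneg _) k2
  have hU30 : 0 ≤ U3 := setIntegral_nonneg_of_le (fun x => pow_nonneg (absSum_nonneg u x) 3) h3
  have hV30 : 0 ≤ V3 := setIntegral_nonneg_of_le (fun x => pow_nonneg (absGrad_nonneg v x) 3) k3
  obtain ⟨y, hy⟩ : ∃ y, y = d / R := ⟨_, rfl⟩
  have hdy : d = y * R := by rw [hy]; field_simp
  have hy0 : 0 < y := by rw [hy]; positivity
  have hy1 : y ≤ 1 / 2 := by rw [hy, div_le_iff₀ hR]; linarith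
  rw [← hy]
  set Y := f (r + d) with hY
  have hY0 : 0 ≤ Y := f0 _
  set δ := y ^ 4 / R ^ 12 with hδ
  set Λ := 17 * c * X / y with hΛ
  have hΛ0 : 0 < Λ := by positivity
  set l := d / (576 * C * Λ) with hl
  have B := H.ballBounds (ρ := r + d) (by linarith) h2 h3 k2 k3 hn hUn
  have hδ0 : 0 < δ := by positivity
  have hR12 : 1 ≤ R ^ 12 := one_le_pow₀ hR1
  have hδy : δ ≤ y ^ 4 := div_le_self (by positivity) hR12
  have hy3 : y ^ 3 ≤ 1 / 8 := by
    calc y ^ 3 ≤ (1 / 2) ^ 3 := by gcongr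
      _ = _ := by norm_num
  have hy4 : y ^ 4 ≤ y / 8 := by
    calc y ^ 4 = y * y ^ 3 := by ring
      _ ≤ y * (1 / 8) := by gcongr
      _ = _ := by ring
  have hyd : y ≤ d := by rw [hdy]; exact le_mul_of_one_le_right hy0.le hR1
  have main := core u v Q r d n _ U2 U3 V2 V3 l δ H B (by linarith) hd (by positivity) hδ0
    (by linarith) (by linarith)
  have hsq : √δ = y ^ 2 / R ^ 6 := by
    rw [hδ, show y ^ 4 / R ^ 12 = (y ^ 2 / R ^ 6) ^ 2 by field_simp]
    exact Real.sqrt_sq (by positivity)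
  have hlogb : 1 + Real.log (d / 2 / δ) ≤ Λ := by
    have e1 : d / 2 / δ = R ^ 13 * (1 / y) ^ 3 / 2 := by rw [hδ, hdy]; field_simp
    have h1 : Real.log (d / 2 / δ) ≤ Real.log (R ^ 13 * (1 / y) ^ 3) := by
      apply Real.log_le_log (by positivity)
      rw [e1]
      exact half_le_self (by positivity)
    rw [Real.log_mul (by positivity) (by positivity), Real.log_pow, Real.log_pow] at h1
    have h2 := Real.log_le_sub_one_of_pos (by positivity : 0 < 1 / y)
    have hy' : 1 ≤ 1 / y := by rw [le_div_iff₀ hy0]; linarith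
    have hcX : 1 ≤ c * X := one_le_mul_of_one_le_of_one_le hc hX1
    have h3 : c * X ≤ c * X * (1 / y) := le_mul_of_one_le_right (by linarith) hy'
    have h4 : 1 / y ≤ c * X * (1 / y) := le_mul_of_one_le_left (by linarith) hcX
    have e2 : Λ = 17 * (c * X * (1 / y)) := by rw [hΛ]; ring
    rw [e2]
    push_cast at h1
    linarith
  have t1 : C * (Λ * (1 / d) * (l * (9 * Y))) = 1 / 64 * Y := by
    rw [hl]; field_simp; ring
  have t2 : y ^ 4 * (C * (Λ * (1 / d) * (l⁻¹ * (U2 + n ^ 2 * V2))))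
      ≤ 166464 * C ^ 2 * c ^ 2 * G / X := by
    calc _ ≤ y ^ 4 * (C * (Λ * (1 / d) * (l⁻¹ * (G * R ^ 2 / X ^ 4)))) := by gcongr
      _ = 166464 * C ^ 2 * c ^ 2 * G / X * X⁻¹ := by
        rw [hl, hΛ, hdy]; field_simp; norm_num
      _ ≤ _ := mul_le_of_le_one_right (by positivity) (inv_le_one_of_one_le₀ hX1)
  have t3 : y ^ 4 * (C * (Λ * (1 / d) * U3)) ≤ 17 * C * c * G / X := by
    calc _ ≤ y ^ 4 * (C * (Λ * (1 / d) * (G * R / X ^ 4))) := by gcongr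
      _ = 17 * C * c * G / X * (y ^ 2 * (X⁻¹) ^ 2) := by rw [hΛ, hdy]; field_simp
      _ ≤ _ := mul_le_of_le_one_right (by positivity)
        (mul_le_one₀ (pow_le_one₀ hy0.le (by linarith)) (by positivity)
          (pow_le_one₀ (by positivity) (inv_le_one_of_one_le₀ hX1)))
  have hX4 : 1 ≤ X ^ 4 := one_le_pow₀ hX1
  have hR2 : 1 ≤ R ^ 2 := one_le_pow₀ hR1
  have t4 : C * (√δ * n * (1 / d + 1 / d ^ 2) * (9 * Y + U2 + U3 + V3))
      ≤ 1 / 64 * Y + 6 * C * G ^ 2 / X := by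
    have g2 : U2 ≤ G * R ^ 3 := by
      have : 0 ≤ n ^ 2 * V2 := by positivity
      have h' : G * R ^ 2 / X ^ 4 ≤ G * R ^ 2 := div_le_self (by positivity) hX4
      have h'' : G * R ^ 2 ≤ G * R ^ 3 := by gcongr; norm_num
      linarith
    have g3 : U3 ≤ G * R ^ 3 := by
      have h' : G * R / X ^ 4 ≤ G * R := div_le_self (by positivity) hX4
      have h'' : G * R ≤ G * R ^ 3 := by
        calc G * R = G * R ^ 1 := by ring
          _ ≤ _ := by gcongr; norm_num
      linarith
    have hs : √δ * (1 / d + 1 / d ^ 2) ≤ 2 / R ^ 6 := by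
      have h5 : y ^ 2 * (1 / d + 1 / d ^ 2) ≤ 2 := by
        have : y ^ 2 * (1 / d + 1 / d ^ 2) = y * R⁻¹ + (R⁻¹) ^ 2 := by rw [hdy]; field_simp
        rw [this]
        have hRi : R⁻¹ ≤ 1 := inv_le_one_of_one_le₀ hR1
        have hRi0 : 0 < R⁻¹ := by positivity
        have h8 : y * R⁻¹ ≤ 1 := mul_le_one₀ (by linarith) hRi0.le hRi
        have h9 : R⁻¹ ^ 2 ≤ 1 := pow_le_one₀ hRi0.le hRi
        linarith
      rw [hsq]
      calc _ = y ^ 2 * (1 / d + 1 / d ^ 2) / R ^ 6 := by ring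
        _ ≤ _ := by gcongr
    have h6 : 18 * C * G / R ^ 5 ≤ 1 / 64 := by
      have hR5 : R ≤ R ^ 5 := le_self_pow₀ hR1 (by norm_num)
      rw [div_le_iff₀ (by positivity)]
      linarith
    have h7 : 6 * C * G ^ 2 / R ^ 2 ≤ 6 * C * G ^ 2 / X := by
      have hR22 : R ≤ R ^ 2 := le_self_pow₀ hR1 (by norm_num)
      gcongr
      linarith
    calc _ = C * (√δ * (1 / d + 1 / d ^ 2) * n * (9 * Y + U2 + U3 + V3)) := by ring
      _ ≤ C * (2 / R ^ 6 * (G * R) * (9 * Y + G * R ^ 3 + G * R ^ 3 + G * R ^ 3)) := by gcongr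
      _ = 18 * C * G / R ^ 5 * Y + 6 * C * G ^ 2 / R ^ 2 := by field_simp; ring
      _ ≤ _ := by gcongr
  have hy41 : y ^ 4 ≤ 1 := by linarith
  have m1 : f r ≤ C * (Λ * (1 / d) * (l * (9 * Y)))
      + C * (Λ * (1 / d) * (l⁻¹ * (U2 + n ^ 2 * V2))) + C * (Λ * (1 / d) * U3)
      + C * (√δ * n * (1 / d + 1 / d ^ 2) * (9 * Y + U2 + U3 + V3)) := by
    refine main.trans ?_
    have : (1 + Real.log (d / 2 / δ)) * (1 / d) * (l * (9 * Y) + l⁻¹ * (U2 + n ^ 2 * V2) + U3)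
        ≤ Λ * (1 / d) * (l * (9 * Y) + l⁻¹ * (U2 + n ^ 2 * V2) + U3) := by
      gcongr
    calc _ ≤ C * (Λ * (1 / d) * (l * (9 * Y) + l⁻¹ * (U2 + n ^ 2 * V2) + U3)
        + √δ * n * (1 / d + 1 / d ^ 2) * (9 * Y + U2 + U3 + V3)) := by gcongr
      _ = _ := by ring
  have m2 : y ^ 4 * f r ≤ y ^ 4 * (1 / 64 * Y) + 166464 * C ^ 2 * c ^ 2 * G / X
      + 17 * C * c * G / X + (y ^ 4 * (1 / 64 * Y) + 6 * C * G ^ 2 / X) := by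
    have a1 := mul_le_mul_of_nonneg_left m1 (by positivity : 0 ≤ y ^ 4)
    have a2 := mul_le_mul_of_nonneg_left t4 (by positivity : 0 ≤ y ^ 4)
    have a3 : y ^ 4 * (6 * C * G ^ 2 / X) ≤ 6 * C * G ^ 2 / X :=
      mul_le_of_le_one_left (by positivity) hy41
    rw [t1] at a1
    linarith
  calc _ ≤ _ := m2
    _ = _ := by ring

end Decay

section Vanishing

lemma eq_zero_of_setIntegral_tendsto {f : E3 → ℝ} {g : ℝ → ℝ} (hf : Continuous f)
    (h0 : ∀ x, 0 ≤ f x) (hg : Tendsto g atTop (nhds 0))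
    (h : ∀ᶠ R in atTop, ∫ x in closedBall (0 : E3) R, f x ≤ g R) (x : E3) : f x = 0 := by
  have hz : ∀ q : ℝ, ∫ x in closedBall (0 : E3) q, f x = 0 := fun q =>
    le_antisymm (ge_of_tendsto hg (by
      filter_upwards [h, eventually_ge_atTop q] with R hR hq
      exact (setIntegral_closedBall_mono_radius hf h0 hq).trans hR))
      (integral_nonneg fun x => h0 x)
  by_contra hx
  have hpos : 0 < f x := lt_of_le_of_ne (h0 x) (Ne.symm hx)
  have h1 : 0 < ∫ y in closedBall (0 : E3) (‖x‖ + 1), f y := by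
    rw [setIntegral_pos_iff_support_of_nonneg_ae (ae_of_all _ h0) (integrableOn_closedBall hf _ _)]
    refine lt_of_lt_of_le (((isOpen_lt continuous_const hf).inter
      (isOpen_ball (x := (0 : E3)) (ε := ‖x‖ + 1))).measure_pos volume ⟨x, hpos, by simp⟩)
      (measure_mono fun y hy => ⟨ne_of_gt hy.1, ball_subset_closedBall hy.2⟩)
  exact h1.ne' (hz _)

lemma eq_const_of_pd_eq_zero {f : E3 → ℝ} (hf : Smooth3 f) (h : ∀ j x, pd j f x = 0) (x y : E3) :
    f x = f y :=
  is_const_of_fderiv_eq_zero (𝕜 := ℝ) (hf.differentiable (by simp)) (fun z => by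
    ext w
    rw [fderiv_eq_sum_pd]
    simp [h]) x y

lemma volume_closedBall_toReal {R : ℝ} (hR : 0 ≤ R) :
    volume.real (closedBall (0 : E3) R) = R ^ 3 * unitVol := by
  have h := Measure.addHaar_real_closedBall' (volume : Measure E3) 0 hR
  rw [finrank_euclideanSpace_fin] at h
  exact h

variable {u v : Fin 3 → E3 → ℝ} {Q : E3 → ℝ} {σ μ : ℝ}

/-- Growth bounds on large balls. -/
structure GrowthBounds (a h : E3 → ℝ) (σ μ : ℝ) : Prop where
  pos : 0 < σ
  le_third : σ ≤ 1 / 3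
  one_le : 1 ≤ μ
  a_sq : ∀ R : ℝ, 1 ≤ R → ∫ x in closedBall (0 : E3) (2 * R), a x ^ 2 ≤ μ * R ^ (5 / 3 : ℝ)
  a_cube : ∀ R : ℝ, 1 ≤ R → ∫ x in closedBall (0 : E3) (2 * R), a x ^ 3 ≤ μ * R ^ (1 - σ)
  h_sq : ∀ R : ℝ, 1 ≤ R → ∫ x in closedBall (0 : E3) (2 * R), h x ^ 2 ≤ μ * R
  h_cube : ∀ R : ℝ, 1 ≤ R → ∫ x in closedBall (0 : E3) (2 * R), h x ^ 3 ≤ μ * R ^ 3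

lemma ReducedEL.dissip_eq_zero (H : ReducedEL u v Q)
    (B : GrowthBounds (absSum u) (absGrad v) σ μ) (x : E3) : dissip u v x = 0 := by
  have hσ := B.pos
  have hσ1 := B.le_third
  have hμ := B.one_le
  obtain ⟨A, R0, h⟩ := exists_decay_estimate (G := 2 * μ ^ 3) (c := 1 + 4 / σ)
    (by linarith [one_le_pow₀ hμ (n := 3)]) (by linarith [show 0 < 4 / σ by positivity])
  obtain ⟨-, -, -, -, cd⟩ := continuous_coefficients H
  refine eq_zero_of_setIntegral_tendsto (g := fun R => A * R ^ (-(σ / 4))) cd (dissip_nonneg u v)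
    ?_ ?_ x
  · simpa using (tendsto_rpow_neg_atTop (by positivity : 0 < σ / 4)).const_mul A
  filter_upwards [eventually_ge_atTop R0, eventually_ge_atTop 1] with R hR0 hR1
  have hR : 0 < R := by linarith
  have hX1 : 1 ≤ R ^ (σ / 4) := Real.one_le_rpow hR1 (by positivity)
  have hX4 : (R ^ (σ / 4)) ^ 4 = R ^ σ := by
    rw [← Real.rpow_natCast, ← Real.rpow_mul hR.le]
    norm_num
  have hn3 : (R ^ (1 / 3 : ℝ)) ^ 3 = R := by
    rw [← Real.rpow_natCast, ← Real.rpow_mul hR.le]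
    norm_num
  have hn1 : 1 ≤ R ^ (1 / 3 : ℝ) := Real.one_le_rpow hR1 (by norm_num)
  have hμ3 : μ ≤ μ ^ 3 := le_self_pow₀ hμ (by norm_num)
  have hσR : 0 < R ^ σ := Real.rpow_pos_of_pos hR σ
  have e1 : R ^ (1 - σ) = R / R ^ σ := by rw [Real.rpow_sub hR, Real.rpow_one]
  have hlow : R ^ (5 / 3 : ℝ) ≤ R ^ 2 / R ^ σ := by
    rw [← Real.rpow_natCast, ← Real.rpow_sub hR]
    exact Real.rpow_le_rpow_of_exponent_le hR1 (by push_cast; linarith)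
  have key := h u v Q R (R ^ (σ / 4)) (μ * R ^ (1 / 3 : ℝ)) _ _ _ _ H hR0 hR1 hX1
    ?_ ?_ (B.a_sq R hR1) (B.a_cube R hR1) (B.h_sq R hR1) (B.h_cube R hR1)
    (one_le_mul_of_one_le_of_one_le hμ hn1) ?_ ?_ ?_ ?_ ?_
  · rw [Real.rpow_neg hR.le, ← div_eq_mul_inv]
    exact key
  · calc R ^ (σ / 4) ≤ R ^ (1 : ℝ) := Real.rpow_le_rpow_of_exponent_le hR1 (by linarith)
      _ = R := Real.rpow_one R
  · have h1 := Real.log_le_rpow_div hR.le (by positivity : 0 < σ / 4)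
    calc Real.log R ≤ R ^ (σ / 4) / (σ / 4) := h1
      _ = 4 / σ * R ^ (σ / 4) := by field_simp
      _ ≤ _ := by gcongr; linarith
  · rw [mul_pow, hn3]
    have : R ^ (1 - σ) ≤ R := by
      rw [e1]; exact div_le_self hR.le (Real.one_le_rpow hR1 hσ.le)
    gcongr
  · have : R ^ (1 / 3 : ℝ) ≤ R := by
      calc _ ≤ R ^ (1 : ℝ) := Real.rpow_le_rpow_of_exponent_le hR1 (by norm_num)
        _ = R := Real.rpow_one R
    have : μ ≤ 2 * μ ^ 3 := by linarith
    gcongr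
  · have e2 : (R ^ (1 / 3 : ℝ)) ^ 2 * R = R ^ (5 / 3 : ℝ) := by
      rw [← Real.rpow_natCast, ← Real.rpow_mul hR.le, ← Real.rpow_add_one hR.ne']
      norm_num
    rw [hX4]
    calc _ = μ * R ^ (5 / 3 : ℝ) + μ ^ 3 * ((R ^ (1 / 3 : ℝ)) ^ 2 * R) := by ring
      _ = (μ + μ ^ 3) * R ^ (5 / 3 : ℝ) := by rw [e2]; ring
      _ ≤ (μ ^ 3 + μ ^ 3) * (R ^ 2 / R ^ σ) := by gcongr
      _ = _ := by ring
  · rw [hX4, e1]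
    calc _ ≤ 2 * μ ^ 3 * (R / R ^ σ) := by gcongr; linarith
      _ = _ := by ring
  · gcongr
    linarith

lemma ReducedEL.eq_zero (H : ReducedEL u v Q)
    (B : GrowthBounds (absSum u) (absGrad v) σ μ) (i : Fin 3) (x : E3) : u i x = 0 := by
  have hσ := B.pos
  have hd := H.dissip_eq_zero B
  have hpd : ∀ i j x, pd j (u i) x = 0 := fun i j x => by
    have h1 := absGrad_sq_le u v x
    rw [hd x, mul_zero] at h1
    have h2 := abs_pd_le_absGrad u i j x
    have h3 : absGrad u x = 0 := pow_eq_zero_iff (two_ne_zero) |>.1 (le_antisymm h1 (sq_nonneg _))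
    exact abs_eq_zero.1 (le_antisymm (h2.trans h3.le) (abs_nonneg _))
  have hconst : ∀ y, absSum u y = absSum u x := fun y => Finset.sum_congr rfl fun i _ => by
    rw [eq_const_of_pd_eq_zero (H.smooth_u i) (hpd i) y x]
  set S := absSum u x with hS
  have hS0 : 0 ≤ S := absSum_nonneg u x
  have hV := unitVol_pos
  have hle : ∀ᶠ R : ℝ in atTop, 8 * unitVol * S ^ 3 ≤ μ * R ^ (-(2 + σ)) := by
    filter_upwards [eventually_ge_atTop 1] with R hR1
    have hR : 0 < R := by linarith
    have h1 := B.a_cube R hR1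
    simp only [hconst, setIntegral_const, smul_eq_mul] at h1
    rw [volume_closedBall_toReal (by positivity)] at h1
    have e : R ^ (1 - σ) = R ^ (-(2 + σ)) * R ^ 3 := by
      rw [← Real.rpow_natCast, ← Real.rpow_add hR]
      congr 1
      push_cast
      ring
    rw [e] at h1
    refine le_of_mul_le_mul_right (a := R ^ 3) ?_ (by positivity)
    linarith
  have hlim : Tendsto (fun R : ℝ => μ * R ^ (-(2 + σ))) atTop (nhds 0) := by
    simpa using (tendsto_rpow_neg_atTop (by positivity : 0 < 2 + σ)).const_mul μ
  have h1 := ge_of_tendsto hlim hle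
  have h3 : S ^ 3 ≤ 0 := by
    by_contra h
    push Not at h
    have : 0 < 8 * unitVol * S ^ 3 := by positivity
    linarith
  have h4 : S = 0 := pow_eq_zero_iff (n := 3) (by norm_num) |>.1 (le_antisymm h3 (by positivity))
  exact abs_eq_zero.1 (le_antisymm ((abs_le_absSum u i x).trans (hS ▸ h4).le) (abs_nonneg _))

end Vanishing

section Growth

lemma integrableOn_ann {f : E3 → ℝ} (hf : Continuous f) (R : ℝ) : IntegrableOn f (ann R) :=
  (integrableOn_closedBall hf 0 R).mono_set fun x hx => by
    simpa using hx.2.le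

lemma measurableSet_ann (R : ℝ) : MeasurableSet (ann R) :=
  ((isOpen_lt continuous_const continuous_norm).inter
    (isOpen_lt continuous_norm continuous_const)).measurableSet

lemma volume_ann_le {R : ℝ} (hR : 0 ≤ R) : volume.real (ann R) ≤ R ^ 3 * unitVol := by
  rw [← volume_closedBall_toReal hR]
  exact measureReal_mono (fun x hx => by simpa using hx.2.le) measure_closedBall_lt_top.ne

lemma setIntegral_closedBall_le_add_ann {f : E3 → ℝ} (hf : Continuous f) (h0 : ∀ x, 0 ≤ f x)
    (R : ℝ) :
    ∫ x in closedBall (0 : E3) R, f x ≤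
      (∫ x in closedBall (0 : E3) (R / 2), f x) + ∫ x in ann R, f x := by
  have hd : Disjoint (closedBall (0 : E3) (R / 2)) (ann R) :=
    Set.disjoint_left.2 fun x hx hx' => by
      have h1 : ‖x‖ ≤ R / 2 := by simpa using hx
      exact absurd hx'.1 (not_lt.2 h1)
  rw [← setIntegral_union hd (measurableSet_ann R) (integrableOn_closedBall hf _ _)
    (integrableOn_ann hf R)]
  have hae : (closedBall (0 : E3) R : Set E3) =ᵐ[volume] ball 0 R := by
    refine (ae_eq_of_subset_of_measure_ge ball_subset_closedBall ?_
      measurableSet_ball.nullMeasurableSet measure_closedBall_lt_top.ne).symm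
    rw [Measure.addHaar_closedBall_eq_addHaar_ball]
  rw [setIntegral_congr_set hae]
  refine setIntegral_mono_set ((integrableOn_closedBall hf _ _).union (integrableOn_ann hf R))
    (ae_of_all _ h0) (LE.le.eventuallyLE fun x hx => ?_)
  have hx : ‖x‖ < R := by simpa using hx
  rcases le_or_gt ‖x‖ (R / 2) with h | h
  · exact Or.inl (by simpa using h)
  · exact Or.inr ⟨h, hx⟩

/-- Power growth on annuli gives power growth on balls. -/
lemma exists_growth_of_ann {f : E3 → ℝ} (hf : Continuous f) (h0 : ∀ x, 0 ≤ f x) {α C : ℝ}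
    (hα : 0 < α) (h : ∀ᶠ R in atTop, ∫ x in ann R, f x ≤ C * R ^ α) :
    ∃ M : ℝ, ∀ R : ℝ, 1 ≤ R → ∫ x in closedBall (0 : E3) (2 * R), f x ≤ M * R ^ α := by
  obtain ⟨R1, hR1⟩ := eventually_atTop.1 (h.and (eventually_ge_atTop 2))
  have hR12 := (hR1 R1 le_rfl).2
  set θ : ℝ := (1 / 2 : ℝ) ^ α with hθ
  have hθ1 : 0 < 1 - θ := sub_pos.2 (Real.rpow_lt_one (by norm_num) (by norm_num) hα)
  set M := max (∫ x in closedBall (0 : E3) R1, f x) (C / (1 - θ)) with hM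
  have hM0 : 0 ≤ M := (integral_nonneg fun x => h0 x).trans (le_max_left _ _)
  have hMC : M * θ + C ≤ M := by
    have : C / (1 - θ) ≤ M := le_max_right _ _
    rw [div_le_iff₀ hθ1] at this
    linarith
  have base : ∀ R : ℝ, 1 ≤ R → R ≤ R1 → ∫ x in closedBall (0 : E3) R, f x ≤ M * R ^ α :=
    fun R h1 hR => (setIntegral_closedBall_mono_radius hf h0 hR).trans
      ((le_max_left _ _).trans (le_mul_of_one_le_right hM0 (Real.one_le_rpow h1 hα.le)))
  have key : ∀ n : ℕ, ∀ R : ℝ, 1 ≤ R → R ≤ 2 ^ n * R1 →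
      ∫ x in closedBall (0 : E3) R, f x ≤ M * R ^ α := by
    intro n
    induction n with
    | zero => intro R h1 hR; exact base R h1 (by simpa using hR)
    | succ n ih =>
      intro R h1 hR
      rcases le_or_gt R R1 with hle | hlt
      · exact base R h1 hle
      · have hhalf := ih (R / 2) (by linarith) (by rw [pow_succ] at hR; linarith)
        have hann := (hR1 R hlt.le).1
        have hs := setIntegral_closedBall_le_add_ann hf h0 R
        have e : (R / 2) ^ α = θ * R ^ α := by
          rw [hθ, ← Real.mul_rpow (by norm_num) (by linarith)]
          ring_nf
        rw [e] at hhalf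
        have := mul_le_mul_of_nonneg_right hMC (Real.rpow_nonneg (by linarith : 0 ≤ R) α)
        linarith
  refine ⟨M * 2 ^ α, fun R h1 => ?_⟩
  obtain ⟨n, hn⟩ := pow_unbounded_of_one_lt (2 * R) (one_lt_two : (1 : ℝ) < 2)
  have := key n (2 * R) (by linarith) (hn.le.trans (le_mul_of_one_le_right (by positivity)
    (by linarith)))
  rwa [Real.mul_rpow (by norm_num) (by linarith), ← mul_assoc] at this

lemma cube_le_rpow_add {a t p : ℝ} (hp : 3 ≤ p) (ha : 0 ≤ a) (ht : 0 < t) :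
    a ^ 3 ≤ t ^ 3 * (t ^ (-p) * a ^ p + 1) := by
  have e : t ^ (-p) * a ^ p = (a / t) ^ p := by
    rw [Real.div_rpow ha ht.le, Real.rpow_neg ht.le]; ring
  have e2 : a ^ 3 = t ^ 3 * (a / t) ^ 3 := by field_simp
  have h0 : 0 ≤ a / t := by positivity
  rw [e, e2]
  refine mul_le_mul_of_nonneg_left ?_ (by positivity)
  rcases le_total (a / t) 1 with h | h
  · have h1 : (a / t) ^ 3 ≤ 1 := pow_le_one₀ h0 h
    have h2 := Real.rpow_nonneg h0 p
    linarith
  · have h1 : (a / t) ^ 3 ≤ (a / t) ^ p := by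
      rw [← Real.rpow_natCast]
      exact Real.rpow_le_rpow_of_exponent_le h (by exact_mod_cast hp)
    linarith

/-- Interpolation of a decaying annular `L^p` bound with the constant function. -/
lemma exists_cube_growth {a : E3 → ℝ} (ha : Continuous a) (h0 : ∀ x, 0 ≤ a x) {γ p η σ : ℝ}
    (hp : 3 ≤ p) (hη : η = γ / p - 3 / p + 2 / 3) (hσ : σ ≤ 6 * η) (hσ1 : σ < 1)
    (h : ∀ᶠ R in atTop, R ^ (-γ) * ∫ x in ann R, a x ^ p ≤ R ^ (-(3 * η * p))) :
    ∃ M : ℝ, ∀ R : ℝ, 1 ≤ R →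
      ∫ x in closedBall (0 : E3) (2 * R), a x ^ 3 ≤ M * R ^ (1 - σ) := by
  have hap : Continuous fun x => a x ^ p := ha.rpow_const fun x => Or.inr (by linarith)
  refine exists_growth_of_ann (f := fun x => a x ^ 3) (by fun_prop)
    (fun x => pow_nonneg (h0 x) 3) (C := 1 + unitVol) (by linarith) ?_
  filter_upwards [h, eventually_ge_atTop 1] with R hR hR1
  have hRp : 0 < R := by linarith
  set t : ℝ := R ^ (-(2 / 3) - 2 * η) with ht
  have htp : 0 < t := Real.rpow_pos_of_pos hRp _
  have hI : ∫ x in ann R, a x ^ p ≤ R ^ (γ - 3 * η * p) := by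
    have := mul_le_mul_of_nonneg_left hR (Real.rpow_nonneg hRp.le γ)
    rwa [← mul_assoc, ← Real.rpow_add hRp, ← Real.rpow_add hRp, add_neg_cancel, Real.rpow_zero,
      one_mul, ← sub_eq_add_neg] at this
  have e1 : t ^ (-p) * R ^ (γ - 3 * η * p) = R ^ 3 := by
    rw [ht, ← Real.rpow_mul hRp.le, ← Real.rpow_add hRp, ← Real.rpow_natCast]
    congr 1
    have : p * η = γ - 3 + 2 / 3 * p := by
      rw [hη]
      field_simp
    push_cast
    linarith
  have e2 : t ^ 3 * R ^ 3 = R ^ (1 - 6 * η) := by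
    rw [ht, ← Real.rpow_natCast, ← Real.rpow_mul hRp.le, ← Real.rpow_natCast, ← Real.rpow_add hRp]
    congr 1
    push_cast
    ring
  have hmaj := (((integrableOn_ann hap R).const_mul (t ^ (-p))).add
    (integrableOn_ann (continuous_const (y := (1 : ℝ))) R)).const_mul (t ^ 3)
  calc ∫ x in ann R, a x ^ 3 ≤ ∫ x in ann R, t ^ 3 * (t ^ (-p) * a x ^ p + 1) :=
        setIntegral_mono (integrableOn_ann (f := fun x => a x ^ 3) (by fun_prop) R) hmaj
          fun x => cube_le_rpow_add hp (h0 x) htp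
    _ = t ^ 3 * (t ^ (-p) * (∫ x in ann R, a x ^ p) + volume.real (ann R)) := by
        rw [integral_const_mul, integral_add ((integrableOn_ann hap R).const_mul _)
          (integrableOn_ann (continuous_const (y := (1 : ℝ))) R), integral_const_mul]
        simp
    _ ≤ t ^ 3 * (t ^ (-p) * R ^ (γ - 3 * η * p) + R ^ 3 * unitVol) := by
        have h2 := volume_ann_le hRp.le
        have h3 := Real.rpow_nonneg htp.le (-p)
        gcongr
    _ = (1 + unitVol) * R ^ (1 - 6 * η) := by rw [e1, ← e2]; ring
    _ ≤ (1 + unitVol) * R ^ (1 - σ) := by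
        have h4 := unitVol_pos
        gcongr

lemma sq_le_cube_div_add {a l : ℝ} (ha : 0 ≤ a) (hl : 0 < l) : a ^ 2 ≤ a ^ 3 * l⁻¹ + l ^ 2 := by
  rcases le_total a l with h | h
  · have : a ^ 2 ≤ l ^ 2 := by gcongr
    have : 0 ≤ a ^ 3 * l⁻¹ := by positivity
    linarith
  · have : a ^ 2 ≤ a ^ 3 * l⁻¹ := by
      rw [← div_eq_mul_inv, le_div_iff₀ hl, pow_succ a 2]
      gcongr
    have : 0 ≤ l ^ 2 := by positivity
    linarith

lemma exists_sq_growth_of_cube {a : E3 → ℝ} (ha : Continuous a) (h0 : ∀ x, 0 ≤ a x) {σ M : ℝ}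
    (hσ : 0 < σ) (hM : 0 ≤ M)
    (h : ∀ R : ℝ, 1 ≤ R → ∫ x in closedBall (0 : E3) (2 * R), a x ^ 3 ≤ M * R ^ (1 - σ)) :
    ∀ R : ℝ, 1 ≤ R → ∫ x in closedBall (0 : E3) (2 * R), a x ^ 2 ≤
      (M + 8 * unitVol) * R ^ (5 / 3 : ℝ) := by
  intro R hR1
  have hR : 0 < R := by linarith
  set l : ℝ := R ^ (-(2 / 3) : ℝ) with hl
  have hlp : 0 < l := Real.rpow_pos_of_pos hR _
  have e1 : R ^ (1 - σ) * l⁻¹ ≤ R ^ (5 / 3 : ℝ) := by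
    rw [hl, ← Real.rpow_neg hR.le, ← Real.rpow_add hR]
    exact Real.rpow_le_rpow_of_exponent_le hR1 (by linarith)
  have e2 : R ^ 3 * l ^ 2 = R ^ (5 / 3 : ℝ) := by
    rw [hl, ← Real.rpow_natCast, ← Real.rpow_natCast, ← Real.rpow_mul hR.le, ← Real.rpow_add hR]
    norm_num
  have i3 := integrableOn_closedBall (F := fun x => a x ^ 3) (by fun_prop) 0 (2 * R)
  calc ∫ x in closedBall (0 : E3) (2 * R), a x ^ 2
      ≤ ∫ x in closedBall (0 : E3) (2 * R), (a x ^ 3 * l⁻¹ + l ^ 2) :=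
        setIntegral_closedBall_mono (by fun_prop) (by fun_prop) fun x _ =>
          sq_le_cube_div_add (h0 x) hlp
    _ = (∫ x in closedBall (0 : E3) (2 * R), a x ^ 3) * l⁻¹ + (2 * R) ^ 3 * unitVol * l ^ 2 := by
        rw [integral_add (i3.mul_const _) (integrableOn_closedBall continuous_const 0 _),
          integral_mul_const, setIntegral_const, volume_closedBall_toReal (by positivity),
          smul_eq_mul]
    _ ≤ M * R ^ (1 - σ) * l⁻¹ + (2 * R) ^ 3 * unitVol * l ^ 2 := by
        gcongr
        exact h R hR1
    _ = M * (R ^ (1 - σ) * l⁻¹) + 8 * unitVol * (R ^ 3 * l ^ 2) := by ring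
    _ ≤ _ := by
        rw [e2, add_mul]
        gcongr

lemma exists_cube_growth_of_morrey {f : E3 → ℝ} (hf : Continuous f) {p γ : ℝ} (hγ : γ < 3)
    (hp : 3 ≤ p) (h : MemMorrey p γ f) :
    ∃ M : ℝ, ∀ R : ℝ, 1 ≤ R → ∫ x in closedBall (0 : E3) (2 * R), |f x| ^ 3 ≤ M * R ^ 3 := by
  obtain ⟨-, C, hC⟩ := h
  refine ⟨27 * |C| + 8 * unitVol, fun R hR1 => ?_⟩
  have hR : 0 < R := by linarith
  have hap : Continuous fun x => |f x| ^ p := hf.abs.rpow_const fun x => Or.inr (by linarith)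
  have h3 : ∫ x in closedBall (0 : E3) (2 * R), |f x| ^ p ≤ |C| * (3 * R) ^ 3 := by
    calc ∫ x in closedBall (0 : E3) (2 * R), |f x| ^ p
        ≤ ∫ x in ball (0 : E3) (3 * R), |f x| ^ p :=
          setIntegral_mono_set ((integrableOn_closedBall hap 0 (3 * R)).mono_set
            ball_subset_closedBall) (ae_of_all _ fun x => by positivity)
            (LE.le.eventuallyLE (closedBall_subset_ball (by linarith)))
      _ = (3 * R) ^ γ * ((3 * R) ^ (-γ) * ∫ x in ball (0 : E3) (3 * R), |f x| ^ p) := by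
          rw [← mul_assoc, ← Real.rpow_add (by positivity), add_neg_cancel, Real.rpow_zero, one_mul]
      _ ≤ (3 * R) ^ (3 : ℝ) * |C| := by
          have h1 := (hC (3 * R) (by linarith)).trans (le_abs_self C)
          have h2 : (1 : ℝ) ≤ 3 * R := by linarith
          gcongr
      _ = |C| * (3 * R) ^ 3 := by rw [mul_comm]; norm_cast
  calc ∫ x in closedBall (0 : E3) (2 * R), |f x| ^ 3
      ≤ ∫ x in closedBall (0 : E3) (2 * R), (|f x| ^ p + 1) :=
        setIntegral_closedBall_mono (by fun_prop) (hap.add continuous_const) fun x _ => by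
          simpa using cube_le_rpow_add hp (abs_nonneg (f x)) one_pos
    _ = (∫ x in closedBall (0 : E3) (2 * R), |f x| ^ p) + (2 * R) ^ 3 * unitVol := by
        rw [integral_add (integrableOn_closedBall hap 0 _)
          (integrableOn_closedBall continuous_const 0 _), setIntegral_const,
          volume_closedBall_toReal (by positivity), smul_eq_mul, mul_one]
    _ ≤ _ := by linarith

end Growth

section Assembly

variable {u v : E3 → Fin 3 → ℝ} {P : E3 → ℝ}

lemma smooth3_component (hu : ContDiff ℝ (⊤ : ℕ∞) u) (i : Fin 3) : Smooth3 fun y => u y i :=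
  contDiff_pi.1 hu i

lemma continuous_vecNorm (hu : ContDiff ℝ (⊤ : ℕ∞) u) : Continuous (vecNorm u) :=
  (continuous_finsetSum _ fun i _ => (smooth3_component hu i).continuous.pow 2).sqrt

lemma smooth3_gradSq (hv : ContDiff ℝ (⊤ : ℕ∞) v) : Smooth3 (gradSq v) :=
  ContDiff.sum fun i _ => ContDiff.sum fun k _ => ((smooth3_component hv k).pd i).pow 2

lemma gradSq_nonneg (v : E3 → Fin 3 → ℝ) (x : E3) : 0 ≤ gradSq v x :=
  Finset.sum_nonneg fun _ _ => Finset.sum_nonneg fun _ _ => sq_nonneg _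

lemma absSum_le_vecNorm (u : E3 → Fin 3 → ℝ) (x : E3) :
    absSum (fun i y => u y i) x ≤ 3 * vecNorm u x := by
  calc absSum (fun i y => u y i) x ≤ ∑ _i : Fin 3, vecNorm u x :=
        Finset.sum_le_sum fun i _ => Real.abs_le_sqrt
          (Finset.single_le_sum (f := fun i => u x i ^ 2) (fun _ _ => sq_nonneg _)
            (Finset.mem_univ i))
    _ = 3 * vecNorm u x := by simp

lemma absGrad_sq_le_gradSq (v : E3 → Fin 3 → ℝ) (x : E3) :
    absGrad (fun k y => v y k) x ^ 2 ≤ 9 * gradSq v x := by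
  have h := sq_sum_le_card_mul_sum_sq (s := (Finset.univ : Finset (Fin 3 × Fin 3)))
    (f := fun q => |pd q.2 (fun y => v y q.1) x|)
  unfold absGrad gradSq
  rw [Finset.sum_comm (γ := Fin 3) (f := fun i k => pd i (fun y => v y k) x ^ 2)]
  simpa [Fintype.sum_prod_type] using h

lemma absGrad_cube_le (w : Fin 3 → E3 → ℝ) (x : E3) :
    absGrad w x ^ 3 ≤ 81 * ∑ i, ∑ k, |pd k (w i) x| ^ 3 := by
  have h := pow_sum_div_card_le_sum_pow (s := (Finset.univ : Finset (Fin 3 × Fin 3)))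
    (f := fun q => |pd q.2 (w q.1) x|) (fun _ _ => abs_nonneg _) 2
  simp only [Fintype.sum_prod_type, Finset.card_univ, Fintype.card_prod, Fintype.card_fin] at h
  rw [div_le_iff₀ (by norm_num)] at h
  norm_num at h
  unfold absGrad
  linarith

lemma exists_gradSq_growth (hv : ContDiff ℝ (⊤ : ℕ∞) v)
    (h : ∃ C : ℝ, ∀ R : ℝ, 1 ≤ R → ∫ x in ann R, gradSq v x ≤ C) :
    ∃ M : ℝ, ∀ R : ℝ, 1 ≤ R →
      ∫ x in closedBall (0 : E3) (2 * R), absGrad (fun k y => v y k) x ^ 2 ≤ M * R := by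
  obtain ⟨C, hC⟩ := h
  have cg := (smooth3_gradSq hv).continuous
  have ca := continuous_absGrad fun k => smooth3_component hv k
  obtain ⟨M, hM⟩ := exists_growth_of_ann cg (gradSq_nonneg v) one_pos (C := |C|) (by
    filter_upwards [eventually_ge_atTop 1] with R hR
    rw [Real.rpow_one]
    exact (hC R hR).trans ((le_abs_self C).trans (le_mul_of_one_le_right (abs_nonneg C) hR)))
  refine ⟨9 * M, fun R hR => ?_⟩
  have h1 := hM R hR
  rw [Real.rpow_one] at h1
  calc _ ≤ ∫ x in closedBall (0 : E3) (2 * R), 9 * gradSq v x :=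
        setIntegral_closedBall_mono (by fun_prop) (by fun_prop) fun x _ => absGrad_sq_le_gradSq v x
    _ ≤ 9 * M * R := by rw [integral_const_mul]; linarith

lemma exists_absGrad_cube_growth (hv : ContDiff ℝ (⊤ : ℕ∞) v) {p γ : ℝ} (hγ : γ < 3) (hp : 3 ≤ p)
    (h : ∀ i k : Fin 3, MemMorrey p γ (fun x => pd i (fun y => v y k) x)) :
    ∃ M : ℝ, ∀ R : ℝ, 1 ≤ R →
      ∫ x in closedBall (0 : E3) (2 * R), absGrad (fun k y => v y k) x ^ 3 ≤ M * R ^ 3 := by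
  have cd : ∀ i k : Fin 3, Continuous (pd i fun y => v y k) := fun i k =>
    ((smooth3_component hv k).pd i).continuous
  have ca := continuous_absGrad fun k => smooth3_component hv k
  choose M hM using fun i k => exists_cube_growth_of_morrey (cd i k) hγ hp (h i k)
  have ci : ∀ i k : Fin 3, Continuous fun x => |pd i (fun y => v y k) x| ^ 3 := fun i k =>
    (cd i k).abs.pow 3
  refine ⟨81 * ∑ k, ∑ i, M i k, fun R hR => ?_⟩
  calc _ ≤ ∫ x in closedBall (0 : E3) (2 * R), 81 * ∑ k, ∑ i, |pd i (fun y => v y k) x| ^ 3 :=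
        setIntegral_closedBall_mono (by fun_prop)
          (continuous_const.mul (continuous_finsetSum _ fun k _ => continuous_finsetSum _
            fun i _ => ci i k)) fun x _ => absGrad_cube_le _ x
    _ = 81 * ∑ k, ∑ i, ∫ x in closedBall (0 : E3) (2 * R), |pd i (fun y => v y k) x| ^ 3 := by
        rw [integral_const_mul, integral_finsetSum _ fun k _ => integrable_finsetSum _ fun i _ =>
          integrableOn_closedBall (ci i k) 0 _]
        congr 1
        exact Finset.sum_congr rfl fun k _ => integral_finsetSum _ fun i _ =>
          integrableOn_closedBall (ci i k) 0 _
    _ ≤ 81 * ∑ k, ∑ i, M i k * R ^ 3 := by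
        gcongr with k _ i _
        exact hM i k R hR
    _ = _ := by simp only [Finset.sum_mul, mul_assoc]

lemma exists_absSum_cube_growth (hu : ContDiff ℝ (⊤ : ℕ∞) u) {p γ η σ : ℝ} (hp : 3 ≤ p)
    (hη : η = γ / p - 3 / p + 2 / 3) (hσ : σ ≤ 6 * η) (hσ1 : σ < 1)
    (h : Tendsto (fun R : ℝ => R ^ (3 * η) *
      (R ^ (-γ) * ∫ x in ann R, |vecNorm u x| ^ p) ^ (1 / p)) atTop (nhds 0)) :
    ∃ M : ℝ, ∀ R : ℝ, 1 ≤ R →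
      ∫ x in closedBall (0 : E3) (2 * R), absSum (fun i y => u y i) x ^ 3 ≤ M * R ^ (1 - σ) := by
  have hn : ∀ x, 0 ≤ vecNorm u x := fun x => Real.sqrt_nonneg _
  have cn := continuous_vecNorm hu
  have ca := continuous_absSum fun i => (smooth3_component hu i).continuous
  have hp0 : 0 < p := by linarith
  obtain ⟨M, hM⟩ := exists_cube_growth cn hn hp hη hσ hσ1 (by
    filter_upwards [h.eventually (ge_mem_nhds one_pos), eventually_ge_atTop 1] with R hR hR1
    have hRp : 0 < R := by linarith
    simp only [abs_of_nonneg (hn _)] at hR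
    set A := R ^ (-γ) * ∫ x in ann R, vecNorm u x ^ p with hA
    have hA0 : 0 ≤ A := mul_nonneg (Real.rpow_nonneg hRp.le _)
      (integral_nonneg fun x => Real.rpow_nonneg (hn x) p)
    have h1 : A ^ (1 / p) ≤ R ^ (-(3 * η)) := by
      rw [Real.rpow_neg hRp.le, ← one_div, le_div_iff₀ (Real.rpow_pos_of_pos hRp _), mul_comm]
      exact hR
    calc A = (A ^ (1 / p)) ^ p := by
          rw [← Real.rpow_mul hA0, one_div, inv_mul_cancel₀ hp0.ne', Real.rpow_one]
      _ ≤ (R ^ (-(3 * η))) ^ p := Real.rpow_le_rpow (Real.rpow_nonneg hA0 _) h1 hp0.le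
      _ = R ^ (-(3 * η * p)) := by rw [← Real.rpow_mul hRp.le, neg_mul])
  refine ⟨27 * M, fun R hR => ?_⟩
  calc _ ≤ ∫ x in closedBall (0 : E3) (2 * R), 27 * vecNorm u x ^ 3 :=
        setIntegral_closedBall_mono (by fun_prop) (by fun_prop) fun x _ => by
          have := pow_le_pow_left₀ (absSum_nonneg _ x) (absSum_le_vecNorm u x) 3
          rw [mul_pow] at this
          norm_num at this
          exact this
    _ ≤ 27 * M * R ^ (1 - σ) := by
        rw [integral_const_mul, mul_assoc]
        have := hM R hR
        gcongr

lemma exists_growthBounds (hu : ContDiff ℝ (⊤ : ℕ∞) u) (hv : ContDiff ℝ (⊤ : ℕ∞) v) {γ p : ℝ}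
    (hannv : ∃ C : ℝ, ∀ R : ℝ, 1 ≤ R → ∫ x in ann R, gradSq v x ≤ C)
    (hγ : γ < 3) (hp : 3 ≤ p) (hη : 0 < γ / p - 3 / p + 2 / 3)
    (hvm : ∀ i k : Fin 3, MemMorrey p γ (fun x => pd i (fun y => v y k) x))
    (hdec : Tendsto (fun R : ℝ => R ^ (3 * (γ / p - 3 / p + 2 / 3)) *
      (R ^ (-γ) * ∫ x in ann R, |vecNorm u x| ^ p) ^ (1 / p)) atTop (nhds 0)) :
    ∃ σ μ : ℝ, GrowthBounds (absSum fun i y => u y i) (absGrad fun k y => v y k) σ μ := by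
  set η := γ / p - 3 / p + 2 / 3 with hηd
  set σ := min (6 * η) (1 / 3) with hσ
  have hσ0 : 0 < σ := lt_min (by positivity) (by norm_num)
  have hσ1 : σ ≤ 1 / 3 := min_le_right _ _
  obtain ⟨A, hA⟩ := exists_absSum_cube_growth hu hp hηd (σ := σ) (min_le_left _ _)
    (by linarith) hdec
  obtain ⟨B, hB⟩ := exists_gradSq_growth hv hannv
  obtain ⟨D, hD⟩ := exists_absGrad_cube_growth hv hγ hp hvm
  have ca := continuous_absSum fun i => (smooth3_component hu i).continuous
  have h0 := unitVol_pos
  have hA' : ∀ R : ℝ, 1 ≤ R → ∫ x in closedBall (0 : E3) (2 * R),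
      absSum (fun i y => u y i) x ^ 3 ≤ |A| * R ^ (1 - σ) := fun R hR =>
    (hA R hR).trans (mul_le_mul_of_nonneg_right (le_abs_self A)
      (Real.rpow_nonneg (by linarith) _))
  have hA2 := exists_sq_growth_of_cube ca (absSum_nonneg _) hσ0 (abs_nonneg A) hA'
  have nA := abs_nonneg A
  have nB := abs_nonneg B
  have nD := abs_nonneg D
  refine ⟨σ, 1 + (|A| + 8 * unitVol) + |B| + |D|, hσ0, hσ1, by linarith, fun R hR => ?_,
    fun R hR => ?_, fun R hR => ?_, fun R hR => ?_⟩
  · exact (hA2 R hR).trans (mul_le_mul_of_nonneg_right (by linarith)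
      (Real.rpow_nonneg (by linarith) _))
  · exact (hA' R hR).trans (mul_le_mul_of_nonneg_right (by linarith)
      (Real.rpow_nonneg (by linarith) _))
  · exact (hB R hR).trans (mul_le_mul_of_nonneg_right (by linarith [le_abs_self B])
      (by linarith))
  · exact (hD R hR).trans (mul_le_mul_of_nonneg_right (by linarith [le_abs_self D])
      (by positivity))

end Assembly

section Reduction

variable {u v : E3 → Fin 3 → ℝ} {P : E3 → ℝ}

lemma sum_mul_pd_eq_zero (hv : ContDiff ℝ (⊤ : ℕ∞) v) (hunit : ∀ x : E3, ∑ i, (v x i) ^ 2 = 1)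
    (i : Fin 3) (x : E3) : ∑ k, pd i (fun y => v y k) x * v x k = 0 := by
  have hd : ∀ k, DifferentiableAt ℝ (fun y => v y k) x := fun k =>
    (smooth3_component hv k).differentiableAt x
  have h1 : pd i (fun y => ∑ k, v y k * v y k) x = 0 := by
    have : (fun y => ∑ k, v y k * v y k) = fun _ => (1 : ℝ) := by
      funext y
      rw [← hunit y]
      exact Finset.sum_congr rfl fun k _ => (sq _).symm
    rw [this]
    simp [pd]
  rw [pd_sum fun k _ => (hd k).fun_mul (hd k)] at h1
  have h2 : ∀ k, pd i (fun y => v y k * v y k) x = 2 * (pd i (fun y => v y k) x * v x k) :=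
    fun k => by rw [pd_mul (hd k) (hd k)]; ring
  simp only [h2, ← Finset.mul_sum] at h1
  linarith

lemma pd_gradSq (hv : ContDiff ℝ (⊤ : ℕ∞) v) (i : Fin 3) (x : E3) :
    pd i (gradSq v) x =
      2 * ∑ j, ∑ k, pd j (fun y => v y k) x * pd j (pd i fun y => v y k) x := by
  have hd : ∀ j k, DifferentiableAt ℝ (pd j fun y => v y k) x := fun j k =>
    ((smooth3_component hv k).pd j).differentiableAt x
  have h : gradSq v = fun x => ∑ j, ∑ k, pd j (fun y => v y k) x * pd j (fun y => v y k) x := by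
    funext y
    simp only [gradSq, sq]
  rw [h, pd_sum fun j _ => DifferentiableAt.fun_sum fun k _ => (hd j k).fun_mul (hd j k),
    Finset.mul_sum]
  refine Finset.sum_congr rfl fun j _ => ?_
  rw [pd_sum fun k _ => (hd j k).fun_mul (hd j k), Finset.mul_sum]
  refine Finset.sum_congr rfl fun k _ => ?_
  rw [pd_mul (hd j k) (hd j k), pd_comm (smooth3_component hv k) j i]
  ring

/-- The divergence of the elastic stress. -/
lemma sum_pd_stress (hv : ContDiff ℝ (⊤ : ℕ∞) v) (i : Fin 3) (x : E3) :
    ∑ j, ∑ k, pd j (fun y => pd i (fun z => v z k) y * pd j (fun z => v z k) y) x =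
      1 / 2 * pd i (gradSq v) x + ∑ k, pd i (fun y => v y k) x * lap (fun y => v y k) x := by
  have hd : ∀ j k, DifferentiableAt ℝ (pd j fun y => v y k) x := fun j k =>
    ((smooth3_component hv k).pd j).differentiableAt x
  rw [pd_gradSq hv]
  simp only [fun j k => pd_mul (j := j) (hd i k) (hd j k), lap, Finset.mul_sum,
    Finset.sum_add_distrib]
  rw [Finset.sum_comm (f := fun j k => pd i (fun y => v y k) x * pd j (pd j fun y => v y k) x)]
  congr 1
  refine Finset.sum_congr rfl fun j _ => Finset.sum_congr rfl fun k _ => ?_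
  ring

lemma sum_pd_mul_lap (hv : ContDiff ℝ (⊤ : ℕ∞) v) (hunit : ∀ x : E3, ∑ i, (v x i) ^ 2 = 1)
    (hsol : StatEL u P v) (i : Fin 3) (x : E3) :
    ∑ k, pd i (fun y => v y k) x * lap (fun y => v y k) x =
      ∑ k, pd i (fun y => v y k) x * transport (fun i y => u y i) (fun k y => v y k) k x := by
  have h : ∀ k, transport (fun i y => u y i) (fun k y => v y k) k x =
      lap (fun y => v y k) x + gradSq v x * v x k := fun k => by
    have := hsol.2.1 x k
    unfold transport
    linarith
  have h0 := sum_mul_pd_eq_zero hv hunit i x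
  have e : ∑ k, pd i (fun y => v y k) x * (gradSq v x * v x k) =
      gradSq v x * ∑ k, pd i (fun y => v y k) x * v x k := by
    rw [Finset.mul_sum]
    exact Finset.sum_congr rfl fun k _ => by ring
  simp only [h, mul_add, Finset.sum_add_distrib]
  rw [e, h0, mul_zero, add_zero]

lemma StatEL.reducedEL (hu : ContDiff ℝ (⊤ : ℕ∞) u) (hP : ContDiff ℝ (⊤ : ℕ∞) P)
    (hv : ContDiff ℝ (⊤ : ℕ∞) v) (hunit : ∀ x : E3, ∑ i, (v x i) ^ 2 = 1)
    (hsol : StatEL u P v) :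
    ReducedEL (fun i y => u y i) (fun k y => v y k) fun x => P x + 1 / 2 * gradSq v x where
  smooth_u := smooth3_component hu
  smooth_v := smooth3_component hv
  smooth_Q := hP.add (contDiff_const.mul (smooth3_gradSq hv))
  div_free := hsol.2.2
  momentum i x := by
    have h1 := hsol.1 x i
    have dg := (smooth3_gradSq hv).differentiableAt x
    rw [sum_pd_stress hv, sum_pd_mul_lap hv hunit hsol] at h1
    rw [pd_add (Smooth3.differentiableAt hP x) (dg.const_mul _), pd_const_mul _ dg]
    linarith

end Reduction

section Pohozaev

variable {v : E3 → Fin 3 → ℝ}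

/-- The stress-energy tensor `∂_i v · ∂_j v - ½|∇v|² δ_ij`. -/
def stressEnergy (v : E3 → Fin 3 → ℝ) (i j : Fin 3) (x : E3) : ℝ :=
  ∑ k, pd i (fun y => v y k) x * pd j (fun y => v y k) x -
    1 / 2 * (if i = j then gradSq v x else 0)

lemma smooth3_stressEnergy (hv : ContDiff ℝ (⊤ : ℕ∞) v) (i j : Fin 3) :
    Smooth3 (stressEnergy v i j) := by
  refine (ContDiff.sum fun k _ => ((smooth3_component hv k).pd i).mul
    ((smooth3_component hv k).pd j)).sub (contDiff_const.mul ?_)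
  split_ifs
  · exact smooth3_gradSq hv
  · exact contDiff_const

lemma abs_stressEnergy_le (v : E3 → Fin 3 → ℝ) (i j : Fin 3) (x : E3) :
    |stressEnergy v i j x| ≤ 2 * gradSq v x := by
  have hg := gradSq_nonneg v x
  have hs : ∀ i, ∑ k, pd i (fun y => v y k) x ^ 2 ≤ gradSq v x := fun i =>
    Finset.single_le_sum (f := fun i => ∑ k, pd i (fun y => v y k) x ^ 2)
      (fun _ _ => Finset.sum_nonneg fun _ _ => sq_nonneg _) (Finset.mem_univ i)
  have h1 : |∑ k, pd i (fun y => v y k) x * pd j (fun y => v y k) x| ≤ gradSq v x := by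
    refine (Finset.abs_sum_le_sum_abs _ _).trans ?_
    calc _ ≤ ∑ k, (1 / 2 * pd i (fun y => v y k) x ^ 2 + 1 / 2 * pd j (fun y => v y k) x ^ 2) :=
          Finset.sum_le_sum fun k _ => by
            rw [abs_mul, ← sq_abs (pd i _ x), ← sq_abs (pd j _ x)]
            linarith [sq_nonneg (|pd i (fun y => v y k) x| - |pd j (fun y => v y k) x|)]
      _ ≤ gradSq v x := by
          rw [Finset.sum_add_distrib, ← Finset.mul_sum, ← Finset.mul_sum]
          linarith [hs i, hs j]
  have h2 : |1 / 2 * (if i = j then gradSq v x else 0)| ≤ gradSq v x := by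
    split_ifs
    · rw [abs_of_nonneg (by positivity)]; linarith
    · simpa using hg
  exact (abs_sub _ _).trans (by linarith)

lemma sum_stressEnergy_diag (v : E3 → Fin 3 → ℝ) (x : E3) :
    ∑ i, stressEnergy v i i x = -(1 / 2) * gradSq v x := by
  have : ∑ i, ∑ k, pd i (fun y => v y k) x * pd i (fun y => v y k) x = gradSq v x := by
    simp only [gradSq, sq]
  simp only [stressEnergy, if_true, Finset.sum_sub_distrib, this, Finset.sum_const,
    Finset.card_univ, Fintype.card_fin, nsmul_eq_mul]
  push_cast
  ring

lemma sum_pd_stressEnergy (hv : ContDiff ℝ (⊤ : ℕ∞) v)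
    (h : ∀ i x, ∑ k, pd i (fun y => v y k) x * lap (fun y => v y k) x = 0) (i : Fin 3) (x : E3) :
    ∑ j, pd j (stressEnergy v i j) x = 0 := by
  have hd : ∀ j k, DifferentiableAt ℝ (pd j fun y => v y k) x := fun j k =>
    ((smooth3_component hv k).pd j).differentiableAt x
  have dg := (smooth3_gradSq hv).differentiableAt x
  have hj : ∀ j, pd j (stressEnergy v i j) x =
      ∑ k, pd j (fun y => pd i (fun z => v z k) y * pd j (fun z => v z k) y) x -
        if i = j then 1 / 2 * pd i (gradSq v) x else 0 := by
    intro j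
    have hs : DifferentiableAt ℝ
        (fun y => ∑ k, pd i (fun z => v z k) y * pd j (fun z => v z k) y) x :=
      DifferentiableAt.fun_sum fun k _ => (hd i k).fun_mul (hd j k)
    rw [← pd_sum fun k _ => (hd i k).fun_mul (hd j k)]
    unfold stressEnergy
    by_cases hij : i = j
    · subst hij
      simp only [if_true]
      rw [pd_sub hs (dg.const_mul _), pd_const_mul _ dg]
    · simp [hij]
  simp only [hj, Finset.sum_sub_distrib, Finset.sum_ite_eq, Finset.mem_univ, if_true]
  rw [sum_pd_stress hv, h]
  ring

end Pohozaev

section PohozaevIdentity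

variable {v : E3 → Fin 3 → ℝ}

lemma pohozaev_identity (hv : ContDiff ℝ (⊤ : ℕ∞) v)
    (h : ∀ i x, ∑ k, pd i (fun y => v y k) x * lap (fun y => v y k) x = 0) {φ : E3 → ℝ} {q : ℝ}
    (hφ : Smooth3 φ) (hφ0 : ∀ x, q < ‖x‖ → φ x = 0) :
    1 / 2 * ∫ x, gradSq v x * φ x = ∑ i, ∑ j, ∫ x, stressEnergy v i j x * (x i * pd j φ x) := by
  have sT := smooth3_stressEnergy hv
  have hc := hasCompactSupport_of_eq_zero hφ0
  have sx : ∀ i, Smooth3 fun x : E3 => x i * φ x := fun i => (smooth3_coord i).mul hφ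
  have hcx : ∀ i, HasCompactSupport fun x : E3 => x i * φ x := fun i => hc.mul_left
  have hpc : ∀ j, HasCompactSupport (pd j φ) := fun j => hc.fderiv_apply (𝕜 := ℝ) _
  have i1 : ∀ i j, Integrable fun x => stressEnergy v i j x * ((if j = i then 1 else 0) * φ x) :=
    fun i j => ((sT i j).continuous.mul (continuous_const.mul
      hφ.continuous)).integrable_of_hasCompactSupport (hc.mul_left.mul_left)
  have i2 : ∀ i j, Integrable fun x : E3 => stressEnergy v i j x * (x i * pd j φ x) :=
    fun i j => ((sT i j).continuous.mul ((smooth3_coord i).continuous.mul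
      (hφ.pd j).continuous)).integrable_of_hasCompactSupport ((hpc j).mul_left.mul_left)
  have i3 : ∀ i j, Integrable fun x : E3 => pd j (stressEnergy v i j) x * (x i * φ x) :=
    fun i j => (((sT i j).pd j).continuous.mul (sx i).continuous).integrable_of_hasCompactSupport
      (hcx i).mul_left
  have hparts : ∀ i j, (∫ x, stressEnergy v i j x * ((if j = i then 1 else 0) * φ x)) +
      ∫ x, stressEnergy v i j x * (x i * pd j φ x) =
        -∫ x, pd j (stressEnergy v i j) x * (x i * φ x) := by
    intro i j
    rw [← integral_mul_pd ((sT i j).of_le (by simp)) ((sx i).of_le (by simp)) (hcx i) j,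
      ← integral_add (i1 i j) (i2 i j)]
    refine integral_congr_ae (ae_of_all _ fun x => ?_)
    simp only
    rw [pd_mul ((smooth3_coord i).differentiableAt x) (hφ.differentiableAt x), pd_coord]
    ring
  have hdiv : ∑ i, ∑ j, ∫ x, pd j (stressEnergy v i j) x * (x i * φ x) = 0 := by
    refine Finset.sum_eq_zero fun i _ => ?_
    rw [← integral_finsetSum _ fun j _ => i3 i j]
    simp only [← Finset.sum_mul, sum_pd_stressEnergy hv h, zero_mul, integral_zero]
  have hdiag : ∑ i, ∑ j, ∫ x, stressEnergy v i j x * ((if j = i then 1 else 0) * φ x) =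
      -(1 / 2 * ∫ x, gradSq v x * φ x) := by
    rw [← integral_const_mul, ← integral_neg]
    simp only [← integral_finsetSum _ fun j _ => i1 _ j]
    rw [← integral_finsetSum _ fun i _ => integrable_finsetSum _ fun j _ => i1 i j]
    refine integral_congr_ae (ae_of_all _ fun x => ?_)
    simp only [ite_mul, one_mul, zero_mul, mul_ite, mul_zero, Finset.sum_ite_eq',
      Finset.mem_univ, if_true, ← Finset.sum_mul, sum_stressEnergy_diag]
    ring
  have hsum := Finset.sum_congr rfl fun i (_ : i ∈ (Finset.univ : Finset (Fin 3))) =>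
    Finset.sum_congr rfl fun j (_ : j ∈ (Finset.univ : Finset (Fin 3))) => hparts i j
  simp only [Finset.sum_add_distrib, Finset.sum_neg_distrib] at hsum
  rw [hdiag, hdiv] at hsum
  linarith

lemma exists_gradSq_le_ann : ∃ K : ℝ, ∀ v : E3 → Fin 3 → ℝ, ContDiff ℝ (⊤ : ℕ∞) v →
    (∀ i x, ∑ k, pd i (fun y => v y k) x * lap (fun y => v y k) x = 0) → ∀ R : ℝ, 0 < R →
    ∫ x in closedBall (0 : E3) R, gradSq v x ≤ K * ∫ x in ann (2 * R), gradSq v x := by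
  obtain ⟨C, hC, hcut⟩ := exists_cutoff
  refine ⟨18 * (16 * C), fun v hv h R hR => ?_⟩
  obtain ⟨φ, hφ, hφ1, hφ0, hφn, -, hφd, -⟩ :=
    hcut (5 / 4 * R) (3 / 2 * R) (by positivity) (by linarith)
  have cg := (smooth3_gradSq hv).continuous
  have hpoho := pohozaev_identity hv h hφ hφ0
  have hlow : ∫ x in closedBall (0 : E3) R, gradSq v x ≤ ∫ x, gradSq v x * φ x := by
    calc _ = ∫ x in closedBall (0 : E3) R, gradSq v x * φ x :=
          setIntegral_congr_fun measurableSet_closedBall fun x hx => by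
            have hx : ‖x‖ ≤ R := by simpa using hx
            rw [hφ1 x (by linarith), mul_one]
      _ ≤ _ := setIntegral_le_integral ((cg.mul hφ.continuous).integrable_of_hasCompactSupport
          (hasCompactSupport_of_eq_zero hφ0).mul_left)
          (ae_of_all _ fun x => mul_nonneg (gradSq_nonneg v x) (hφn x))
  have hterm : ∀ i j, ∫ x, stressEnergy v i j x * (x i * pd j φ x) ≤
      16 * C * ∫ x in ann (2 * R), gradSq v x := by
    intro i j
    have hout : ∀ x : E3, x ∉ ann (2 * R) → stressEnergy v i j x * (x i * pd j φ x) = 0 := by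
      intro x hx
      have hz : pd j φ x = 0 := by
        rcases le_or_gt ‖x‖ R with hle | hlt
        · have : φ =ᶠ[nhds x] fun _ => (1 : ℝ) := by
            filter_upwards [(isOpen_lt continuous_norm continuous_const).mem_nhds
              (show ‖x‖ < 5 / 4 * R by linarith)] with y hy
            exact hφ1 y (le_of_lt hy)
          simp [pd, this.fderiv_eq]
        · refine pd_eq_zero_of_eqOn_compl hφ0 ?_
          have : ¬ ‖x‖ < 2 * R := fun h2 => hx ⟨by linarith, h2⟩
          linarith
      rw [hz, mul_zero, mul_zero]
    rw [← setIntegral_eq_integral_of_forall_compl_eq_zero hout, ← integral_const_mul]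
    refine (Real.le_norm_self _).trans (norm_integral_le_of_norm_le
      ((integrableOn_ann cg (2 * R)).const_mul (16 * C)) ?_)
    refine (ae_restrict_iff' (measurableSet_ann _)).2 (ae_of_all _ fun x hx => ?_)
    have hx2 : |x i| ≤ 2 * R := (abs_coord_le_norm x i).trans hx.2.le
    have hd := hφd j x
    have e : C / (3 / 2 * R - 5 / 4 * R) = 4 * C / R := by field_simp; norm_num
    rw [e] at hd
    rw [Real.norm_eq_abs, abs_mul, abs_mul]
    have hg := gradSq_nonneg v x
    calc _ ≤ 2 * gradSq v x * (2 * R * (4 * C / R)) := by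
          gcongr
          exact abs_stressEnergy_le v i j x
      _ = 16 * C * gradSq v x := by field_simp; ring
  have hsum : ∑ i, ∑ j, ∫ x, stressEnergy v i j x * (x i * pd j φ x) ≤
      ∑ _i : Fin 3, ∑ _j : Fin 3, 16 * C * ∫ x in ann (2 * R), gradSq v x :=
    Finset.sum_le_sum fun i _ => Finset.sum_le_sum fun j _ => hterm i j
  simp only [Finset.sum_const, Finset.card_univ, Fintype.card_fin, nsmul_eq_mul] at hsum
  push_cast at hsum
  linarith

/-- Finite annular energy forces maps with divergence-free stress-energy to be constant. -/
lemma gradSq_eq_zero (hv : ContDiff ℝ (⊤ : ℕ∞) v)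
    (h : ∀ i x, ∑ k, pd i (fun y => v y k) x * lap (fun y => v y k) x = 0)
    (hann : ∃ C : ℝ, ∀ R : ℝ, 1 ≤ R → ∫ x in ann R, gradSq v x ≤ C) (x : E3) :
    gradSq v x = 0 := by
  obtain ⟨K, hK⟩ := exists_gradSq_le_ann
  obtain ⟨C, hC⟩ := hann
  have cg := (smooth3_gradSq hv).continuous
  have g0 := gradSq_nonneg v
  set I : ℝ → ℝ := fun R => ∫ x in closedBall (0 : E3) R, gradSq v x with hI
  have hmono : Monotone I := fun r q hrq => setIntegral_closedBall_mono_radius cg g0 hrq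
  have hle : ∀ R : ℝ, 1 ≤ R → I R ≤ |K| * ∫ x in ann (2 * R), gradSq v x := fun R hR =>
    (hK v hv h R (by linarith)).trans (mul_le_mul_of_nonneg_right (le_abs_self K)
      (integral_nonneg fun x => g0 x))
  have hbdd : BddAbove (Set.range I) := by
    refine ⟨|K| * C, ?_⟩
    rintro _ ⟨R, rfl⟩
    refine (hmono (le_max_left R 1)).trans ((hle _ (le_max_right R 1)).trans ?_)
    exact mul_le_mul_of_nonneg_left (hC _ (by linarith [le_max_right R 1])) (abs_nonneg K)
  have hlim := tendsto_atTop_ciSup hmono hbdd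
  have hlim2 : Tendsto (fun R => |K| * (I (2 * R) - I R)) atTop (nhds 0) := by
    have h2 := hlim.comp (tendsto_id.const_mul_atTop (zero_lt_two (α := ℝ)))
    simpa using (h2.sub hlim).const_mul |K|
  refine eq_zero_of_setIntegral_tendsto cg g0 hlim2 ?_ x
  filter_upwards [eventually_ge_atTop 1] with R hR
  refine (hle R hR).trans (mul_le_mul_of_nonneg_left ?_ (abs_nonneg K))
  have hd : Disjoint (closedBall (0 : E3) R) (ann (2 * R)) :=
    Set.disjoint_left.2 fun y hy hy' => by
      have h1 : ‖y‖ ≤ R := by simpa using hy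
      linarith [hy'.1]
  have hu := setIntegral_union hd (measurableSet_ann (2 * R)) (integrableOn_closedBall cg 0 R)
    (integrableOn_ann cg (2 * R))
  have hs : ∫ x in closedBall (0 : E3) R ∪ ann (2 * R), gradSq v x ≤ I (2 * R) := by
    refine setIntegral_mono_set (integrableOn_closedBall cg 0 (2 * R)) (ae_of_all _ g0)
      (LE.le.eventuallyLE ?_)
    rintro y (hy | hy)
    · exact closedBall_subset_closedBall (by linarith) hy
    · simpa using hy.2.le
  linarith

end PohozaevIdentity

theorem liouville_stationary_EL_eta_pos
    (u v : E3 → Fin 3 → ℝ) (P : E3 → ℝ) (γ p : ℝ)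
    (hu : ContDiff ℝ (⊤ : ℕ∞) u) (hP : ContDiff ℝ (⊤ : ℕ∞) P)
    (hv : ContDiff ℝ (⊤ : ℕ∞) v)
    (hunit : ∀ x : E3, ∑ i, (v x i) ^ 2 = 1)
    (hsol : StatEL u P v)
    (hannv : ∃ C : ℝ, ∀ R : ℝ, 1 ≤ R → ∫ x in ann R, gradSq v x ≤ C)
    (hγ0 : 0 < γ) (hγ3 : γ < 3) (hp3 : 3 ≤ p)
    (hη : 0 < γ / p - 3 / p + 2 / 3)
    (hum : MemMorrey0 p γ (vecNorm u))
    (hvm : ∀ i k : Fin 3, MemMorrey p γ (fun x => pd i (fun y => v y k) x))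
    (hdec : Tendsto
      (fun R : ℝ => R ^ (3 * (γ / p - 3 / p + 2 / 3)) *
        (R ^ (-γ) * ∫ x in ann R, |vecNorm u x| ^ p) ^ (1 / p))
      atTop (nhds 0)) :
    (∀ x : E3, ∀ i : Fin 3, u x i = 0) ∧
    (∀ x : E3, ∀ i k : Fin 3, pd i (fun y => v y k) x = 0) ∧
    (∃ c : ℝ, ∀ x : E3, P x = c) := by
  have H := hsol.reducedEL hu hP hv hunit
  obtain ⟨σ, μ, B⟩ := exists_growthBounds hu hv hannv hγ3 hp3 hη hvm hdec
  have hu0 : ∀ x i, u x i = 0 := fun x i => H.eq_zero B i x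
  have hlap : ∀ i x, ∑ k, pd i (fun y => v y k) x * lap (fun y => v y k) x = 0 := fun i x => by
    rw [sum_pd_mul_lap hv hunit hsol]
    simp [transport, hu0]
  have hg := gradSq_eq_zero hv hlap hannv
  have hpd : ∀ (x : E3) (i k : Fin 3), pd i (fun y => v y k) x = 0 := fun x i k => by
    have h1 := (Finset.sum_eq_zero_iff_of_nonneg fun i _ =>
      Finset.sum_nonneg fun k _ => sq_nonneg (pd i (fun y => v y k) x)).1 (hg x) i
      (Finset.mem_univ i)
    exact pow_eq_zero_iff two_ne_zero |>.1 ((Finset.sum_eq_zero_iff_of_nonneg fun k _ =>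
      sq_nonneg (pd i (fun y => v y k) x)).1 h1 k (Finset.mem_univ k))
  refine ⟨hu0, hpd, P 0, fun x => eq_const_of_pd_eq_zero hP (fun j y => ?_) x 0⟩
  have hc : ∀ i, pd i (fun _ => (0 : ℝ)) = fun _ => 0 := fun i => by
    funext z
    simp [pd]
  simpa [hg, hu0, hpd, lap, hc] using H.momentum j y
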